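/- The Diophantine equation (F_{m+1}^{(k)})^x − (F_{m-1}^{(k)})^x = F_n^{(k)} has no positive integer solutions m, n, k, x with x ≥ 2 and 3 ≤ k ≤ min{m, log x} (where log denotes the natural logarithm). -/

import Mathlib

open Finset Polynomial

/-- `α` is the dominant root of `X ^ k - X ^ (k - 1) - ⋯ - 1`. -/
structure DominantRoot (k : ℕ) (α : ℝ) : Prop where
  three_le : 3 ≤ k
  eqn : α ^ k * (2 - α) = 1
  lower : 9 / 5 < α
  upper : α < 2

theorem exists_dominantRoot {k : ℕ} (hk : 3 ≤ k) : ∃ α, DominantRoot k α := by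
  have hcont : ContinuousOn (fun a : ℝ => a ^ k * (2 - a)) (Set.Icc (9 / 5) 2) := by fun_prop
  have h := intermediate_value_Ioo' (by norm_num : (9 / 5 : ℝ) ≤ 2) hcont
  have h1 : (1 : ℝ) ∈ Set.Ioo ((2 : ℝ) ^ k * (2 - 2)) ((9 / 5 : ℝ) ^ k * (2 - 9 / 5)) := by
    refine ⟨by norm_num, ?_⟩
    have : (9 / 5 : ℝ) ^ 3 ≤ (9 / 5) ^ k := pow_le_pow_right₀ (by norm_num) hk
    norm_num at this ⊢
    linarith
  obtain ⟨a, ha, hae⟩ := h h1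
  exact ⟨a, hk, hae, ha.1, ha.2⟩

theorem DominantRoot.sum_pow_eq {k : ℕ} {α : ℝ} (h : DominantRoot k α) :
    ∑ i ∈ range k, α ^ i = α ^ k := by
  have h1 := h.lower
  rw [geom_sum_eq (by linarith), div_eq_iff (by linarith)]
  linear_combination h.eqn

/-- The coefficients of the cofactor of `X - α`. -/
noncomputable def cofactorCoeff (α : ℝ) (i : ℕ) : ℝ := (1 - (α ^ i)⁻¹) / (α - 1)

theorem DominantRoot.mul_cofactorCoeff_succ {k : ℕ} {α : ℝ} (h : DominantRoot k α) (i : ℕ) :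
    α * cofactorCoeff α (i + 1) = 1 + cofactorCoeff α i := by
  have h1 := h.lower
  have h2 : α - 1 ≠ 0 := by linarith
  have h3 : α ≠ 0 := by linarith
  unfold cofactorCoeff
  field_simp
  ring

theorem cofactorCoeff_zero (α : ℝ) : cofactorCoeff α 0 = 0 := by simp [cofactorCoeff]

theorem DominantRoot.cofactorCoeff_self {k : ℕ} {α : ℝ} (h : DominantRoot k α) :
    cofactorCoeff α k = 1 := by
  have h1 := h.lower
  have h2 : α - 1 ≠ 0 := by linarith
  have h4 : (α ^ k)⁻¹ = 2 - α := inv_eq_of_mul_eq_one_right h.eqn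
  rw [cofactorCoeff, h4, div_eq_one_iff_eq h2]
  ring

theorem DominantRoot.cofactorCoeff_mono {k : ℕ} {α : ℝ} (h : DominantRoot k α) (i : ℕ) :
    cofactorCoeff α i ≤ cofactorCoeff α (i + 1) := by
  have h1 := h.lower
  unfold cofactorCoeff
  have : (α ^ (i + 1))⁻¹ ≤ (α ^ i)⁻¹ :=
    inv_anti₀ (by positivity) (pow_le_pow_right₀ (by linarith) (by omega))
  have h2 : 0 ≤ α - 1 := by linarith
  gcongr

/-- A solution of the recurrence in the hyperplane complementary to the dominant one is bounded by
its initial values. -/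
theorem DominantRoot.norm_le_of_recurrence {k : ℕ} {α : ℝ} (h : DominantRoot k α) (G : ℕ → ℂ)
    (hG : ∀ m, G (m + k) = ∑ i ∈ range k, G (m + i))
    (hG0 : ∑ i ∈ range k, (cofactorCoeff α (i + 1) : ℂ) * G i = 0) {C : ℝ}
    (hC : ∀ i < k, ‖G i‖ ≤ C) (m : ℕ) : ‖G m‖ ≤ C := by
  set γ := cofactorCoeff α with hγ
  have hγ0 : γ 0 = 0 := cofactorCoeff_zero α
  have hγk : γ k = 1 := h.cofactorCoeff_self
  have hshift : ∀ m, ∑ i ∈ range k, (γ (i + 1) : ℂ) * G (m + 1 + i) =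
      ∑ i ∈ range k, (γ i : ℂ) * G (m + i) + G (m + k) := by
    intro m
    have e1 := sum_range_succ (fun i => (γ i : ℂ) * G (m + i)) k
    have e2 := sum_range_succ' (fun i => (γ i : ℂ) * G (m + i)) k
    rw [e1, hγk, hγ0] at e2
    simp only [Complex.ofReal_one, one_mul, Complex.ofReal_zero, zero_mul, add_zero] at e2
    rw [e2]
    exact sum_congr rfl fun i _ => by rw [show m + 1 + i = m + (i + 1) by ring]
  have hW : ∀ m, ∑ i ∈ range k, (γ (i + 1) : ℂ) * G (m + i) = 0 := by
    intro m
    induction m with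
    | zero => simpa using hG0
    | succ m ih =>
      rw [hshift, hG, ← sum_add_distrib]
      have : ∀ i ∈ range k, (γ i : ℂ) * G (m + i) + G (m + i) =
          α * ((γ (i + 1) : ℂ) * G (m + i)) := by
        intro i _
        have e : (α : ℂ) * γ (i + 1) = 1 + γ i := by exact_mod_cast h.mul_cofactorCoeff_succ i
        rw [← mul_assoc, e]; ring
      rw [sum_congr rfl this, ← mul_sum, ih, mul_zero]
  induction m using Nat.strong_induction_on with
  | _ m ih =>
    rcases lt_or_ge m k with hm | hm
    · exact hC m hm
    · obtain ⟨n, rfl⟩ : ∃ n, m = n + k := ⟨m - k, by omega⟩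
      have e1 := hshift n
      rw [hW (n + 1)] at e1
      have e2 : G (n + k) = ∑ i ∈ range k, ((γ (i + 1) - γ i : ℝ) : ℂ) * G (n + i) := by
        have : ∀ i ∈ range k, ((γ (i + 1) - γ i : ℝ) : ℂ) * G (n + i) =
            (γ (i + 1) : ℂ) * G (n + i) - (γ i : ℂ) * G (n + i) := fun i _ => by
          push_cast; ring
        rw [sum_congr rfl this, sum_sub_distrib, hW n]
        linear_combination -e1
      have hsum : ∑ i ∈ range k, (γ (i + 1) - γ i) = 1 := by
        rw [sum_range_sub, hγk, hγ0, sub_zero]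
      rw [e2]
      refine (norm_sum_le _ _).trans ?_
      calc ∑ i ∈ range k, ‖((γ (i + 1) - γ i : ℝ) : ℂ) * G (n + i)‖
          ≤ ∑ i ∈ range k, (γ (i + 1) - γ i) * C := by
            refine sum_le_sum fun i hi => ?_
            have hd : 0 ≤ γ (i + 1) - γ i := sub_nonneg.2 (h.cofactorCoeff_mono i)
            rw [norm_mul, Complex.norm_real, Real.norm_of_nonneg hd]
            have := mem_range.1 hi
            exact mul_le_mul_of_nonneg_left (ih (n + i) (by omega)) hd
        _ = C := by rw [← sum_mul, hsum, one_mul]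

/-- The other roots of the characteristic polynomial lie in the closed unit disc. -/
theorem DominantRoot.norm_le_one {k : ℕ} {α : ℝ} (h : DominantRoot k α) {β : ℂ} (hβ : β ≠ α)
    (hroot : ∑ i ∈ range k, β ^ i = β ^ k) : ‖β‖ ≤ 1 := by
  have hk := h.three_le
  have hG0 : ∑ i ∈ range k, (cofactorCoeff α (i + 1) : ℂ) * β ^ i = 0 := by
    have e : (β - α) * ∑ i ∈ range k, (cofactorCoeff α (i + 1) : ℂ) * β ^ i = 0 := by
      have e1 := sum_range_succ (fun i => (cofactorCoeff α i : ℂ) * β ^ i) k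
      have e2 := sum_range_succ' (fun i => (cofactorCoeff α i : ℂ) * β ^ i) k
      rw [e1, h.cofactorCoeff_self, cofactorCoeff_zero] at e2
      simp only [Complex.ofReal_one, one_mul, Complex.ofReal_zero, zero_mul, add_zero] at e2
      have e3 : ∀ i ∈ range k, (β - α) * ((cofactorCoeff α (i + 1) : ℂ) * β ^ i) =
          (cofactorCoeff α (i + 1) : ℂ) * β ^ (i + 1) - ((cofactorCoeff α i : ℂ) * β ^ i + β ^ i) := by
        intro i _
        have e : (α : ℂ) * cofactorCoeff α (i + 1) = 1 + cofactorCoeff α i := by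
          exact_mod_cast h.mul_cofactorCoeff_succ i
        rw [pow_succ]
        linear_combination -β ^ i * e
      rw [mul_sum, sum_congr rfl e3, sum_sub_distrib, sum_add_distrib, hroot]
      linear_combination -e2
    rcases mul_eq_zero.1 e with h1 | h1
    · exact absurd (sub_eq_zero.1 h1) hβ
    · exact h1
  by_contra hlt
  push Not at hlt
  have hb := h.norm_le_of_recurrence (fun m => β ^ m) (fun m => by
    simp only [pow_add, ← mul_sum, hroot]) hG0 (C := ‖β‖ ^ k) (fun i hi => by
    rw [norm_pow]; exact pow_le_pow_right₀ hlt.le hi.le) (k + 1)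
  rw [norm_pow] at hb
  exact absurd (pow_lt_pow_right₀ hlt (Nat.lt_succ_self k)) (not_lt.2 hb)

/-- If `f` takes values at most `N` and takes each value below `N` at most once, then the sum of
its values is at least `0 + 1 + ⋯ + (N - 1)`. -/
theorem sum_ge_of_injOn_lt {N : ℕ} (f : Fin N → ℕ) (hf : ∀ i, f i ≤ N)
    (hinj : ∀ i j, f i < N → f i = f j → i = j) : N * (N - 1) / 2 ≤ ∑ i, f i := by
  have h1 : ∀ i, f i = ∑ j ∈ range N, if j < f i then 1 else 0 := by
    intro i
    rw [← Finset.card_filter]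
    have : (range N).filter (fun j => j < f i) = range (f i) := by
      ext j; simp only [mem_filter, mem_range]; have := hf i; omega
    rw [this, card_range]
  have h2 : ∑ i, f i = ∑ j ∈ range N, ∑ i, if j < f i then 1 else 0 := by
    rw [Finset.sum_comm]; exact Finset.sum_congr rfl fun i _ => h1 i
  have h3 : ∀ j ∈ range N, N - 1 - j ≤ ∑ i, if j < f i then 1 else 0 := by
    intro j hj
    rw [← Finset.card_filter]
    have hcompl := Finset.card_filter_add_card_filter_not (s := (univ : Finset (Fin N)))
      (fun i => j < f i)
    have hle : #{i : Fin N | ¬ j < f i} ≤ j + 1 := by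
      have : #{i : Fin N | ¬ j < f i} ≤ #(range (j + 1)) := by
        refine Finset.card_le_card_of_injOn f ?_ ?_
        · intro i hi
          simp at hi ⊢; omega
        · intro a ha b hb hab
          simp at ha hj
          exact hinj a b (by omega) hab
      simpa using this
    simp only [card_univ, Fintype.card_fin] at hcompl
    omega
  calc N * (N - 1) / 2 = ∑ j ∈ range N, j := (Finset.sum_range_id N).symm
    _ = ∑ j ∈ range N, (N - 1 - j) := (Finset.sum_range_reflect (fun j => j) N).symm
    _ ≤ _ := by rw [h2]; exact Finset.sum_le_sum h3

/-- Leibniz bound for a determinant whose rows are bounded. -/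
theorem norm_det_le_factorial_mul_prod {𝕜 : Type*} [NormedField 𝕜] {N : ℕ}
    (A : Matrix (Fin N) (Fin N) 𝕜) (c : Fin N → ℝ)
    (h : ∀ i j, ‖A i j‖ ≤ c i) : ‖A.det‖ ≤ N.factorial * ∏ i, c i := by
  rw [← Matrix.det_transpose, Matrix.det_apply']
  refine (norm_sum_le _ _).trans ?_
  have : ∀ σ ∈ (univ : Finset (Equiv.Perm (Fin N))),
      ‖((Equiv.Perm.sign σ : ℤ) : 𝕜) * ∏ i, A.transpose (σ i) i‖ ≤ ∏ i, c i := by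
    intro σ _
    rw [norm_mul, norm_prod]
    have h1 : ‖((Equiv.Perm.sign σ : ℤ) : 𝕜)‖ = 1 := by
      rcases Int.units_eq_one_or (Equiv.Perm.sign σ) with h | h <;> simp [h]
    rw [h1, one_mul]
    exact Finset.prod_le_prod (fun i _ => norm_nonneg _) fun i _ => h i (σ i)
  refine (Finset.sum_le_sum this).trans ?_
  simp [Fintype.card_perm]

/-- Upper bound for an interpolation determinant whose rows have expansions in powers of the
column parameter. -/
theorem abs_det_le_of_row_expansions {N : ℕ} (hN : 0 < N) (A : Matrix (Fin N) (Fin N) ℝ) (ρ : ℝ) (hρ : 1 ≤ ρ)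
    (w : Fin N → ℕ → Fin N → ℝ) (a : Fin N → ℕ → ℝ) (z : Fin N → ℝ) (c : Fin N → ℕ → ℝ)
    (hA : ∀ i j, A i j = ∑ n ∈ range (N + 1), w i n j)
    (hw : ∀ i n j, n < N → w i n j = a i n * z j ^ n)
    (hc : ∀ i n j, n ≤ N → |w i n j| ≤ c i n) :
    ρ ^ (N * (N - 1) / 2) * |A.det| ≤
      N.factorial * ∏ i, ∑ n ∈ range (N + 1), c i n * ρ ^ n := by
  classical
  have hexp : A.det = ∑ f ∈ Fintype.piFinset (fun _ : Fin N => range (N + 1)),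
      Matrix.det (fun i j => w i (f i) j) := by
    have h := (Matrix.detRowAlternating (R := ℝ) (n := Fin N)).toMultilinearMap.map_sum_finset
      (fun i n => w i n) (fun _ => range (N + 1))
    have hA' : A = fun i => ∑ n ∈ range (N + 1), w i n := by
      ext i j; rw [hA i j, Finset.sum_apply]
    calc A.det = Matrix.det (fun i => ∑ n ∈ range (N + 1), w i n) := by rw [← hA']
      _ = _ := h
  have hterm : ∀ f ∈ Fintype.piFinset (fun _ : Fin N => range (N + 1)),
      ρ ^ (N * (N - 1) / 2) * |Matrix.det (fun i j => w i (f i) j)| ≤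
        N.factorial * ∏ i, (c i (f i) * ρ ^ (f i)) := by
    intro f hf
    have hfN : ∀ i, f i ≤ N := fun i => by
      have := Fintype.mem_piFinset.1 hf i
      simp at this; omega
    have j0 : Fin N := ⟨0, hN⟩
    have hc0 : ∀ i, 0 ≤ c i (f i) := fun i => (abs_nonneg _).trans (hc i (f i) j0 (hfN i))
    by_cases hinj : ∀ i j, f i < N → f i = f j → i = j
    · have hs := sum_ge_of_injOn_lt f hfN hinj
      have hd := norm_det_le_factorial_mul_prod (fun i j => w i (f i) j) (fun i => c i (f i))
        (fun i j => hc i (f i) j (hfN i))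
      rw [Finset.prod_mul_distrib, Finset.prod_pow_eq_pow_sum, mul_comm]
      rw [← mul_assoc]
      exact mul_le_mul hd (pow_le_pow_right₀ hρ hs) (by positivity)
        (mul_nonneg (by positivity) (Finset.prod_nonneg fun i _ => hc0 i))
    · push Not at hinj
      obtain ⟨i, j, hi, hij, hne⟩ := hinj
      have h0 : Matrix.det (fun i j => w i (f i) j) = 0 := by
        set W : Matrix (Fin N) (Fin N) ℝ := fun i j => w i (f i) j with hW
        have hWij : W = (W.updateRow j (a j (f j) • fun j => z j ^ f i)).updateRow i
            (a i (f i) • fun j => z j ^ f i) := by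
          ext p q
          by_cases hp : p = i
          · subst hp; simp [hW, hw p (f p) q hi]
          · by_cases hpj : p = j
            · subst hpj
              rw [Matrix.updateRow_ne hp, Matrix.updateRow_self]
              simp [hW, hw p (f p) q (hij ▸ hi), hij]
            · simp [hp, hpj]
        rw [hWij, Matrix.det_updateRow_smul, Matrix.updateRow_comm _ hne.symm,
          Matrix.det_updateRow_smul, Matrix.det_zero_of_row_eq hne]
        · simp
        · ext q; simp [hne]
      rw [h0]
      simp only [abs_zero, mul_zero]
      exact mul_nonneg (by positivity)
        (Finset.prod_nonneg fun i _ => mul_nonneg (hc0 i) (by positivity))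
  have hprod : ∏ i, ∑ n ∈ range (N + 1), c i n * ρ ^ n =
      ∑ f ∈ Fintype.piFinset (fun _ : Fin N => range (N + 1)), ∏ i, (c i (f i) * ρ ^ (f i)) :=
    Finset.prod_univ_sum _ _
  rw [hexp, hprod, Finset.mul_sum]
  calc _ ≤ ρ ^ (N * (N - 1) / 2) * ∑ f ∈ Fintype.piFinset (fun _ : Fin N => range (N + 1)),
      |Matrix.det (fun i j => w i (f i) j)| := by
        gcongr; exact Finset.abs_sum_le_sum_abs _ _
    _ ≤ _ := by rw [Finset.mul_sum]; exact Finset.sum_le_sum hterm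

theorem abs_exp_sub_sum_le (t : ℝ) (n : ℕ) :
    |Real.exp t - ∑ p ∈ range n, t ^ p / p.factorial| ≤
      Real.exp |t| - ∑ p ∈ range n, |t| ^ p / p.factorial := by
  have h := Complex.norm_exp_sub_sum_le_exp_norm_sub_sum (t : ℂ) n
  have h2 : (Complex.exp t - ∑ m ∈ range n, (t : ℂ) ^ m / m.factorial) =
      ((Real.exp t - ∑ p ∈ range n, t ^ p / p.factorial : ℝ) : ℂ) := by
    push_cast; rfl
  rw [h2, Complex.norm_real, Complex.norm_real] at h
  simpa using h

theorem pow_mul_exp_sub_sum_le {ρ s : ℝ} (hρ : 1 ≤ ρ) (hs : 0 ≤ s) (n : ℕ) :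
    ρ ^ n * (Real.exp s - ∑ p ∈ range n, s ^ p / p.factorial) ≤
      Real.exp (ρ * s) - ∑ p ∈ range n, (ρ * s) ^ p / p.factorial := by
  have key : ∀ t : ℝ, HasSum (fun p => t ^ (p + n) / (p + n).factorial)
      (Real.exp t - ∑ p ∈ range n, t ^ p / p.factorial) := by
    intro t
    have h := NormedSpace.expSeries_div_hasSum_exp t
    rw [← Real.exp_eq_exp_ℝ] at h
    exact (hasSum_nat_add_iff' n).2 h
  refine hasSum_le ?_ ((key s).mul_left (ρ ^ n)) (key (ρ * s))
  intro p
  rw [mul_pow, pow_add ρ, ← mul_div_assoc]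
  gcongr
  exact le_mul_of_one_le_left (by positivity) (one_le_pow₀ hρ)

/-- The function `z ↦ z ^ u * exp (t * z) * y`, with `y` a small perturbation of `1`, has a
truncated power series expansion with controlled weighted sum of coefficients. -/
theorem exists_row_expansion {N u : ℕ} (hu : u < N) {ρ t B X E : ℝ} (hρ : 1 ≤ ρ)
    (hX : |t| * B ≤ X) (hB : 0 ≤ B) (hE1 : ρ ^ N * E ≤ 1) (z y : Fin N → ℝ)
    (hz : ∀ j, 0 ≤ z j) (hzB : ∀ j, z j ≤ B) (hy : ∀ j, |y j - 1| ≤ E) :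
    ∃ (w : ℕ → Fin N → ℝ) (a c : ℕ → ℝ),
      (∀ j, z j ^ u * Real.exp (t * z j) * y j = ∑ n ∈ range (N + 1), w n j) ∧
      (∀ n j, n < N → w n j = a n * z j ^ n) ∧
      (∀ n j, n ≤ N → |w n j| ≤ c n) ∧
      ∑ n ∈ range (N + 1), c n * ρ ^ n ≤ 2 * ((B * ρ) ^ u * Real.exp (X * ρ)) := by
  have hX0 : 0 ≤ X := (by positivity : 0 ≤ |t| * B).trans hX
  obtain ⟨M, rfl⟩ : ∃ M, N = u + M := ⟨N - u, by omega⟩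
  set a : ℕ → ℝ := fun n => if n < u then 0 else t ^ (n - u) / (n - u).factorial with ha
  set T : ℝ := Real.exp X - ∑ p ∈ range M, X ^ p / p.factorial with hT
  set c : ℕ → ℝ := fun n => if n < u then 0 else if n < u + M then
    B ^ u * (X ^ (n - u) / (n - u).factorial) else B ^ u * (T + Real.exp X * E) with hc
  set w : ℕ → Fin (u + M) → ℝ := fun n j => if n < u + M then a n * z j ^ n else
    z j ^ u * (Real.exp (t * z j) - ∑ p ∈ range M, (t * z j) ^ p / p.factorial) +
      z j ^ u * Real.exp (t * z j) * (y j - 1) with hw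
  have htz : ∀ j, |t * z j| ≤ X := fun j => by
    rw [abs_mul, abs_of_nonneg (hz j)]
    exact (mul_le_mul_of_nonneg_left (hzB j) (abs_nonneg t)).trans hX
  refine ⟨w, a, c, ?_, ?_, ?_, ?_⟩
  · intro j
    rw [sum_range_succ]
    have h1 : ∑ n ∈ range (u + M), w n j =
        z j ^ u * ∑ p ∈ range M, (t * z j) ^ p / p.factorial := by
      rw [sum_range_add, mul_sum]
      have h0 : ∑ n ∈ range u, w n j = 0 := by
        refine sum_eq_zero fun n hn => ?_
        have hn := mem_range.1 hn
        simp only [hw, ha, if_pos hn, if_pos (show n < u + M by omega), zero_mul]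
      rw [h0, zero_add]
      refine sum_congr rfl fun p hp => ?_
      have hp := mem_range.1 hp
      simp only [hw, ha, if_pos (show u + p < u + M by omega), if_neg (show ¬ u + p < u by omega),
        Nat.add_sub_cancel_left, pow_add, mul_pow]
      ring
    rw [h1]
    simp only [hw, if_neg (lt_irrefl (u + M))]
    ring
  · intro n j hn
    simp only [hw, if_pos hn]
  · intro n j hn
    have hzu : |z j ^ u| ≤ B ^ u := by
      rw [abs_of_nonneg (pow_nonneg (hz j) u)]
      exact pow_le_pow_left₀ (hz j) (hzB j) u
    rcases lt_or_eq_of_le hn with h | h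
    · by_cases hnu : n < u
      · simp [hw, hc, ha, h, hnu]
      · simp only [hw, hc, ha, if_pos h, if_neg hnu]
        have : t ^ (n - u) / ((n - u).factorial : ℝ) * z j ^ n =
            z j ^ u * ((t * z j) ^ (n - u) / (n - u).factorial) := by
          rw [mul_pow]
          have : z j ^ n = z j ^ u * z j ^ (n - u) := by rw [← pow_add]; congr 1; omega
          rw [this]; ring
        rw [this, abs_mul, abs_div, abs_pow (t * z j), Nat.abs_cast]
        gcongr
        exact htz j
    · subst h
      simp only [hw, hc, if_neg (lt_irrefl (u + M)), if_neg (show ¬ u + M < u by omega)]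
      rw [mul_assoc (z j ^ u), ← mul_add, abs_mul]
      refine mul_le_mul hzu ?_ (abs_nonneg _) (by positivity)
      refine (abs_add_le _ _).trans (add_le_add ?_ ?_)
      · refine (abs_exp_sub_sum_le _ _).trans ?_
        rw [hT]
        have hmono := (fun s : ℝ => pow_mul_exp_sub_sum_le (ρ := 1) (s := s) le_rfl)
        rcases eq_or_lt_of_le (abs_nonneg (t * z j)) with h0 | h0
        · rw [← h0]
          have h1 := (abs_nonneg _).trans (abs_exp_sub_sum_le X M)
          rw [abs_of_nonneg hX0] at h1
          have hM : 0 < M := by omega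
          obtain ⟨M', rfl⟩ : ∃ M', M = M' + 1 := ⟨M - 1, by omega⟩
          rw [sum_range_succ']
          simpa using h1
        · have h1 : 1 ≤ X / |t * z j| := (one_le_div h0).2 (htz j)
          have h2 := pow_mul_exp_sub_sum_le h1 (abs_nonneg (t * z j)) M
          rw [div_mul_cancel₀ _ h0.ne'] at h2
          have h3 := (abs_nonneg _).trans (abs_exp_sub_sum_le |t * z j| M)
          rw [abs_abs] at h3
          exact (le_mul_of_one_le_left h3 (one_le_pow₀ h1)).trans h2
      · rw [abs_mul, Real.abs_exp]
        exact mul_le_mul (Real.exp_le_exp.2 ((le_abs_self _).trans (htz j))) (hy j)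
          (abs_nonneg _) (Real.exp_pos _).le
  · have h0 : ∑ n ∈ range u, c n * ρ ^ n = 0 := by
      refine sum_eq_zero fun n hn => ?_
      have hn := mem_range.1 hn
      simp only [hc, if_pos hn, zero_mul]
    have h1 : ∑ n ∈ range M, c (u + n) * ρ ^ (u + n) =
        (B * ρ) ^ u * ∑ p ∈ range M, (ρ * X) ^ p / p.factorial := by
      rw [mul_sum]
      refine sum_congr rfl fun p hp => ?_
      have hp := mem_range.1 hp
      simp only [hc, if_pos (show u + p < u + M by omega), if_neg (show ¬ u + p < u by omega),
        Nat.add_sub_cancel_left, pow_add, mul_pow]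
      ring
    rw [sum_range_succ, sum_range_add, h0, h1]
    simp only [hc, if_neg (lt_irrefl (u + M)), if_neg (show ¬ u + M < u by omega)]
    have h2 := pow_mul_exp_sub_sum_le hρ hX0 M
    have h3 : B ^ u * (T + Real.exp X * E) * ρ ^ (u + M) =
        (B * ρ) ^ u * (ρ ^ M * T) + B ^ u * Real.exp X * (ρ ^ (u + M) * E) := by
      rw [pow_add, mul_pow]; ring
    have h4 : B ^ u * Real.exp X * (ρ ^ (u + M) * E) ≤ (B * ρ) ^ u * Real.exp (X * ρ) := by
      calc B ^ u * Real.exp X * (ρ ^ (u + M) * E) ≤ B ^ u * Real.exp X * 1 := by gcongr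
        _ ≤ (B * ρ) ^ u * Real.exp (X * ρ) := by
          rw [mul_one]
          have : B ≤ B * ρ := le_mul_of_one_le_right hB hρ
          have : X ≤ X * ρ := le_mul_of_one_le_right hX0 hρ
          gcongr
    have h5 : (B * ρ) ^ u * (ρ ^ M * T) ≤ (B * ρ) ^ u *
        (Real.exp (ρ * X) - ∑ p ∈ range M, (ρ * X) ^ p / p.factorial) := by
      have : 0 ≤ B * ρ := by positivity
      gcongr
    rw [h3]
    rw [mul_comm ρ X] at *
    nlinarith [h4, h5]

theorem coeff_prod_sum_of_natDegree_le {ι : Type*} (s : Finset ι) (f : ι → ℝ[X]) (d : ι → ℕ)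
    (h : ∀ i ∈ s, (f i).natDegree ≤ d i) :
    (∏ i ∈ s, f i).coeff (∑ i ∈ s, d i) = ∏ i ∈ s, (f i).coeff (d i) := by
  classical
  induction s using Finset.induction_on with
  | empty => simp
  | insert a s ha ih =>
    rw [prod_insert ha, sum_insert ha, prod_insert ha, coeff_mul_add_eq_of_natDegree_le
      (h a (mem_insert_self a s)), ih fun i hi => h i (mem_insert_of_mem hi)]
    refine (natDegree_prod_le _ _).trans (sum_le_sum fun i hi => h i (mem_insert_of_mem hi))

/-- Shifts of polynomials twisted by a geometric progression have a nonzero determinant, whose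
degree is controlled. -/
theorem det_shift_ne_zero {n d : ℕ} (P : Fin n → ℝ[X]) (hP : ∀ i, P i ≠ 0)
    (hd : ∀ i, (P i).natDegree ≤ d) (y : Fin n → ℝ) (hy : Function.Injective y) (b : ℝ) :
    (Matrix.of fun j i : Fin n => (P i).comp (X + C (j * b)) * C (y i ^ (j : ℕ))).det ≠ 0 ∧
    (Matrix.of fun j i : Fin n =>
      (P i).comp (X + C (j * b)) * C (y i ^ (j : ℕ))).det.natDegree ≤ n * d := by
  set D : Matrix (Fin n) (Fin n) ℝ[X] :=
    Matrix.of fun j i : Fin n => (P i).comp (X + C (j * b)) * C (y i ^ (j : ℕ)) with hD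
  have hdeg : ∀ j i, (D j i).natDegree ≤ (P i).natDegree := by
    intro j i
    simp only [hD, Matrix.of_apply]
    refine (natDegree_mul_C_le _ _).trans ?_
    rw [natDegree_comp, natDegree_X_add_C, mul_one]
  have hcoeff : ∀ j i, (D j i).coeff (P i).natDegree =
      (P i).leadingCoeff * Matrix.vandermonde y i j := by
    intro j i
    simp only [hD, Matrix.of_apply, coeff_mul_C, Matrix.vandermonde_apply]
    congr 1
    have h1 : ((P i).comp (X + C ((j : ℝ) * b))).natDegree = (P i).natDegree := by
      rw [natDegree_comp, natDegree_X_add_C, mul_one]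
    have h2 := leadingCoeff_comp (p := P i) (q := X + C ((j : ℝ) * b))
      (by rw [natDegree_X_add_C]; exact one_ne_zero)
    rw [leadingCoeff, h1, leadingCoeff_X_add_C, one_pow, mul_one] at h2
    exact h2
  have hdetc : D.det.coeff (∑ i, (P i).natDegree) =
      (∏ i, (P i).leadingCoeff) * (Matrix.vandermonde y).det := by
    rw [Matrix.det_apply', finsetSum_coeff, ← Matrix.det_transpose, Matrix.det_apply', mul_sum]
    refine sum_congr rfl fun σ _ => ?_
    rw [← C_eq_intCast, coeff_C_mul, coeff_prod_sum_of_natDegree_le _ _ _ fun i _ => hdeg (σ i) i]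
    simp only [hcoeff, prod_mul_distrib, Matrix.transpose_apply]
    ring
  refine ⟨fun h0 => ?_, ?_⟩
  · rw [h0, coeff_zero] at hdetc
    rcases mul_eq_zero.1 hdetc.symm with h | h
    · obtain ⟨i, _, hi⟩ := prod_eq_zero_iff.1 h
      exact hP i (leadingCoeff_eq_zero.1 hi)
    · exact Matrix.det_vandermonde_ne_zero_iff.2 hy h
  · rw [Matrix.det_apply']
    refine natDegree_sum_le_of_forall_le _ _ fun σ _ => ?_
    rw [← C_eq_intCast]
    refine (natDegree_C_mul_le _ _).trans ((natDegree_prod_le _ _).trans ?_)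
    calc ∑ i, (D (σ i) i).natDegree ≤ ∑ _i : Fin n, d :=
          sum_le_sum fun i _ => (hdeg _ _).trans (hd i)
      _ = n * d := by simp

/-- Zero estimate for exponential polynomials along a two-generated subgroup of
`ℝ × ℝˣ`. -/
theorem zero_estimate {K L R S : ℕ} {a₁ a₂ b₁ b₂ : ℝ} (ha₁ : 0 < a₁) (ha₁' : a₁ ≠ 1)
    (ha₂ : 0 < a₂)
    (hinj : Set.InjOn (fun q : ℕ × ℕ => q.1 * b₂ + q.2 * b₁) {q | q.1 < R ∧ q.2 ≤ S})
    (hcard : L * (K - 1) < R * (S + 1)) (p : Fin K → Fin L → ℝ)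
    (hp : ∀ r < R + L - 1, ∀ s ≤ S,
      ∑ u, ∑ v, p u v * ((r * b₂ + s * b₁) ^ (u : ℕ) * (a₁ ^ r * a₂ ^ s) ^ (v : ℕ)) = 0) :
    p = 0 := by
  classical
  set P : Fin L → ℝ[X] := fun v => ∑ u : Fin K, C (p u v) * X ^ (u : ℕ) with hPdef
  have hPdeg : ∀ v, (P v).natDegree ≤ K - 1 := fun v => by
    refine natDegree_sum_le_of_forall_le _ _ fun u _ => ?_
    exact (natDegree_C_mul_X_pow_le _ _).trans (by omega)
  have hPcoeff : ∀ v u, (P v).coeff (u : Fin K) = p u v := fun v u => by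
    simp only [hPdef, finsetSum_coeff, coeff_C_mul, coeff_X_pow]
    rw [sum_eq_single u]
    · simp
    · intro b _ hb
      have : (u : ℕ) ≠ b := fun h => hb (Fin.ext h.symm)
      simp [this]
    · simp
  set V : Finset (Fin L) := univ.filter fun v => P v ≠ 0 with hV
  by_contra hne
  have hVne : V.Nonempty := by
    by_contra h
    rw [not_nonempty_iff_eq_empty] at h
    apply hne
    ext u v
    have hv : P v = 0 := by
      by_contra hv
      have : v ∈ V := by simp [hV, hv]
      simp [h] at this
    rw [← hPcoeff v u, hv]; simp
  set n := #V with hn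
  have hnL : n ≤ L := by simpa using card_le_univ V
  have hn0 : 0 < n := hVne.card_pos
  let e : Fin n ↪o Fin L := V.orderEmbOfFin rfl
  have heV : ∀ i, e i ∈ V := fun i => V.orderEmbOfFin_mem rfl i
  have hrange : ∀ v ∈ V, ∃ i, e i = v := fun v hv => by
    have := V.range_orderEmbOfFin rfl
    have h2 : v ∈ Set.range (V.orderEmbOfFin rfl) := by rw [this]; exact hv
    exact h2
  have hpow : Function.Injective fun i : Fin n => a₁ ^ (e i : ℕ) := by
    intro i j hij
    have := pow_right_injective₀ ha₁ ha₁' hij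
    exact e.injective (Fin.ext this)
  obtain ⟨hD0, hDdeg⟩ := det_shift_ne_zero (fun i => P (e i))
    (fun i => (mem_filter.1 (heV i)).2) (fun i => hPdeg (e i)) (fun i => a₁ ^ (e i : ℕ)) hpow b₂
  set D := Matrix.of fun j i : Fin n =>
    (P (e i)).comp (X + C ((j : ℝ) * b₂)) * C ((a₁ ^ (e i : ℕ)) ^ (j : ℕ)) with hD
  have hroot : ∀ r < R, ∀ s ≤ S, D.det.eval (r * b₂ + s * b₁) = 0 := by
    intro r hr s hs
    set ζ : ℝ := r * b₂ + s * b₁ with hζ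
    set Y : ℝ := a₁ ^ r * a₂ ^ s with hY
    have hY0 : Y ≠ 0 := by positivity
    have hmap : D.det.eval ζ = (D.map (eval ζ)).det := by
      have := RingHom.map_det (evalRingHom ζ) D
      simpa using this
    rw [hmap]
    refine Matrix.exists_mulVec_eq_zero_iff.1 ⟨fun i => Y ^ (e i : ℕ), ?_, ?_⟩
    · intro h
      have := congr_fun h ⟨0, hn0⟩
      exact pow_ne_zero _ hY0 this
    · ext j
      have h1 := hp (r + j) (by have := j.2; omega) s hs
      rw [sum_comm] at h1
      have h2 : ∀ v : Fin L, ∑ u, p u v * ((((r + j : ℕ) : ℝ) * b₂ + s * b₁) ^ (u : ℕ) *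
          (a₁ ^ (r + j : ℕ) * a₂ ^ s) ^ (v : ℕ)) =
          ((P v).eval (ζ + j * b₂) * (a₁ ^ (v : ℕ)) ^ (j : ℕ)) * Y ^ (v : ℕ) := by
        intro v
        simp only [hPdef, eval_finsetSum, eval_mul, eval_C, eval_pow, eval_X, sum_mul]
        refine sum_congr rfl fun u _ => ?_
        have e1 : (((r + j : ℕ) : ℝ) * b₂ + s * b₁) = ζ + j * b₂ := by rw [hζ]; push_cast; ring
        have e2 : (a₁ ^ (r + j : ℕ) * a₂ ^ s) ^ (v : ℕ) = (a₁ ^ (v : ℕ)) ^ (j : ℕ) * Y ^ (v : ℕ) := by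
          rw [hY, ← pow_mul, mul_comm (v : ℕ), pow_mul, ← mul_pow, pow_add]; ring
        rw [e1, e2]; ring
      simp only [h2] at h1
      have h3 : ∑ v : Fin L, ((P v).eval (ζ + j * b₂) * (a₁ ^ (v : ℕ)) ^ (j : ℕ)) * Y ^ (v : ℕ) =
          ∑ v ∈ V, ((P v).eval (ζ + j * b₂) * (a₁ ^ (v : ℕ)) ^ (j : ℕ)) * Y ^ (v : ℕ) := by
        symm
        refine sum_subset (subset_univ _) fun v _ hv => ?_
        have : P v = 0 := by
          by_contra h; exact hv (by simp [hV, h])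
        simp [this]
      rw [h3] at h1
      have h4 : V = univ.map e.toEmbedding := by
        ext v
        simp only [mem_map, mem_univ, true_and]
        exact ⟨fun h => hrange v h, fun ⟨i, hi⟩ => by rw [← hi]; exact heV i⟩
      rw [h4, sum_map] at h1
      simp only [Matrix.mulVec, dotProduct, Matrix.map_apply, hD, Matrix.of_apply, eval_mul,
        eval_comp, eval_add, eval_X, eval_C, Pi.zero_apply]
      exact h1
  set E : Finset (ℕ × ℕ) := range R ×ˢ range (S + 1) with hE
  have hEinj : Set.InjOn (fun q : ℕ × ℕ => q.1 * b₂ + q.2 * b₁) (E : Set (ℕ × ℕ)) := by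
    refine hinj.mono fun q hq => ?_
    simp [hE] at hq
    exact ⟨hq.1, by omega⟩
  have hcardE : #(E.image fun q : ℕ × ℕ => q.1 * b₂ + q.2 * b₁) = R * (S + 1) := by
    rw [card_image_of_injOn hEinj]; simp [hE]
  have hsub : (E.image fun q : ℕ × ℕ => q.1 * b₂ + q.2 * b₁) ⊆ D.det.roots.toFinset := by
    intro ζ hζ
    obtain ⟨q, hq, rfl⟩ := mem_image.1 hζ
    simp only [hE, mem_product, mem_range] at hq
    rw [Multiset.mem_toFinset, mem_roots hD0]
    exact hroot q.1 hq.1 q.2 (by omega)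
  have h1 := card_le_card hsub
  have h2 := (Multiset.toFinset_card_le D.det.roots).trans (card_roots' D.det)
  have h3 : n * (K - 1) ≤ L * (K - 1) := Nat.mul_le_mul_right _ hnL
  omega

/-- Linearly independent functions on a set have a nonzero alternant. -/
theorem exists_det_ne_zero_of_independent {I E : Type*} [Fintype I] [DecidableEq I]
    (f : I → E → ℝ) (hf : ∀ p : I → ℝ, (∀ e, ∑ i, p i * f i e = 0) → p = 0) :
    ∃ g : I → E, (Matrix.of fun i j => f i (g j)).det ≠ 0 := by
  set c : E → I → ℝ := fun e i => f i e with hc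
  have hspan : Submodule.span ℝ (Set.range c) = ⊤ := by
    by_contra h
    obtain ⟨φ, hφ, hker⟩ := Submodule.exists_le_ker_of_lt_top _ (lt_top_iff_ne_top.2 h)
    apply hφ
    have hrep : ∀ x : I → ℝ, φ x = ∑ i, φ (Pi.single i 1) * x i := by
      intro x
      conv_lhs => rw [pi_eq_sum_univ' x]
      rw [map_sum]
      refine sum_congr rfl fun i _ => ?_
      rw [map_smul, smul_eq_mul, mul_comm]
    have h0 := hf (fun i => φ (Pi.single i 1)) fun e => by
      have h1 : φ (c e) = 0 := hker (Submodule.subset_span ⟨e, rfl⟩)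
      rw [hrep] at h1
      exact h1
    ext i
    simpa using congr_fun h0 i
  obtain ⟨b, hbs, hbspan, hbli⟩ := exists_linearIndependent ℝ (Set.range c)
  rw [hspan] at hbspan
  let bas : Module.Basis b ℝ (I → ℝ) := Module.Basis.mk hbli (by rw [Subtype.range_coe, hbspan])
  let eqv : I ≃ b := (Pi.basisFun ℝ I).indexEquiv bas
  have hg : ∀ j : I, ∃ e, c e = (eqv j : I → ℝ) := fun j => hbs (eqv j).2
  choose g hg using hg
  refine ⟨g, ?_⟩
  have hli : LinearIndependent ℝ fun j : I => c (g j) := by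
    have : (fun j : I => c (g j)) = (fun x : b => (x : I → ℝ)) ∘ eqv := by
      ext j; simp [hg]
    rw [this]
    exact hbli.comp _ eqv.injective
  have h2 : IsUnit (Matrix.of fun j i => f i (g j)) :=
    Matrix.linearIndependent_rows_iff_isUnit.1 hli
  rw [← Matrix.det_transpose]
  exact ((Matrix.isUnit_iff_isUnit_det _).1 h2).ne_zero

/-- A Liouville-type inequality for the values at `α` of integer polynomials. -/
def LiouvilleAt (k : ℕ) (α : ℝ) : Prop :=
  ∀ (Q : ℤ[X]) (M : ℝ), 1 ≤ M → (∀ z : ℂ, ‖z‖ ≤ 1 → ‖aeval z Q‖ ≤ M) → aeval α Q ≠ 0 →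
    1 ≤ |aeval α Q| * M ^ (k - 1)

theorem sum_fin_cast (n : ℕ) : ∑ i : Fin n, ((i : ℕ) : ℝ) = n * (n - 1) / 2 := by
  rw [Fin.sum_univ_eq_sum_range (fun i => (i : ℝ))]
  induction n with
  | zero => simp
  | succ n ih => rw [sum_range_succ, ih]; push_cast; ring

theorem cast_mul_pred_div_two (n : ℕ) : ((n * (n - 1) / 2 : ℕ) : ℝ) = n * (n - 1) / 2 := by
  rw [← Finset.sum_range_id, Nat.cast_sum, ← sum_fin_cast,
    Fin.sum_univ_eq_sum_range (fun i => (i : ℝ))]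

theorem log_factorial_le (n : ℕ) : Real.log n.factorial ≤ n * Real.log n := by
  have h : (n.factorial : ℝ) ≤ (n : ℝ) ^ n := by exact_mod_cast Nat.factorial_le_pow n
  rw [← Real.log_pow]
  exact Real.log_le_log (by positivity) h

set_option maxHeartbeats 1000000 in
/-- The main inequality of the interpolation determinant method for two logarithms. -/
theorem interpolation_inequality {k : ℕ} (hk : 1 ≤ k) {α : ℝ} (hα : LiouvilleAt k α)
    {K L R S : ℕ} (hK : 1 ≤ K) (hL : 1 ≤ L) {a₁ a₂ : ℝ} (ha₁ : 0 < a₁) (ha₁' : a₁ ≠ 1)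
    (ha₂ : 0 < a₂) {b₁ b₂ : ℕ} (hb₂ : 0 < b₂) {A₁ D₁ A₂ D₂ : ℤ[X]}
    (hA₁ : aeval α A₁ = a₁ * aeval α D₁) (hA₂ : aeval α A₂ = a₂ * aeval α D₂)
    (hD₁ : 0 < aeval α D₁) (hD₂ : 0 < aeval α D₂) {M₁ M₂ : ℝ} (hM₁ : 1 ≤ M₁) (hM₂ : 1 ≤ M₂)
    (hA₁M : ∀ z : ℂ, ‖z‖ ≤ 1 → ‖aeval z A₁‖ ≤ M₁) (hD₁M : ∀ z : ℂ, ‖z‖ ≤ 1 → ‖aeval z D₁‖ ≤ M₁)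
    (hA₂M : ∀ z : ℂ, ‖z‖ ≤ 1 → ‖aeval z A₂‖ ≤ M₂) (hD₂M : ∀ z : ℂ, ‖z‖ ≤ 1 → ‖aeval z D₂‖ ≤ M₂)
    (hinj : Set.InjOn (fun q : ℕ × ℕ => q.1 * (b₂ : ℝ) + q.2 * (b₁ : ℝ)) {q | q.1 < R ∧ q.2 ≤ S})
    (hcard : L * (K - 1) < R * (S + 1)) {B X w : ℝ} (hB1 : 1 ≤ B)
    (hB : ((R + L : ℕ) : ℝ) * b₂ + S * b₁ ≤ B) (hX : |Real.log a₁| / b₂ * B ≤ X)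
    (hE : Real.exp (K * L) *
      (Real.exp (L * S * |b₂ * Real.log a₂ - b₁ * Real.log a₁| / b₂) - 1) ≤ 1)
    (hw : (R + L : ℕ) * Real.log (aeval α D₁) + S * Real.log (aeval α D₂) ≤ w) :
    (K : ℝ) * L - 1 ≤ 2 * k * Real.log (K * L) + 2 * Real.log 2 +
      (K - 1) * (k * Real.log B + 1) + (L - 1) * (Real.exp 1 * X + w +
        (k - 1) * ((R + L : ℕ) * Real.log M₁ + S * Real.log M₂)) := by
  classical
  set N := K * L with hN
  have hN0 : 0 < N := Nat.mul_pos hK hL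
  set T := R + L with hT
  have hb₂' : (0 : ℝ) < b₂ := by exact_mod_cast hb₂
  let ζ : ℕ × ℕ → ℝ := fun q => q.1 * (b₂ : ℝ) + q.2 * (b₁ : ℝ)
  let Y : ℕ × ℕ → ℝ := fun q => a₁ ^ q.1 * a₂ ^ q.2
  let E : Type := {q : ℕ × ℕ // q.1 ≤ T ∧ q.2 ≤ S}
  let e : Fin N ≃ Fin K × Fin L := finProdFinEquiv.symm
  let u : Fin N → ℕ := fun i => (e i).1
  let v : Fin N → ℕ := fun i => (e i).2
  have hprodsum : ∀ g : ℕ → ℕ → ℝ, ∑ i, g (u i) (v i) = ∑ a : Fin K, ∑ b : Fin L, g a b := by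
    intro g
    rw [← Fintype.sum_prod_type' (fun (a : Fin K) (b : Fin L) => g a b)]
    exact e.sum_comp (fun x => g x.1 x.2)
  obtain ⟨g, hg⟩ := exists_det_ne_zero_of_independent
    (fun (i : Fin N) (q : E) => ζ q.1 ^ (u i) * Y q.1 ^ (v i)) (by
      intro p hp
      have h0 := zero_estimate ha₁ ha₁' ha₂ hinj hcard (fun a b => p (e.symm (a, b))) (by
        intro r hr s hs
        have := hp ⟨(r, s), by omega, hs⟩
        rw [← e.symm.sum_comp, Fintype.sum_prod_type] at this
        simpa [ζ, Y, u, v] using this)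
      ext i
      have := congr_fun (congr_fun h0 (e i).1) (e i).2
      simpa using this)
  set A : Matrix (Fin N) (Fin N) ℝ := Matrix.of fun i j => ζ (g j).1 ^ (u i) * Y (g j).1 ^ (v i)
    with hAdef
  have hζ0 : ∀ q, 0 ≤ ζ q := fun q => by positivity
  have hζB : ∀ q : E, ζ q.1 ≤ B := fun q => by
    refine le_trans ?_ hB
    have h1 : ((q.1.1 : ℕ) : ℝ) ≤ T := by exact_mod_cast q.2.1
    have h2 : ((q.1.2 : ℕ) : ℝ) ≤ S := by exact_mod_cast q.2.2
    simp only [ζ]; gcongr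
  have hY0 : ∀ q, 0 < Y q := fun q => by simp only [Y]; positivity
  have huK : ∀ i, u i < K := fun i => (e i).1.2
  have hvL : ∀ i, v i < L := fun i => (e i).2.2
  -- upper bound
  have hupper : (N : ℝ) * (N - 1) / 2 + Real.log |A.det| ≤ Real.log N.factorial +
      ∑ i, (Real.log 2 + u i * (Real.log B + 1) + v i * (Real.exp 1 * X)) := by
    set τ := Real.log a₁ / b₂ with hτ
    set Λ := b₂ * Real.log a₂ - b₁ * Real.log a₁ with hΛ
    set Er := Real.exp (L * S * |Λ| / b₂) - 1 with hEr
    have hrow : ∀ i, _ := fun i => exists_row_expansion (N := N) (u := u i)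
      ((huK i).trans_le (Nat.le_mul_of_pos_right K hL)) (ρ := Real.exp 1) (t := v i * τ) (B := B)
      (X := v i * X) (E := Er) (Real.one_le_exp zero_le_one)
      (by
        rw [abs_mul, Nat.abs_cast, mul_assoc, hτ, abs_div, Nat.abs_cast]
        gcongr) (by linarith)
      (by
        rw [← Real.exp_nat_mul, mul_one, hN]; push_cast; exact hE)
      (fun j => ζ (g j).1) (fun j => Real.exp (v i * (g j).1.2 * Λ / b₂)) (fun j => hζ0 _)
      (fun j => hζB _) (fun j => by
        have h1 : |(v i : ℝ) * (g j).1.2 * Λ / b₂| ≤ L * S * |Λ| / b₂ := by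
          rw [abs_div, abs_mul, abs_mul, Nat.abs_cast, Nat.abs_cast, Nat.abs_cast]
          have h1 : ((v i : ℕ) : ℝ) ≤ L := by exact_mod_cast (hvL i).le
          have h2 : (((g j).1.2 : ℕ) : ℝ) ≤ S := by exact_mod_cast (g j).2.2
          gcongr
        have h2 := abs_exp_sub_sum_le ((v i : ℝ) * (g j).1.2 * Λ / b₂) 1
        simp only [range_one, sum_singleton, pow_zero, Nat.factorial_zero, Nat.cast_one,
          div_one] at h2
        exact h2.trans (by rw [hEr]; gcongr))
    choose wr ar cr h1 h2 h3 h4 using hrow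
    have hYexp : ∀ i j, Y (g j).1 ^ v i = Real.exp (v i * τ * ζ (g j).1) *
        Real.exp (v i * (g j).1.2 * Λ / b₂) := by
      intro i j
      have hlogY : Real.log (Y (g j).1) = τ * ζ (g j).1 + (g j).1.2 * Λ / b₂ := by
        simp only [Y, ζ, hτ, hΛ]
        rw [Real.log_mul (by positivity) (by positivity), Real.log_pow, Real.log_pow]
        field_simp
        ring
      rw [← Real.exp_add, ← Real.exp_log (pow_pos (hY0 (g j).1) (v i)), Real.log_pow, hlogY]
      congr 1; ring
    have hdet := abs_det_le_of_row_expansions hN0 A (Real.exp 1) (Real.one_le_exp zero_le_one)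
      wr ar (fun j => ζ (g j).1) cr
      (fun i j => by rw [← h1 i j]; simp only [hAdef, Matrix.of_apply]; rw [hYexp]; ring)
      h2 h3
    have hdet2 : Real.exp 1 ^ (N * (N - 1) / 2) * |A.det| ≤
        N.factorial * ∏ i, (2 * ((B * Real.exp 1) ^ u i * Real.exp (v i * X * Real.exp 1))) := by
      refine hdet.trans ?_
      gcongr with i _
      · intro i _
        exact sum_nonneg fun n hn => mul_nonneg ((abs_nonneg _).trans (h3 i n ⟨0, hN0⟩ (by
          have := mem_range.1 hn; omega))) (by positivity)
      · exact h4 i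
    have habs : 0 < |A.det| := abs_pos.2 hg
    have hlog := Real.log_le_log (by positivity) hdet2
    rw [Real.log_mul (by positivity) habs.ne', Real.log_pow, Real.log_exp, mul_one,
      cast_mul_pred_div_two, Real.log_mul (by positivity) (by positivity),
      Real.log_prod (fun i _ => by positivity)] at hlog
    refine hlog.trans (le_of_eq ?_)
    congr 1
    refine sum_congr rfl fun i _ => ?_
    rw [Real.log_mul (by norm_num) (by positivity), Real.log_mul (by positivity) (by positivity),
      Real.log_pow, Real.log_mul (by positivity) (by positivity), Real.log_exp, Real.log_exp]
    ring
  -- lower bound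
  have hlower : 0 ≤ Real.log |A.det| + ∑ i, (v i * w) + (k - 1) * (Real.log N.factorial +
      ∑ i, (u i * Real.log B + v i * (T * Real.log M₁ + S * Real.log M₂))) := by
    let Qm : Matrix (Fin N) (Fin N) ℤ[X] := Matrix.of fun i j =>
      (((g j).1.1 * b₂ + (g j).1.2 * b₁ : ℕ) : ℤ[X]) ^ u i *
        (A₁ ^ (g j).1.1 * D₁ ^ (T - (g j).1.1) * (A₂ ^ (g j).1.2 * D₂ ^ (S - (g j).1.2))) ^ v i
    set W : ℝ := aeval α D₁ ^ T * aeval α D₂ ^ S with hW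
    have hW0 : 0 < W := by positivity
    have hval : aeval α Qm.det = (∏ i, W ^ v i) * A.det := by
      have hm : aeval α Qm.det = (Qm.map (aeval α)).det := by
        have := RingHom.map_det (aeval α : ℤ[X] →ₐ[ℤ] ℝ).toRingHom Qm
        simpa using this
      rw [hm, ← Matrix.det_mul_column]
      congr 1
      ext i j
      simp only [Matrix.map_apply, Qm, Matrix.of_apply, map_mul, map_pow, map_natCast, hA₁, hA₂,
        hAdef, ζ, Y, hW]
      have e1 : (aeval α D₁ : ℝ) ^ T =
          aeval α D₁ ^ (g j).1.1 * aeval α D₁ ^ (T - (g j).1.1) := by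
        rw [← pow_add]; congr 1; have := (g j).2.1; omega
      have e2 : (aeval α D₂ : ℝ) ^ S =
          aeval α D₂ ^ (g j).1.2 * aeval α D₂ ^ (S - (g j).1.2) := by
        rw [← pow_add]; congr 1; have := (g j).2.2; omega
      rw [e1, e2]
      push_cast
      ring
    set MQ : ℝ := N.factorial * ∏ i, (B ^ u i * (M₁ ^ T * M₂ ^ S) ^ v i) with hMQ
    have hMQ1 : 1 ≤ MQ := by
      have h1 : (1 : ℝ) ≤ N.factorial := by exact_mod_cast Nat.factorial_pos N
      have h2 : ∀ i ∈ (univ : Finset (Fin N)), 1 ≤ B ^ u i * (M₁ ^ T * M₂ ^ S) ^ v i :=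
        fun i _ => one_le_mul_of_one_le_of_one_le (one_le_pow₀ hB1) (one_le_pow₀
          (one_le_mul_of_one_le_of_one_le (one_le_pow₀ hM₁) (one_le_pow₀ hM₂)))
      have h3 : (1 : ℝ) ≤ ∏ i, (B ^ u i * (M₁ ^ T * M₂ ^ S) ^ v i) := by
        have := Finset.prod_le_prod (s := (univ : Finset (Fin N))) (f := fun _ => (1 : ℝ))
          (fun i _ => zero_le_one) h2
        simpa using this
      exact one_le_mul_of_one_le_of_one_le h1 h3
    have hQM : ∀ z : ℂ, ‖z‖ ≤ 1 → ‖aeval z Qm.det‖ ≤ MQ := by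
      intro z hz
      have hm : aeval z Qm.det = (Qm.map (aeval z)).det := by
        have := RingHom.map_det (aeval z : ℤ[X] →ₐ[ℤ] ℂ).toRingHom Qm
        simpa using this
      rw [hm]
      refine norm_det_le_factorial_mul_prod _ _ fun i j => ?_
      simp only [Matrix.map_apply, Qm, Matrix.of_apply, map_mul, map_pow, map_natCast, norm_mul,
        norm_pow, Complex.norm_natCast]
      have e1 : M₁ ^ T = M₁ ^ (g j).1.1 * M₁ ^ (T - (g j).1.1) := by
        rw [← pow_add]; congr 1; have := (g j).2.1; omega
      have e2 : M₂ ^ S = M₂ ^ (g j).1.2 * M₂ ^ (S - (g j).1.2) := by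
        rw [← pow_add]; congr 1; have := (g j).2.2; omega
      rw [e1, e2]
      have h1 := hA₁M z hz
      have h2 := hD₁M z hz
      have h3 := hA₂M z hz
      have h4 := hD₂M z hz
      have h5 := hζB (g j)
      simp only [ζ] at h5
      push_cast
      gcongr
    have hne : aeval α Qm.det ≠ 0 := by
      rw [hval]
      exact mul_ne_zero (prod_ne_zero_iff.2 fun i _ => (pow_pos hW0 _).ne') hg
    have hl := hα Qm.det MQ hMQ1 hQM hne
    have hprod0 : 0 < ∏ i, W ^ v i := prod_pos fun i _ => pow_pos hW0 _
    have habs : 0 < |A.det| := abs_pos.2 hg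
    rw [hval, abs_mul, abs_of_pos hprod0] at hl
    have hlog := Real.log_le_log one_pos hl
    have hP0 : ∀ i, 0 < B ^ u i * (M₁ ^ T * M₂ ^ S) ^ v i := fun i => by positivity
    rw [Real.log_one, Real.log_mul (by positivity) (by positivity),
      Real.log_mul hprod0.ne' habs.ne', Real.log_pow, hMQ,
      Real.log_mul (by positivity) (prod_pos fun i _ => hP0 i).ne',
      Real.log_prod (fun i _ => (pow_pos hW0 _).ne'), Real.log_prod (fun i _ => (hP0 i).ne')]
      at hlog
    have hWw : Real.log W ≤ w := by
      rw [hW, Real.log_mul (by positivity) (by positivity), Real.log_pow, Real.log_pow]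
      exact hw
    have hs1 : ∑ i, Real.log (W ^ v i) ≤ ∑ i, (v i * w : ℝ) := by
      refine sum_le_sum fun i _ => ?_
      rw [Real.log_pow]; gcongr
    have hs2 : ∑ i, Real.log (B ^ u i * (M₁ ^ T * M₂ ^ S) ^ v i) =
        ∑ i, (u i * Real.log B + v i * (T * Real.log M₁ + S * Real.log M₂)) := by
      refine sum_congr rfl fun i _ => ?_
      rw [Real.log_mul (by positivity) (by positivity), Real.log_pow, Real.log_pow,
        Real.log_mul (by positivity) (by positivity), Real.log_pow, Real.log_pow]
    rw [hs2, Nat.cast_sub hk, Nat.cast_one] at hlog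
    linarith
  have hKr : (1 : ℝ) ≤ K := by exact_mod_cast hK
  have hLr : (1 : ℝ) ≤ L := by exact_mod_cast hL
  have hkr : (1 : ℝ) ≤ k := by exact_mod_cast hk
  have hNr : (N : ℝ) = K * L := by rw [hN]; push_cast; ring
  have hsum : ∀ p q r : ℝ, ∑ i, (p + u i * q + v i * r) =
      N * p + N * (K - 1) / 2 * q + N * (L - 1) / 2 * r := by
    intro p q r
    have := hprodsum fun a b => p + a * q + b * r
    rw [this]
    simp only [sum_add_distrib, ← sum_mul, sum_const, card_univ, Fintype.card_fin, nsmul_eq_mul,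
      ← mul_sum, sum_fin_cast, hNr]
    ring
  have hs1 := hsum (Real.log 2) (Real.log B + 1) (Real.exp 1 * X)
  have hs2 := hsum 0 0 w
  have hs3 := hsum 0 (Real.log B) (T * Real.log M₁ + S * Real.log M₂)
  simp only [zero_add, mul_zero, add_zero] at hs2 hs3
  rw [hs1] at hupper
  rw [hs2, hs3] at hlower
  have hfac := log_factorial_le N
  have hfac2 : (k : ℝ) * Real.log N.factorial ≤ k * (N * Real.log N) := by gcongr
  have hNpos : (0 : ℝ) < N := by exact_mod_cast hN0
  rw [← hNr]
  have hfin : (N : ℝ) / 2 * (N - 1) ≤ N / 2 * (2 * k * Real.log N + 2 * Real.log 2 +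
      (K - 1) * (k * Real.log B + 1) + (L - 1) * (Real.exp 1 * X + w +
        (k - 1) * (T * Real.log M₁ + S * Real.log M₂))) := by
    linear_combination hupper + hlower + hfac2
  exact le_of_mul_le_mul_left hfin (by positivity)

/-- The characteristic polynomial of the recurrence. -/
noncomputable def charPolyK (k : ℕ) : ℤ[X] := X ^ k - ∑ i ∈ range k, X ^ i

theorem aeval_charPolyK {A : Type*} [CommRing A] (k : ℕ) (z : A) :
    aeval z (charPolyK k) = z ^ k - ∑ i ∈ range k, z ^ i := by
  simp [charPolyK]

theorem charPolyK_degree_aux (k : ℕ) : (∑ i ∈ range k, (X : ℤ[X]) ^ i).degree < k := by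
  rw [← mem_degreeLT]
  refine Submodule.sum_mem _ fun i hi => ?_
  rw [mem_degreeLT, degree_X_pow]
  exact_mod_cast mem_range.1 hi

theorem charPolyK_monic (k : ℕ) : (charPolyK k).Monic :=
  monic_X_pow_sub (charPolyK_degree_aux k)

theorem charPolyK_natDegree (k : ℕ) : (charPolyK k).natDegree = k := by
  have : (charPolyK k).degree = k := by
    rw [charPolyK, degree_sub_eq_left_of_degree_lt, degree_X_pow]
    rw [degree_X_pow]; exact charPolyK_degree_aux k
  exact natDegree_eq_of_degree_eq_some this

namespace DominantRoot

open IntermediateField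

theorem isIntegral {k : ℕ} {α : ℝ} (h : DominantRoot k α) : IsIntegral ℤ α :=
  ⟨charPolyK k, charPolyK_monic k, by
    have := aeval_charPolyK k α
    rw [h.sum_pow_eq, sub_self] at this
    exact this⟩

theorem natDegree_minpoly_le {k : ℕ} {α : ℝ} (h : DominantRoot k α) :
    (minpoly ℚ α).natDegree ≤ k := by
  have hdvd : minpoly ℚ α ∣ (charPolyK k).map (algebraMap ℤ ℚ) := by
    apply minpoly.dvd
    rw [aeval_map_algebraMap, aeval_charPolyK, h.sum_pow_eq, sub_self]
  have h1 := natDegree_le_of_dvd hdvd ((charPolyK_monic k).map _).ne_zero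
  rwa [(charPolyK_monic k).natDegree_map, charPolyK_natDegree] at h1

theorem embedding_norm_le {k : ℕ} {α : ℝ} (h : DominantRoot k α) (σ : ℚ⟮α⟯ →ₐ[ℚ] ℂ)
    (hσ : σ (AdjoinSimple.gen ℚ α) ≠ α) : ‖σ (AdjoinSimple.gen ℚ α)‖ ≤ 1 := by
  apply h.norm_le_one hσ
  have h1 : ∑ i ∈ range k, AdjoinSimple.gen ℚ α ^ i = AdjoinSimple.gen ℚ α ^ k := by
    apply (algebraMap ℚ⟮α⟯ ℝ).injective
    simp only [map_sum, map_pow, AdjoinSimple.algebraMap_gen]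
    exact h.sum_pow_eq
  have := congr_arg σ h1
  simpa only [map_sum, map_pow] using this

theorem irrational {k : ℕ} {α : ℝ} (h : DominantRoot k α) (q : ℚ) : (q : ℝ) ≠ α := by
  intro hq
  have h1 : IsIntegral ℤ (algebraMap ℚ ℝ q) := by
    have := h.isIntegral
    rw [← hq] at this
    exact this
  have h2 : IsIntegral ℤ q := (isIntegral_algebraMap_iff (algebraMap ℚ ℝ).injective).1 h1
  obtain ⟨n, hn⟩ := IsIntegrallyClosed.isIntegral_iff.1 h2
  have h3 : (n : ℝ) = α := by
    rw [← hq, ← hn]; simp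
  have h4 := h.lower
  have h5 := h.upper
  rw [← h3] at h4 h5
  have h6 : n < 2 := by exact_mod_cast h5
  have h7 : (1 : ℝ) < n := by linarith
  have h8 : 1 < n := by exact_mod_cast h7
  omega

/-- There is a conjugate of `α` in the closed unit disc. -/
theorem exists_conjugate {k : ℕ} {α : ℝ} (h : DominantRoot k α) :
    ∃ β : ℂ, ‖β‖ ≤ 1 ∧ ∀ Q : ℤ[X], aeval α Q = 0 → aeval β Q = 0 := by
  have h_integral : IsIntegral ℚ α := h.isIntegral.tower_top
  have hdeg : 2 ≤ (minpoly ℚ α).natDegree := by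
    rw [minpoly.two_le_natDegree_iff h_integral]
    rintro ⟨q, hq⟩
    exact h.irrational q hq
  have : FiniteDimensional ℚ ℚ⟮α⟯ := adjoin.finiteDimensional h_integral
  have hcard : Fintype.card (ℚ⟮α⟯ →ₐ[ℚ] ℂ) = (minpoly ℚ α).natDegree := by
    rw [AlgHom.card, adjoin.finrank h_integral]
  have hex : ∃ σ : ℚ⟮α⟯ →ₐ[ℚ] ℂ, σ (AdjoinSimple.gen ℚ α) ≠ α := by
    by_contra hall
    push Not at hall
    have : Subsingleton (ℚ⟮α⟯ →ₐ[ℚ] ℂ) :=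
      ⟨fun σ τ => algHom_ext_of_eq_adjoin ℚ rfl (by
        rintro _ rfl
        exact (hall σ).trans (hall τ).symm)⟩
    have := Fintype.card_le_one_iff_subsingleton.2 this
    omega
  obtain ⟨σ, hσ⟩ := hex
  refine ⟨_, h.embedding_norm_le σ hσ, fun Q hQ => ?_⟩
  have h1 : aeval (AdjoinSimple.gen ℚ α) Q = 0 := by
    apply (algebraMap ℚ⟮α⟯ ℝ).injective
    rw [← aeval_algebraMap_apply, AdjoinSimple.algebraMap_gen, hQ, map_zero]
  have h2 := congr_arg (σ.restrictScalars ℤ) h1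
  rw [← aeval_algHom_apply, map_zero] at h2
  exact h2

theorem liouvilleAt {k : ℕ} {α : ℝ} (h : DominantRoot k α) : LiouvilleAt k α := by
  intro Q M hM hQM hQ
  have h_integral : IsIntegral ℚ α := h.isIntegral.tower_top
  have : FiniteDimensional ℚ ℚ⟮α⟯ := adjoin.finiteDimensional h_integral
  classical
  set g := AdjoinSimple.gen ℚ α with hg
  set x : ℚ⟮α⟯ := aeval g Q with hx
  have hgα : algebraMap ℚ⟮α⟯ ℝ g = α := AdjoinSimple.algebraMap_gen ℚ α
  have hxα : algebraMap ℚ⟮α⟯ ℝ x = aeval α Q := by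
    rw [hx, ← aeval_algebraMap_apply, hgα]
  have hx0 : x ≠ 0 := by
    intro h0
    rw [h0, map_zero] at hxα
    exact hQ hxα.symm
  have hgint : IsIntegral ℤ g := by
    have := h.isIntegral
    rw [← hgα] at this
    exact (isIntegral_algebraMap_iff (algebraMap ℚ⟮α⟯ ℝ).injective).1 this
  have hxint : IsIntegral ℤ x := by
    have : x ∈ integralClosure ℤ ℚ⟮α⟯ := by
      rw [hx]
      exact (aeval_mem_adjoin_singleton ℤ g |> fun hm =>
        (Algebra.adjoin_le (S := integralClosure ℤ ℚ⟮α⟯)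
          (Set.singleton_subset_iff.2 hgint)) hm)
    exact this
  have hnint : IsIntegral ℤ (Algebra.norm ℚ x) := Algebra.isIntegral_norm ℚ hxint
  obtain ⟨n, hn⟩ := IsIntegrallyClosed.isIntegral_iff.1 hnint
  have hn0 : n ≠ 0 := by
    rintro rfl
    apply hx0
    rw [← Algebra.norm_eq_zero_iff (R := ℚ), ← hn]; simp
  have hprod := Algebra.norm_eq_prod_embeddings ℚ ℂ x
  have hnorm : (1 : ℝ) ≤ ‖algebraMap ℚ ℂ (Algebra.norm ℚ x)‖ := by
    rw [← hn]
    have : (1 : ℝ) ≤ |(n : ℝ)| := by exact_mod_cast Int.one_le_abs hn0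
    simpa using this
  have hσx : ∀ σ : ℚ⟮α⟯ →ₐ[ℚ] ℂ, σ x = aeval (σ g) Q := fun σ =>
    (aeval_algHom_apply (σ.restrictScalars ℤ) g Q).symm
  rw [hprod, norm_prod] at hnorm
  let σ₀ : ℚ⟮α⟯ →ₐ[ℚ] ℂ := (IsScalarTower.toAlgHom ℚ ℝ ℂ).comp ℚ⟮α⟯.val
  have hσ₀ : σ₀ g = α := by
    change ((algebraMap ℚ⟮α⟯ ℝ g : ℝ) : ℂ) = α
    rw [hgα]
  have hσ₀x : ‖σ₀ x‖ = |aeval α Q| := by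
    rw [hσx, hσ₀]
    have : aeval (α : ℂ) Q = ((aeval α Q : ℝ) : ℂ) := aeval_algebraMap_apply ℂ α Q
    rw [this, Complex.norm_real, Real.norm_eq_abs]
  rw [← mul_prod_erase univ _ (mem_univ σ₀), hσ₀x] at hnorm
  refine hnorm.trans (mul_le_mul_of_nonneg_left ?_ (abs_nonneg _))
  have hcard : #((univ : Finset (ℚ⟮α⟯ →ₐ[ℚ] ℂ)).erase σ₀) ≤ k - 1 := by
    rw [card_erase_of_mem (mem_univ _), card_univ, AlgHom.card, adjoin.finrank h_integral]
    exact Nat.sub_le_sub_right h.natDegree_minpoly_le 1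
  calc ∏ σ ∈ (univ : Finset (ℚ⟮α⟯ →ₐ[ℚ] ℂ)).erase σ₀, ‖σ x‖
      ≤ ∏ _σ ∈ (univ : Finset (ℚ⟮α⟯ →ₐ[ℚ] ℂ)).erase σ₀, M := by
        refine prod_le_prod (fun _ _ => norm_nonneg _) fun σ hσ => ?_
        rw [hσx]
        refine hQM _ (h.embedding_norm_le σ fun he => ?_)
        refine (mem_erase.1 hσ).1 (algHom_ext_of_eq_adjoin ℚ rfl ?_)
        rintro _ rfl
        exact he.trans hσ₀.symm
    _ = M ^ #((univ : Finset (ℚ⟮α⟯ →ₐ[ℚ] ℂ)).erase σ₀) := by rw [prod_const]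
    _ ≤ M ^ (k - 1) := pow_le_pow_right₀ hM hcard

end DominantRoot

/-- The defining properties of the `k`-generalized Fibonacci sequence. -/
structure IsKFib (k : ℕ) (F : ℤ → ℤ) : Prop where
  zero : ∀ i : ℤ, 2 - (k : ℤ) ≤ i → i ≤ 0 → F i = 0
  one : F 1 = 1
  recurrence : ∀ i : ℤ, 2 ≤ i → F i = ∑ j ∈ Icc (1 : ℤ) (k : ℤ), F (i - j)

namespace IsKFib
variable {k : ℕ} {F : ℤ → ℤ}

theorem shift_recurrence (hF : IsKFib k F) (m : ℕ) :
    F ((m + k : ℕ) + 2 - (k : ℤ)) = ∑ i ∈ range k, F ((m + i : ℕ) + 2 - (k : ℤ)) := by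
  rw [hF.recurrence _ (by push_cast; omega)]
  refine sum_bij' (fun j _ => (k - j).toNat) (fun i _ => (k - i : ℤ)) ?_ ?_ ?_ ?_ ?_
  · intro j hj; simp only [mem_Icc, mem_range] at *; omega
  · intro i hi; simp only [mem_Icc, mem_range] at *; omega
  · intro j hj; simp only [mem_Icc] at hj; omega
  · intro i hi; simp only [mem_range] at hi; omega
  · intro j hj; simp only [mem_Icc] at hj; congr 1; omega

theorem double (hF : IsKFib k F) (m : ℕ) :
    F ((m + 1 + k : ℕ) + 2 - (k : ℤ)) + F (m + 2 - (k : ℤ)) =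
      2 * F ((m + k : ℕ) + 2 - (k : ℤ)) := by
  have e1 := sum_range_succ (fun i => F ((m + i : ℕ) + 2 - (k : ℤ))) k
  have e2 := sum_range_succ' (fun i => F ((m + i : ℕ) + 2 - (k : ℤ))) k
  have e3 := hF.shift_recurrence (m + 1)
  have e4 := hF.shift_recurrence m
  have e5 : ∀ i ∈ range k, F ((m + 1 + i : ℕ) + 2 - (k : ℤ)) =
      F ((m + (i + 1) : ℕ) + 2 - (k : ℤ)) := fun i _ => by
    rw [show m + 1 + i = m + (i + 1) by ring]
  rw [sum_congr rfl e5] at e3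
  rw [add_zero] at e2
  linarith

theorem nonneg (hF : IsKFib k F) (m : ℕ) : 0 ≤ F (m + 2 - (k : ℤ)) := by
  induction m using Nat.strong_induction_on with
  | _ m ih =>
    rcases lt_or_ge m k with hm | hm
    · rcases eq_or_ne (m + 1) k with h | h
      · rw [show (m : ℤ) + 2 - k = 1 by omega, hF.one]; norm_num
      · rw [hF.zero _ (by omega) (by omega)]
    · obtain ⟨n, rfl⟩ : ∃ n, m = n + k := ⟨m - k, by omega⟩
      rw [hF.shift_recurrence]
      refine sum_nonneg fun i hi => ih _ ?_
      have := mem_range.1 hi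
      omega

theorem nonneg' (hF : IsKFib k F) {i : ℤ} (hi : 2 - (k : ℤ) ≤ i) : 0 ≤ F i := by
  have := hF.nonneg (i - 2 + k).toNat
  rwa [show ((i - 2 + k).toNat : ℤ) + 2 - k = i by omega] at this

theorem succ_add (hF : IsKFib k F) {i : ℤ} (hi : 2 ≤ i) : F (i + 1) + F (i - k) = 2 * F i := by
  have := hF.double (i - 2).toNat
  rwa [show (((i - 2).toNat + 1 + k : ℕ) : ℤ) + 2 - k = i + 1 by omega,
    show (((i - 2).toNat : ℕ) : ℤ) + 2 - k = i - k by omega,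
    show (((i - 2).toNat + k : ℕ) : ℤ) + 2 - k = i by omega] at this

theorem two (hF : IsKFib k F) (hk : 3 ≤ k) : F 2 = 1 := by
  rw [hF.recurrence 2 le_rfl, sum_eq_single 1]
  · exact hF.one
  · intro j hj hj1
    simp only [mem_Icc] at hj
    exact hF.zero _ (by omega) (by omega)
  · intro h; simp only [mem_Icc] at h; omega

theorem succ_le (hF : IsKFib k F) (hk : 3 ≤ k) {i : ℤ} (hi : 1 ≤ i) : F (i + 1) ≤ 2 * F i := by
  rcases eq_or_lt_of_le hi with rfl | h
  · rw [hF.one, show (1 : ℤ) + 1 = 2 by norm_num, hF.two hk]; norm_num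
  · have := hF.succ_add (i := i) (by omega)
    have := hF.nonneg' (i := i - k) (by omega)
    omega

theorem add_three_le (hF : IsKFib k F) (hk : 3 ≤ k) {i : ℤ} (hi : 2 ≤ i) :
    F (i - 1) + F (i - 2) + F (i - 3) ≤ F i := by
  rw [hF.recurrence i hi]
  have hsub : ({1, 2, 3} : Finset ℤ) ⊆ Icc 1 (k : ℤ) := by
    intro j; simp only [mem_insert, mem_singleton, mem_Icc]; omega
  refine le_trans (le_of_eq ?_) (sum_le_sum_of_subset_of_nonneg hsub fun j hj _ => ?_)
  · simp [add_assoc]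
  · simp only [mem_Icc] at hj
    exact hF.nonneg' (by omega)

theorem one_le (hF : IsKFib k F) (hk : 3 ≤ k) {i : ℤ} (hi : 1 ≤ i) : 1 ≤ F i := by
  induction i, hi using Int.leInduction with
  | base => rw [hF.one]
  | succ i hi ih =>
    have h := hF.add_three_le hk (i := i + 1) (by omega)
    rw [show i + 1 - 1 = i by ring] at h
    have h1 := hF.nonneg' (i := i + 1 - 2) (by omega)
    have h2 := hF.nonneg' (i := i + 1 - 3) (by omega)
    linarith

theorem three_mul_le (hF : IsKFib k F) (hk : 3 ≤ k) {i : ℤ} (hi : 3 ≤ i) :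
    3 * F (i - 1) ≤ F (i + 1) := by
  have h1 := hF.add_three_le hk (i := i + 1) (by omega)
  have h2 := hF.add_three_le hk (i := i) (by omega)
  have h3 := hF.succ_le hk (i := i - 2) (by omega)
  rw [show i - 2 + 1 = i - 1 by ring] at h3
  rw [show i + 1 - 1 = i by ring, show i + 1 - 2 = i - 1 by ring,
    show i + 1 - 3 = i - 2 by ring] at h1
  have := hF.nonneg' (i := i - 3) (by omega)
  linarith

theorem four_le (hF : IsKFib k F) (hk : 3 ≤ k) {i : ℤ} (hi : 3 ≤ i) : 4 ≤ F (i + 1) := by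
  have h3 : F 3 = 2 := by
    have := hF.succ_add (i := 2) le_rfl
    rw [hF.zero (2 - k) le_rfl (by omega), hF.two hk] at this
    norm_num at this; exact this
  have h4 : 4 ≤ F 4 := by
    have := hF.add_three_le hk (i := 4) (by norm_num)
    norm_num [h3, hF.two hk, hF.one] at this; exact this
  induction i, hi using Int.leInduction with
  | base => exact h4
  | succ i hi ih =>
    have h := hF.add_three_le hk (i := i + 1 + 1) (by omega)
    rw [show i + 1 + 1 - 1 = i + 1 by ring] at h
    have h1 := hF.nonneg' (i := i + 1 + 1 - 2) (by omega)
    have h2 := hF.nonneg' (i := i + 1 + 1 - 3) (by omega)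
    linarith

theorem le_two_pow (hF : IsKFib k F) (hk : 3 ≤ k) (m : ℕ) : F ((m : ℤ) + 2) ≤ 2 ^ m := by
  induction m with
  | zero => simp [hF.two hk]
  | succ m ih =>
    have := hF.succ_le hk (i := (m : ℤ) + 2) (by omega)
    push_cast
    rw [show (m : ℤ) + 1 + 2 = m + 2 + 1 by ring, pow_succ]
    linarith

end IsKFib

theorem succ_le_mul_pow {k : ℕ} (hk : 3 ≤ k) : ((k : ℝ) + 1) ≤ 7 / 10 * (9 / 5) ^ k := by
  induction k, hk using Nat.le_induction with
  | base => norm_num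
  | succ k hk ih =>
    have : (3 : ℝ) ≤ k := by exact_mod_cast hk
    rw [pow_succ]; push_cast
    linarith

/-- The coefficient of the dominant root in the Binet formula for `F_n`, normalised so that
`F_n ∼ c * α ^ (n - 1)`. -/
noncomputable def binetCoeff (k : ℕ) (α : ℝ) : ℝ := (α - 1) / ((k + 1) * α - 2 * k)

namespace DominantRoot
variable {k : ℕ} {α : ℝ}

theorem mul_two_sub_le (h : DominantRoot k α) : (k + 1) * (2 - α) ≤ 7 / 10 := by
  have h1 := succ_le_mul_pow h.three_le
  have h2 : (9 / 5 : ℝ) ^ k ≤ α ^ k := pow_le_pow_left₀ (by norm_num) h.lower.le k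
  have h3 := h.eqn
  have h4 := h.upper
  have : ((k : ℝ) + 1) ≤ 7 / 10 * α ^ k := by linarith
  have := mul_le_mul_of_nonneg_right this (by linarith : 0 ≤ 2 - α)
  nlinarith

theorem den_lower (h : DominantRoot k α) : 13 / 10 ≤ (k + 1) * α - 2 * k := by
  have := h.mul_two_sub_le
  linarith

theorem binetCoeff_mul (h : DominantRoot k α) :
    binetCoeff k α * ((k + 1) * α - 2 * k) = α - 1 :=
  div_mul_cancel₀ _ (by linarith [h.den_lower])

theorem binetCoeff_lower (h : DominantRoot k α) : 1 / 2 < binetCoeff k α := by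
  have h1 := h.den_lower
  have h2 := h.upper
  have h3 : (3 : ℝ) ≤ k := by exact_mod_cast h.three_le
  rw [binetCoeff, lt_div_iff₀ (by linarith)]
  nlinarith

theorem binetCoeff_upper (h : DominantRoot k α) : binetCoeff k α < 9 / 10 := by
  have h1 := h.den_lower
  have h2 := h.upper
  have := h.mul_two_sub_le
  rw [binetCoeff, div_lt_iff₀ (by linarith)]
  nlinarith

theorem abs_sub_binet_le (h : DominantRoot k α) {F : ℤ → ℤ} (hF : IsKFib k F) (n : ℕ) :
    |(F (n + 1) : ℝ) - binetCoeff k α * α ^ n| ≤ 1 / 2 := by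
  have hk := h.three_le
  have hl := h.lower
  have hu := h.upper
  set c := binetCoeff k α with hc
  have hc1 := h.binetCoeff_lower
  have hc2 := h.binetCoeff_upper
  let E : ℕ → ℝ := fun m => (F ((m : ℤ) + 2 - k) : ℝ) - c * (2 - α) * α ^ (m + 1)
  have hsmall : ∀ i, i + 1 < k → F ((i : ℤ) + 2 - k) = 0 := fun i hi =>
    hF.zero _ (by omega) (by omega)
  have hlast : F (((k - 1 : ℕ) : ℤ) + 2 - k) = 1 := by
    rw [show ((k - 1 : ℕ) : ℤ) + 2 - k = 1 by omega, hF.one]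
  have hrec : ∀ m, E (m + k) = ∑ i ∈ range k, E (m + i) := by
    intro m
    simp only [E]
    rw [hF.shift_recurrence m, sum_sub_distrib, ← mul_sum]
    push_cast
    congr 2
    simp only [show ∀ i, α ^ (m + i + 1) = α ^ (m + 1) * α ^ i from fun i => by ring]
    rw [← mul_sum, h.sum_pow_eq]
  have hW : ∑ i ∈ range k, cofactorCoeff α (i + 1) * E i = 0 := by
    have e1 : ∑ i ∈ range k, cofactorCoeff α (i + 1) * (F ((i : ℤ) + 2 - k) : ℝ) = 1 := by
      rw [sum_eq_single (k - 1)]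
      · rw [hlast, Nat.sub_add_cancel (by omega), h.cofactorCoeff_self]; norm_num
      · intro i hi hne
        have := mem_range.1 hi
        rw [hsmall i (by omega)]; simp
      · intro hn; exact absurd (mem_range.2 (by omega)) hn
    have e2 : ∑ i ∈ range k, cofactorCoeff α (i + 1) * α ^ (i + 1) =
        (α * α ^ k - k) / (α - 1) := by
      have : ∀ i ∈ range k, cofactorCoeff α (i + 1) * α ^ (i + 1) =
          (α * α ^ i - 1) / (α - 1) := by
        intro i _
        rw [cofactorCoeff]
        have : α ≠ 0 := by linarith
        field_simp
        ring
      rw [sum_congr rfl this, ← sum_div, sum_sub_distrib, ← mul_sum, h.sum_pow_eq]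
      simp
    have e3 : ∀ i ∈ range k, cofactorCoeff α (i + 1) * E i =
        cofactorCoeff α (i + 1) * (F ((i : ℤ) + 2 - k) : ℝ) -
          c * (2 - α) * (cofactorCoeff α (i + 1) * α ^ (i + 1)) := fun i _ => by
      simp only [E]; ring
    rw [sum_congr rfl e3, sum_sub_distrib, e1, ← mul_sum, e2]
    have hcm := h.binetCoeff_mul
    have h1 : α - 1 ≠ 0 := by linarith
    field_simp
    linear_combination -hcm - c * α * h.eqn
  have hE0 : ∀ i < k, |E i| ≤ 1 / 2 := by
    intro i hi
    simp only [E]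
    rcases eq_or_ne (i + 1) k with he | he
    · rw [show i = k - 1 by omega, hlast, Nat.sub_add_cancel (by omega), abs_le]
      have := h.eqn
      constructor <;> push_cast <;> nlinarith
    · rw [hsmall i (by omega)]
      have h1 : α ^ (i + 1) * α ≤ α ^ k := by
        rw [← pow_succ]; exact pow_le_pow_right₀ (by linarith) (by omega)
      have h2 : 0 ≤ (2 - α) * α ^ (i + 1) := by
        have : 0 ≤ 2 - α := by linarith
        positivity
      have h3 : (2 - α) * α ^ (i + 1) * α ≤ 1 := by
        have := mul_le_mul_of_nonneg_left h1 (by linarith : 0 ≤ 2 - α)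
        linarith [h.eqn]
      have h4 : (2 - α) * α ^ (i + 1) ≤ 5 / 9 := by nlinarith
      rw [abs_le]
      constructor <;> push_cast <;> nlinarith
  have key := h.norm_le_of_recurrence (fun m => (E m : ℂ))
    (fun m => by simp only [hrec]; push_cast; rfl) (by exact_mod_cast hW) (C := 1 / 2)
    (fun i hi => by rw [Complex.norm_real]; exact hE0 i hi) (n + (k - 1))
  rw [Complex.norm_real, Real.norm_eq_abs] at key
  convert key using 2
  simp only [E]
  rw [show ((n + (k - 1) : ℕ) : ℤ) + 2 - k = n + 1 by omega,
    show n + (k - 1) + 1 = n + k by omega, pow_add]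
  linear_combination c * α ^ n * h.eqn

end DominantRoot

/-- The analytic information about a hypothetical solution with `n = s + 1` and
`A = F_{m+1}`. -/
structure AnalyticSolution (k : ℕ) (α : ℝ) (m s x A : ℕ) : Prop where
  root : DominantRoot k α
  k_le_m : k ≤ m
  k_le_log : (k : ℝ) ≤ Real.log x
  four_le : 4 ≤ A
  le_two_pow : A ≤ 2 ^ (m - 1)
  approx : |(A : ℝ) - binetCoeff k α * α ^ m| ≤ 1 / 2
  form : |x * Real.log A - s * Real.log α - Real.log (binetCoeff k α)| ≤ 2 / 3 ^ x

theorem abs_log_sub_log_le {a b e : ℝ} (ha : 0 < a) (h : |a - b| ≤ e) (he : e < a) :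
    |Real.log a - Real.log b| ≤ e / (a - e) := by
  have h1 := abs_le.1 h
  have hb : 0 < b := by linarith
  have he0 : 0 ≤ e := (abs_nonneg _).trans h
  have hae : 0 < a - e := by linarith
  rw [← Real.log_div ha.ne' hb.ne', abs_le]
  constructor
  · have := Real.one_sub_inv_le_log_of_pos (div_pos ha hb)
    refine le_trans ?_ this
    rw [inv_div, neg_le_sub_iff_le_add, div_le_iff₀ ha, add_mul, div_mul_eq_mul_div]
    have : e ≤ e * a / (a - e) := by
      rw [le_div_iff₀ hae]; nlinarith
    linarith
  · have := Real.log_le_sub_one_of_pos (div_pos ha hb)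
    refine this.trans ?_
    rw [div_sub_one hb.ne']
    exact div_le_div₀ he0 (by linarith) hae (by linarith)

theorem AnalyticSolution.of_isKFib {k : ℕ} (hk : 3 ≤ k) {F : ℤ → ℤ} (hF : IsKFib k F) {m s x : ℕ}
    (hkm : k ≤ m) (hklog : (k : ℝ) ≤ Real.log x)
    (heq : F (m + 1) ^ x - F (m - 1) ^ x = F (s + 1)) :
    ∃ α A, AnalyticSolution k α m s x A := by
  obtain ⟨α, h⟩ := exists_dominantRoot hk
  have hA := hF.four_le hk (i := m) (by omega)
  have hB := hF.one_le hk (i := m - 1) (by omega)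
  have hAB := hF.three_mul_le hk (i := m) (by omega)
  have hup := hF.le_two_pow hk (m - 1)
  rw [show ((m - 1 : ℕ) : ℤ) + 2 = m + 1 by omega] at hup
  obtain ⟨A, hAe⟩ : ∃ A : ℕ, F (m + 1) = A := ⟨(F (m + 1)).toNat, by omega⟩
  obtain ⟨b, hbe⟩ : ∃ b : ℕ, F (m - 1) = b := ⟨(F (m - 1)).toNat, by omega⟩
  rw [hAe] at hA hAB hup heq
  rw [hbe] at hB hAB heq
  have hAm := h.abs_sub_binet_le hF m
  rw [hAe] at hAm
  have hFs := h.abs_sub_binet_le hF s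
  rw [← heq] at hFs
  push_cast at hAm hFs
  set c := binetCoeff k α
  have hc := h.binetCoeff_lower
  have hα := h.lower
  have hx2 : 2 ≤ x := by
    by_contra hx
    have h3 : (3 : ℝ) ≤ k := by exact_mod_cast hk
    have : x = 0 ∨ x = 1 := by omega
    rcases this with rfl | rfl <;> simp at hklog <;> linarith
  refine ⟨α, A, h, hkm, hklog, by exact_mod_cast hA, by exact_mod_cast hup, hAm, ?_⟩
  have hA' : (4 : ℝ) ≤ A := by exact_mod_cast hA
  have hAB' : 3 * (b : ℝ) ≤ A := by exact_mod_cast hAB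
  have hb' : (1 : ℝ) ≤ b := by exact_mod_cast hB
  have hpow : (b : ℝ) ^ x * 3 ^ x ≤ A ^ x := by
    rw [← mul_pow]; exact pow_le_pow_left₀ (by positivity) (by linarith) x
  have h4 : (4 : ℝ) ^ x ≤ A ^ x := pow_le_pow_left₀ (by norm_num) hA' x
  have h34 : (16 : ℝ) / 9 * 3 ^ x ≤ 4 ^ x := by
    have : ((4 : ℝ) / 3) ^ 2 ≤ (4 / 3) ^ x := pow_le_pow_right₀ (by norm_num) hx2
    rw [div_pow (4 : ℝ) 3 x, le_div_iff₀ (by positivity)] at this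
    norm_num at this; linarith
  have h9 : (9 : ℝ) ≤ 3 ^ x := by
    have : (3 : ℝ) ^ 2 ≤ 3 ^ x := pow_le_pow_right₀ (by norm_num) hx2
    norm_num at this; exact this
  have hb1 : (1 : ℝ) ≤ (b : ℝ) ^ x := one_le_pow₀ hb'
  set P := (A : ℝ) ^ x
  set q := (b : ℝ) ^ x
  set t := (3 : ℝ) ^ x
  have hP : 16 ≤ P := by linarith
  have hclose : |P - c * α ^ s| ≤ q + 1 / 2 := by
    rw [abs_le] at hFs ⊢
    constructor <;> linarith
  have hlt : q + 1 / 2 < P := by nlinarith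
  have hfin := abs_log_sub_log_le (by positivity) hclose hlt
  have hl1 : Real.log P = x * Real.log A := by rw [Real.log_pow]
  have hl2 : Real.log (c * α ^ s) = Real.log c + s * Real.log α := by
    rw [Real.log_mul (by linarith) (by positivity), Real.log_pow]
  rw [hl1, hl2] at hfin
  rw [sub_sub, add_comm (_ * _) (Real.log c)]
  refine hfin.trans ?_
  rw [div_le_div_iff₀ (by linarith) (by positivity)]
  nlinarith

namespace AnalyticSolution
variable {k m s x A : ℕ} {α : ℝ}

theorem three_le_m (h : AnalyticSolution k α m s x A) : 3 ≤ m := h.root.three_le.trans h.k_le_m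

theorem log_A_pos (h : AnalyticSolution k α m s x A) : 1 < Real.log A := by
  have : (4 : ℝ) ≤ A := by exact_mod_cast h.four_le
  rw [Real.lt_log_iff_exp_lt (by linarith)]
  linarith [Real.exp_one_lt_d9]

/-- `log F_{m+1}` is close to `m log α + log c`. -/
theorem abs_log_sub_le (h : AnalyticSolution k α m s x A) :
    |Real.log A - m * Real.log α - Real.log (binetCoeff k α)| ≤ 2 / α ^ m := by
  have hc := h.root.binetCoeff_lower
  have hα := h.root.lower
  have hA' : (4 : ℝ) ≤ A := by exact_mod_cast h.four_le
  have h1 := abs_log_sub_log_le (by positivity) h.approx (by linarith)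
  rw [Real.log_mul (by linarith) (by positivity), Real.log_pow] at h1
  rw [sub_sub, add_comm (_ * _)]
  refine h1.trans ?_
  have h2 := (abs_le.1 h.approx).1
  have h3 : α ^ m / 2 ≤ binetCoeff k α * α ^ m := by
    have : 0 < α ^ m := by positivity
    nlinarith
  rw [div_le_div_iff₀ (by linarith) (by positivity)]
  linarith

end AnalyticSolution

theorem exp_mul_exp_sub_one_le {T z : ℝ} (hT : 12 ≤ T) (hz0 : 0 ≤ z)
    (hz : z ≤ 3 * T * Real.exp (-(2 * T))) : Real.exp T * (Real.exp z - 1) ≤ 1 := by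
  have hq := Real.quadratic_le_exp_of_nonneg (show 0 ≤ T by linarith)
  have h6 : 6 * T ≤ Real.exp T := by nlinarith
  have he : Real.exp (-(2 * T)) = (Real.exp T)⁻¹ * (Real.exp T)⁻¹ := by
    rw [← Real.exp_neg, ← Real.exp_add]; ring_nf
  have hpos := Real.exp_pos T
  have hinv : Real.exp T * (Real.exp T)⁻¹ = 1 := mul_inv_cancel₀ hpos.ne'
  have hi0 : 0 < (Real.exp T)⁻¹ := by positivity
  have h2 : z ≤ (Real.exp T)⁻¹ / 2 := by
    rw [he] at hz
    have : 3 * T * (Real.exp T)⁻¹ ≤ 1 / 2 := by nlinarith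
    nlinarith
  have hz1 : z ≤ 1 := by nlinarith
  have h3 : Real.exp z - 1 ≤ 2 * z := by
    have := Real.exp_bound' hz0 hz1 (n := 2) (by norm_num)
    norm_num [sum_range_succ] at this
    nlinarith
  nlinarith

theorem log_three_mul_add_one_le {k : ℕ} (hk : 3 ≤ k) : Real.log (3 * k + 1) ≤ k := by
  rw [Real.log_le_iff_le_exp (by positivity)]
  have hk' : (3 : ℝ) ≤ k := by exact_mod_cast hk
  have h := Real.quadratic_le_exp_of_nonneg (show (0 : ℝ) ≤ k by positivity)
  have h1 : (7 / 3 : ℝ) ^ k ≤ Real.exp k := by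
    rw [← Real.exp_one_pow]
    exact pow_le_pow_left₀ (by norm_num) (by linarith [Real.exp_one_gt_d9]) k
  have : (3 * k + 1 : ℝ) ≤ (7 / 3) ^ k := by
    clear h h1 hk'
    induction k, hk using Nat.le_induction with
    | base => norm_num
    | succ k hk ih =>
      have : (3 : ℝ) ≤ k := by exact_mod_cast hk
      rw [pow_succ]; push_cast; linarith
  linarith

namespace DominantRoot
variable {k : ℕ} {α : ℝ}

theorem log_lower (h : DominantRoot k α) : 586 / 1000 < Real.log α := by
  have h1 : Real.log (9 / 5) < Real.log α := Real.log_lt_log (by norm_num) h.lower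
  have h2 : 11 * Real.log 2 ≤ 13 * Real.log (9 / 5) := by
    have := Real.log_le_log (by norm_num) (show (2 : ℝ) ^ 11 ≤ (9 / 5) ^ 13 by norm_num)
    rwa [Real.log_pow, Real.log_pow] at this
  linarith [Real.log_two_gt_d9]

theorem log_upper (h : DominantRoot k α) : Real.log α < 694 / 1000 := by
  have := Real.log_lt_log (by linarith [h.lower]) h.upper
  linarith [Real.log_two_lt_d9]

theorem log_binetCoeff_lower (h : DominantRoot k α) :
    -(694 / 1000) < Real.log (binetCoeff k α) := by
  have := Real.log_lt_log (by norm_num) h.binetCoeff_lower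
  rw [one_div, Real.log_inv] at this
  linarith [Real.log_two_lt_d9]

theorem log_binetCoeff_upper (h : DominantRoot k α) :
    Real.log (binetCoeff k α) < -(1 / 10) := by
  have h1 := h.binetCoeff_lower
  have := Real.log_le_sub_one_of_pos (show 0 < binetCoeff k α by linarith)
  linarith [h.binetCoeff_upper]

/-- `α` and a rational integer of absolute value at least two are multiplicatively independent. -/
theorem pow_ne_natCast_pow (h : DominantRoot k α) {A a t : ℕ} (hA : 2 ≤ A) (ha : a ≠ 0) :
    (A : ℝ) ^ a ≠ α ^ t := by
  intro he
  obtain ⟨β, hβ, hQ⟩ := h.exists_conjugate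
  have h0 := hQ (C ((A : ℤ) ^ a) - X ^ t) (by simp [he])
  have h1 : β ^ t = (A : ℂ) ^ a := by
    simp at h0; linear_combination -h0
  have h2 : ‖β ^ t‖ ≤ 1 := by rw [norm_pow]; exact pow_le_one₀ (norm_nonneg _) hβ
  rw [h1, norm_pow, Complex.norm_natCast] at h2
  have h3 : 1 < (A : ℝ) ^ a := one_lt_pow₀ (by exact_mod_cast hA) ha
  linarith

/-- `α` and the Binet coefficient are multiplicatively independent, for exponents of opposite
behaviour. -/
theorem pow_mul_pow_ne (h : DominantRoot k α) {p q : ℕ} (hq : q ≠ 0) :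
    α ^ p * (α - 1) ^ q ≠ ((k + 1) * α - 2 * k) ^ q := by
  intro he
  obtain ⟨β, hβ, hQ⟩ := h.exists_conjugate
  have h0 := hQ ((X : ℤ[X]) ^ p * (X - 1) ^ q - (((k : ℤ[X]) + 1) * X - 2 * (k : ℤ[X])) ^ q) (by simp [he, map_ofNat])
  have h1 : β ^ p * (β - 1) ^ q = ((k + 1) * β - 2 * k) ^ q := by
    simp [map_ofNat] at h0; linear_combination h0
  have hn := congr_arg norm h1
  rw [norm_mul, norm_pow, norm_pow, norm_pow] at hn
  have h2 : ‖β - 1‖ < ‖(k + 1) * β - 2 * k‖ := by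
    rw [← sq_lt_sq₀ (norm_nonneg _) (norm_nonneg _), ← Complex.normSq_eq_norm_sq,
      ← Complex.normSq_eq_norm_sq, Complex.normSq_apply, Complex.normSq_apply]
    have hre : β.re ≤ 1 := (Complex.re_le_norm β).trans hβ
    have hk : (3 : ℝ) ≤ k := by exact_mod_cast h.three_le
    simp
    have e1 : 0 ≤ (1 - β.re) := by linarith
    have : ((k + 1) * β.re - 2 * k) = -((k + 1) * (1 - β.re) + (k - 1)) := by ring
    rw [this]
    have e2 : 0 ≤ (k + 1) * (1 - β.re) := by positivity
    have e3 : (1 - β.re) ≤ (k + 1) * (1 - β.re) := by nlinarith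
    have e4 : β.im * β.im ≤ ((k + 1) * β.im) * ((k + 1) * β.im) := by
      have : (1 : ℝ) ≤ (k + 1) * (k + 1) := by nlinarith
      nlinarith [mul_self_nonneg β.im]
    nlinarith
  have h3 : ‖β‖ ^ p * ‖β - 1‖ ^ q ≤ ‖β - 1‖ ^ q :=
    mul_le_of_le_one_left (by positivity) (pow_le_one₀ (norm_nonneg _) hβ)
  have h4 := pow_lt_pow_left₀ h2 (norm_nonneg _) hq
  linarith

end DominantRoot

theorem norm_aeval_sub_one_le {z : ℂ} (hz : ‖z‖ ≤ 1) : ‖aeval z (X - 1 : ℤ[X])‖ ≤ 2 := by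
  simp only [map_sub, aeval_X, map_one]
  refine (norm_sub_le _ _).trans ?_
  rw [norm_one]; linarith

theorem norm_aeval_den_le {k : ℕ} (hk : 3 ≤ k) {z : ℂ} (hz : ‖z‖ ≤ 1) :
    ‖aeval z (((k : ℤ[X]) + 1) * X - 2 * (k : ℤ[X]))‖ ≤ 3 * k + 1 := by
  simp only [map_sub, map_mul, map_add, aeval_X, map_one, map_natCast, map_ofNat]
  refine (norm_sub_le _ _).trans ?_
  have h1 : ‖(k + 1 : ℂ)‖ = k + 1 := by
    rw [show (k + 1 : ℂ) = ((k + 1 : ℕ) : ℂ) by push_cast; rfl, Complex.norm_natCast]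
    push_cast; rfl
  have h2 : ‖(2 * k : ℂ)‖ = 2 * k := by
    rw [show (2 * k : ℂ) = ((2 * k : ℕ) : ℂ) by push_cast; rfl, Complex.norm_natCast]
    push_cast; rfl
  rw [norm_mul, h1, h2]
  have : (0 : ℝ) ≤ k := by positivity
  nlinarith

theorem abs_exp_sub_one_le_exp_abs (z : ℝ) : |Real.exp z - 1| ≤ Real.exp |z| - 1 := by
  rcases le_total 0 z with h | h
  · rw [abs_of_nonneg h, abs_of_nonneg (by linarith [Real.add_one_le_exp z])]
  · have h1 : Real.exp z ≤ 1 := Real.exp_le_one_iff.2 h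
    rw [abs_of_nonpos h, abs_of_nonpos (by linarith)]
    linarith [Real.add_one_le_exp z, Real.add_one_le_exp (-z)]

/-- A Liouville-type lower bound for the linear forms `q log c + p log α`. -/
theorem DominantRoot.le_mul_of_abs_le {k : ℕ} {α : ℝ} (hr : DominantRoot k α) {p q : ℕ}
    (hq : q ≠ 0) {T : ℝ} (hT : 12 ≤ T)
    (hsmall : |q * Real.log (binetCoeff k α) + p * Real.log α| ≤ 3 * T * Real.exp (-(2 * T))) :
    T ≤ q * (4 * k ^ 2 + 1) := by
  have hk3 := hr.three_le
  have hk : (3 : ℝ) ≤ k := by exact_mod_cast hk3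
  have hc1 := hr.binetCoeff_lower
  have hα1 := hr.lower
  have hα2 := hr.upper
  have hq1 : (1 : ℝ) ≤ q := by exact_mod_cast Nat.one_le_iff_ne_zero.2 hq
  have hval := exp_mul_exp_sub_one_le hT (abs_nonneg _) hsmall
  set Λ := q * Real.log (binetCoeff k α) + p * Real.log α with hΛ
  set Q : ℤ[X] := X ^ p * (X - 1) ^ q - (((k : ℤ[X]) + 1) * X - 2 * (k : ℤ[X])) ^ q with hQ
  have hden := hr.den_lower
  have hden2 : (k + 1) * α - 2 * k ≤ 2 := by nlinarith
  have hQα : aeval α Q = α ^ p * (α - 1) ^ q - ((k + 1) * α - 2 * k) ^ q := by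
    simp [hQ, map_ofNat]
  have hne : aeval α Q ≠ 0 := by
    rw [hQα]; exact sub_ne_zero.2 (hr.pow_mul_pow_ne hq)
  have hbd : ∀ z : ℂ, ‖z‖ ≤ 1 → ‖aeval z Q‖ ≤ 2 * (3 * k + 1) ^ q := by
    intro z hz
    rw [hQ, map_sub, map_mul, map_pow, map_pow, map_pow, aeval_X]
    refine (norm_sub_le _ _).trans ?_
    rw [norm_mul, norm_pow, norm_pow, norm_pow]
    have b1 : ‖z‖ ^ p ≤ 1 := pow_le_one₀ (norm_nonneg _) hz
    have b2 : ‖aeval z (X - 1 : ℤ[X])‖ ^ q ≤ (3 * k + 1) ^ q :=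
      pow_le_pow_left₀ (norm_nonneg _) ((norm_aeval_sub_one_le hz).trans (by linarith)) q
    have b3 : ‖aeval z (((k : ℤ[X]) + 1) * X - 2 * (k : ℤ[X]))‖ ^ q ≤ (3 * k + 1) ^ q :=
      pow_le_pow_left₀ (norm_nonneg _) (norm_aeval_den_le hk3 hz) q
    have b4 : ‖z‖ ^ p * ‖aeval z (X - 1 : ℤ[X])‖ ^ q ≤ 1 * (3 * k + 1) ^ q :=
      mul_le_mul b1 b2 (by positivity) zero_le_one
    linarith
  have hM1 : (1 : ℝ) ≤ (3 * k + 1) ^ q := one_le_pow₀ (by linarith)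
  have hliou := hr.liouvilleAt Q _ (by linarith) hbd hne
  have hQabs : |aeval α Q| ≤ 2 ^ q * (Real.exp |Λ| - 1) := by
    have e0 : Real.exp Λ = binetCoeff k α ^ q * α ^ p := by
      rw [hΛ, Real.exp_add, ← Real.log_pow, ← Real.log_pow, Real.exp_log (by positivity),
        Real.exp_log (by positivity)]
    have e1 : α ^ p * (α - 1) ^ q - ((k + 1) * α - 2 * k) ^ q =
        ((k + 1) * α - 2 * k) ^ q * (Real.exp Λ - 1) := by
      rw [e0, ← hr.binetCoeff_mul, mul_pow]
      ring
    rw [hQα, e1, abs_mul, abs_of_nonneg (pow_nonneg (by linarith) q)]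
    exact mul_le_mul (pow_le_pow_left₀ (by linarith) hden2 q) (abs_exp_sub_one_le_exp_abs Λ)
      (abs_nonneg _) (by positivity)
  have p0 : 0 ≤ ((2 : ℝ) * (3 * k + 1) ^ q) ^ (k - 1) := by positivity
  have hchain : Real.exp T ≤ 2 ^ q * (2 * (3 * k + 1) ^ q) ^ (k - 1) :=
    calc Real.exp T = Real.exp T * 1 := by ring
      _ ≤ Real.exp T * (|aeval α Q| * (2 * (3 * k + 1) ^ q) ^ (k - 1)) :=
        mul_le_mul_of_nonneg_left hliou (Real.exp_pos _).le
      _ ≤ Real.exp T * (2 ^ q * (Real.exp |Λ| - 1) * (2 * (3 * k + 1) ^ q) ^ (k - 1)) :=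
        mul_le_mul_of_nonneg_left (mul_le_mul_of_nonneg_right hQabs p0) (Real.exp_pos _).le
      _ = (Real.exp T * (Real.exp |Λ| - 1)) * (2 ^ q * (2 * (3 * k + 1) ^ q) ^ (k - 1)) := by ring
      _ ≤ 1 * (2 ^ q * (2 * (3 * k + 1) ^ q) ^ (k - 1)) :=
        mul_le_mul_of_nonneg_right hval (by positivity)
      _ = _ := one_mul _
  have hlog := Real.log_le_log (Real.exp_pos T) hchain
  rw [Real.log_exp, Real.log_mul (by positivity) (by positivity), Real.log_pow, Real.log_pow,
    Real.log_mul (by positivity) (by positivity), Real.log_pow] at hlog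
  have hl2 := Real.log_two_lt_d9
  have hl20 := Real.log_two_gt_d9
  have hl3 := log_three_mul_add_one_le hk3
  have hl30 := Real.log_nonneg (show (1 : ℝ) ≤ 3 * k + 1 by linarith)
  have hk1 : ((k - 1 : ℕ) : ℝ) ≤ k := by exact_mod_cast Nat.sub_le k 1
  have g1 : (q : ℝ) * Real.log 2 ≤ q * k :=
    mul_le_mul_of_nonneg_left (by linarith) (by linarith)
  have g2' : (q : ℝ) * Real.log (3 * k + 1) ≤ q * k :=
    mul_le_mul_of_nonneg_left (by linarith) (by linarith)
  have g2 : Real.log 2 + q * Real.log (3 * k + 1) ≤ 2 * (q * k) := by nlinarith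
  have g3 : ((k - 1 : ℕ) : ℝ) * (Real.log 2 + q * Real.log (3 * k + 1)) ≤ k * (2 * (q * k)) :=
    mul_le_mul hk1 g2 (by positivity) (by positivity)
  have g4 : (q : ℝ) * k ≤ q * (k * k) := by
    refine mul_le_mul_of_nonneg_left ?_ (by linarith)
    nlinarith
  nlinarith

theorem injOn_of_forall_ne {y N S : ℕ} (hy : 0 < y) (hN : 0 < N)
    (h : ∀ p q : ℕ, q ≠ 0 → q ≤ S → p * y ≠ q * N) :
    Set.InjOn (fun q : ℕ × ℕ => q.1 * (y : ℝ) + q.2 * (N : ℝ)) {q | q.2 ≤ S} := by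
  have main : ∀ p q p' d : ℕ, q + d + 1 ≤ S → p * y + q * N ≠ p' * y + (q + d + 1) * N := by
    intro p q p' d hS he
    have hpp : p' ≤ p := by
      by_contra hcon
      have : p * y ≤ p' * y := Nat.mul_le_mul_right _ (by omega)
      have : q * N < (q + d + 1) * N := Nat.mul_lt_mul_of_pos_right (by omega) hN
      omega
    obtain ⟨e, rfl⟩ := Nat.exists_eq_add_of_le hpp
    refine h e (d + 1) (by omega) (by omega) ?_
    simp only [add_mul] at he ⊢
    omega
  rintro ⟨p, q⟩ hq ⟨p', q'⟩ hq' he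
  replace hq : q ≤ S := hq
  replace hq' : q' ≤ S := hq'
  have he' : p * y + q * N = p' * y + q' * N := by
    simp only at he
    exact_mod_cast he
  rcases lt_trichotomy q q' with hlt | rfl | hlt
  · obtain ⟨d, rfl⟩ := Nat.exists_eq_add_of_lt hlt
    exact absurd he' (main _ _ _ _ hq')
  · have : p * y = p' * y := by omega
    rw [Nat.eq_of_mul_eq_mul_right hy this]
  · obtain ⟨d, rfl⟩ := Nat.exists_eq_add_of_lt hlt
    exact absurd he'.symm (main _ _ _ _ hq)

namespace AnalyticSolution
variable {k m s x A : ℕ} {α : ℝ}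

theorem twenty_le (h : AnalyticSolution k α m s x A) : 20 ≤ x := by
  have hk : (3 : ℝ) ≤ k := by exact_mod_cast h.root.three_le
  have h1 := h.k_le_log
  have hx0 : (0 : ℝ) < x := by
    rcases Nat.eq_zero_or_pos x with rfl | hx
    · have := h.root.three_le
      simp at h1; omega
    · exact_mod_cast hx
  have h2 : Real.exp 3 ≤ x := by
    rw [← Real.le_log_iff_exp_le hx0]; linarith
  have h3 : (2.7182 : ℝ) ^ 3 ≤ Real.exp 3 := by
    have := pow_le_pow_left₀ (by norm_num) (show (2.7182 : ℝ) ≤ Real.exp 1 by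
      linarith [Real.exp_one_gt_d9]) 3
    rwa [Real.exp_one_pow] at this
  have : (20 : ℝ) ≤ x := by norm_num at h3; linarith
  exact_mod_cast this

/-- The linear form in `log α` and `log c`. -/
theorem abs_form_le (h : AnalyticSolution k α m s x A) :
    |(x - 1) * Real.log (binetCoeff k α) + (m * x - s) * Real.log α| ≤
      2 * x / α ^ m + 2 / 3 ^ x := by
  have h1 := h.form
  have h2 := h.abs_log_sub_le
  have e : (x - 1) * Real.log (binetCoeff k α) + (m * x - s) * Real.log α =
      (x * Real.log A - s * Real.log α - Real.log (binetCoeff k α)) -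
        x * (Real.log A - m * Real.log α - Real.log (binetCoeff k α)) := by ring
  rw [e]
  refine (abs_sub _ _).trans ?_
  rw [abs_mul, Nat.abs_cast]
  have := mul_le_mul_of_nonneg_left h2 (Nat.cast_nonneg (α := ℝ) x)
  have e2 : (x : ℝ) * (2 / α ^ m) = 2 * x / α ^ m := by ring
  linarith

set_option maxHeartbeats 1000000 in
theorem min_le (h : AnalyticSolution k α m s x A) :
    ((min x m : ℕ) : ℝ) ≤ 5200 * k ^ 4 * Real.log x ^ 2 := by
  by_contra! hM
  set M := min x m with hMdef
  set v := Real.log x with hv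
  have hr := h.root
  have hk3 := hr.three_le
  have hk : (3 : ℝ) ≤ k := by exact_mod_cast hk3
  have hkv : (k : ℝ) ≤ v := h.k_le_log
  have hx20 := h.twenty_le
  have hx20' : (20 : ℝ) ≤ x := by exact_mod_cast hx20
  set ℓ := Real.log α with hℓ
  have hℓ1 := hr.log_lower
  have hℓ2 := hr.log_upper
  set lc := Real.log (binetCoeff k α) with hlc
  have hlc1 := hr.log_binetCoeff_lower
  have hlc2 := hr.log_binetCoeff_upper
  have hc1 := hr.binetCoeff_lower
  have hα1 := hr.lower
  have hα2 := hr.upper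
  obtain ⟨L, hL1, hL2⟩ : ∃ L : ℕ, 4 * k * v + 3 ≤ (L : ℝ) ∧ (L : ℝ) ≤ 4 * k * v + 4 := by
    refine ⟨⌈4 * k * v⌉₊ + 3, ?_, ?_⟩
    · push_cast; linarith [Nat.le_ceil (4 * k * v)]
    · push_cast; linarith [Nat.ceil_lt_add_one (show 0 ≤ 4 * k * v by positivity)]
  set J := 4 * k ^ 2 + 1 with hJ
  have hJ' : (J : ℝ) = 4 * k ^ 2 + 1 := by rw [hJ]; push_cast; ring
  have hkv9 : 9 ≤ k * v := by clear * - hk hkv; nlinarith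
  have hL39 : (39 : ℝ) ≤ L := by linarith
  have hJ37 : (37 : ℝ) ≤ J := by rw [hJ']; clear * - hk; nlinarith
  have hLN : 1 ≤ L := by exact_mod_cast (by linarith : (1 : ℝ) ≤ L)
  set T : ℝ := 16 * L ^ 2 * J with hT
  have hTM : 2 * T ≤ M * (58 / 100) := by
    have a1 : (L : ℝ) ≤ 40 / 9 * (k * v) := by linarith
    have a2 : (J : ℝ) ≤ 37 / 9 * k ^ 2 := by rw [hJ']; clear * - hk; nlinarith
    have a3 : (L : ℝ) ^ 2 ≤ (40 / 9 * (k * v)) ^ 2 := pow_le_pow_left₀ (by positivity) a1 2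
    have a4 : (L : ℝ) ^ 2 * J ≤ (40 / 9 * (k * v)) ^ 2 * (37 / 9 * k ^ 2) :=
      mul_le_mul a3 a2 (by positivity) (by positivity)
    have a5 : (40 / 9 * (k * v)) ^ 2 * (37 / 9 * k ^ 2) = 59200 / 729 * (k ^ 4 * v ^ 2) := by ring
    rw [a5] at a4
    have a6 : 0 ≤ (k : ℝ) ^ 4 * v ^ 2 := by positivity
    rw [hT]
    linarith
  have hT500 : 500 ≤ T := by
    have b1 : (39 : ℝ) ^ 2 * 37 ≤ L ^ 2 * J := by gcongr
    rw [hT]; linarith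
  have hT12 : 12 ≤ T := by linarith
  have hMx : (M : ℝ) ≤ x := by exact_mod_cast min_le_left x m
  have hMm : (M : ℝ) ≤ m := by exact_mod_cast min_le_right x m
  have hTx : T ≤ x := by linarith
  set η := Real.exp (-(2 * T)) with hη
  have hη0 : 0 < η := Real.exp_pos _
  have hη3 : η ≤ 1 / 1000 := by
    have h1 := Real.quadratic_le_exp_of_nonneg (show 0 ≤ 2 * T by linarith)
    have h2 : 1000 ≤ 2 * T := by linarith
    rw [hη, Real.exp_neg, ← one_div]
    exact one_div_le_one_div_of_le (by norm_num) (by clear * - h1 h2; nlinarith)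
  have hαm : (α ^ m)⁻¹ ≤ η := by
    rw [hη, Real.exp_neg]
    refine inv_anti₀ (Real.exp_pos _) ?_
    rw [← Real.le_log_iff_exp_le (by positivity), Real.log_pow]
    have b1 : (M : ℝ) * (586 / 1000) ≤ m * Real.log α := by gcongr
    linarith
  have h3x : ((3 : ℝ) ^ x)⁻¹ ≤ η := by
    rw [hη, Real.exp_neg]
    refine inv_anti₀ (Real.exp_pos _) ?_
    rw [← Real.le_log_iff_exp_le (by positivity), Real.log_pow]
    have : 2 / 3 ≤ Real.log 3 := by
      have := Real.one_sub_inv_le_log_of_pos (show (0 : ℝ) < 3 by norm_num)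
      norm_num at this ⊢; linarith
    have : (x : ℝ) * (2 / 3) ≤ x * Real.log 3 := by gcongr
    linarith
  have hform : |(x - 1) * lc + (m * x - s) * ℓ| ≤ 3 * η * (x - 1) := by
    refine h.abs_form_le.trans ?_
    have e1 : 2 * x / α ^ m + 2 / 3 ^ x = 2 * x * (α ^ m)⁻¹ + 2 * ((3 : ℝ) ^ x)⁻¹ := by ring
    rw [e1]
    have b1 : 2 * x * (α ^ m)⁻¹ ≤ 2 * x * η := by gcongr
    have b2 : 20 * η ≤ x * η := by gcongr
    linarith
  have hform' := abs_le.1 hform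
  obtain ⟨y, hy⟩ : ∃ y : ℕ, x = y + 1 := ⟨x - 1, by omega⟩
  have hy' : (x : ℝ) = y + 1 := by rw [hy]; push_cast; ring
  rw [show (x : ℝ) - 1 = y by linarith] at hform hform'
  have hy19 : (19 : ℝ) ≤ y := by linarith
  have hNpos : (0 : ℝ) < m * x - s := by
    have b1 : η * y ≤ 1 / 1000 * y := by gcongr
    have b2 : (y : ℝ) * lc ≤ y * (-(1 / 10)) := by gcongr
    by_contra! hcon
    have : (m * x - s) * ℓ ≤ 0 := mul_nonpos_of_nonpos_of_nonneg hcon (by linarith)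
    linarith
  obtain ⟨N, hN⟩ : ∃ N : ℕ, (N : ℝ) = m * x - s := by
    refine ⟨m * x - s, ?_⟩
    have : s < m * x := by exact_mod_cast (by push_cast; linarith : ((s : ℕ) : ℝ) < ((m * x : ℕ) : ℝ))
    rw [Nat.cast_sub this.le]; push_cast; ring
  rw [← hN] at hform hform' hNpos
  have hN0 : 0 < N := by exact_mod_cast hNpos
  have hN12 : (N : ℝ) ≤ 6 / 5 * y := by
    have e1 : (N : ℝ) * (586 / 1000) ≤ N * ℓ := by gcongr
    have e2 : y * -(694 / 1000) ≤ y * lc := by gcongr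
    have e3 : η * y ≤ 1 / 1000 * y := by gcongr
    linarith
  have hLS : (L : ℝ) * (16 * L) ≤ T := by
    have : (L : ℝ) ^ 2 * 1 ≤ L ^ 2 * J := by gcongr; linarith
    rw [hT]; linarith
  -- the two exponents are not almost proportional with small coefficients
  have hindep : ∀ p q : ℕ, q ≠ 0 → q ≤ 16 * L → p * y ≠ q * N := by
    intro p q hq hqS hpq
    have hq1 : (1 : ℝ) ≤ q := by exact_mod_cast Nat.one_le_iff_ne_zero.2 hq
    have hqS' : (q : ℝ) ≤ 16 * L := by exact_mod_cast hqS
    have hpq' : (p : ℝ) * y = q * N := by exact_mod_cast hpq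
    have hsmall : |q * lc + p * ℓ| ≤ 3 * η * q := by
      have e : (y : ℝ) * (q * lc + p * ℓ) = q * (y * lc + N * ℓ) := by
        linear_combination ℓ * hpq'
      have e' := congr_arg abs e
      rw [abs_mul, abs_mul, Nat.abs_cast, Nat.abs_cast] at e'
      have := mul_le_mul_of_nonneg_left hform (show (0 : ℝ) ≤ q by positivity)
      rw [← e'] at this
      have : (y : ℝ) * |q * lc + p * ℓ| ≤ y * (3 * η * q) := by linarith
      exact le_of_mul_le_mul_left this (by linarith)
    have hqT : 3 * η * q ≤ 3 * T * η := by
      have : η * q ≤ η * T := mul_le_mul_of_nonneg_left (by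
        have : (L : ℝ) * 39 ≤ L * L := by gcongr
        linarith) hη0.le
      linarith
    have hcon := hr.le_mul_of_abs_le hq hT12 (hsmall.trans hqT)
    rw [← hJ'] at hcon
    have g5 : (q : ℝ) * J ≤ 16 * L * J := by gcongr
    have g6 : 16 * (L : ℝ) * J * 39 ≤ T := by
      rw [hT]
      have : 16 * (L : ℝ) * J * 39 ≤ 16 * L * J * L := by gcongr
      linarith
    have : 0 < 16 * (L : ℝ) * J := by positivity
    linarith
  set S := 16 * L with hS
  have hinj : Set.InjOn (fun q : ℕ × ℕ => q.1 * (y : ℝ) + q.2 * (N : ℝ))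
      {q | q.1 < L * J ∧ q.2 ≤ S} := by
    exact (injOn_of_forall_ne (by omega) hN0 hindep).mono fun q hq => hq.2
  have hSJ : 1 ≤ S * J := Nat.mul_pos (by omega) (by omega)
  have hKL : ((S * J : ℕ) : ℝ) * L = T := by rw [hT, hS]; push_cast; ring
  have hLJ20 : L * (J + 101 / 5) ≤ (x : ℝ) := by
    refine le_trans ?_ hTx
    rw [hT]
    have : (L : ℝ) * 1 ≤ L * L := by gcongr; linarith
    have b2 : (L : ℝ) * L * 37 ≤ L * L * J := by gcongr
    have b3 : (L : ℝ) * J * 39 ≤ L * J * L := by gcongr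
    linarith
  have hlx : Real.log (((L : ℝ) * (J + 101 / 5)) * y) ≤ 2 * v := by
    have : (L : ℝ) * (J + 101 / 5) * y ≤ (x : ℝ) ^ 2 := by
      rw [sq]; gcongr; linarith
    have := Real.log_le_log (by positivity) this
    rwa [Real.log_pow] at this
  have hLJ1 : 1 ≤ (L : ℝ) * J := by
    have : (39 : ℝ) * 37 ≤ L * J := by gcongr
    linarith
  have hB1 : 1 ≤ (L : ℝ) * (J + 101 / 5) * y := by
    have : (39 : ℝ) * (37 + 101 / 5) * 19 ≤ L * (J + 101 / 5) * y := by gcongr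
    linarith
  have key := interpolation_inequality (by omega : 1 ≤ k) hr.liouvilleAt (K := S * J) (L := L)
    (R := L * J) (S := S) hSJ hLN (a₁ := α) (a₂ := (binetCoeff k α)⁻¹) (by linarith)
    (by linarith) (by positivity) (b₁ := N) (b₂ := y) (by omega)
    (A₁ := X) (D₁ := 1) (A₂ := ((k : ℤ[X]) + 1) * X - 2 * (k : ℤ[X])) (D₂ := X - 1)
    (M₁ := 1) (M₂ := 3 * k + 1) (by simp) (by
      have : binetCoeff k α ≠ 0 := by linarith
      simp only [map_sub, map_mul, map_add, aeval_X, map_one, map_natCast, map_ofNat]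
      rw [eq_inv_mul_iff_mul_eq₀ this, hr.binetCoeff_mul])
    (by simp) (by simp only [map_sub, aeval_X, map_one]; linarith) le_rfl (by linarith)
    (by simp) (by simp) (fun z hz => norm_aeval_den_le hk3 hz)
    (fun z hz => (norm_aeval_sub_one_le hz).trans (by linarith)) hinj (by
      have : S * J - 1 < S * J := by omega
      calc L * (S * J - 1) < L * (S * J) := Nat.mul_lt_mul_of_pos_left this (by omega)
        _ ≤ L * J * (S + 1) := by rw [mul_comm S J, ← mul_assoc]; exact Nat.mul_le_mul_left _ (by omega))
    (B := ((L : ℝ) * (J + 101 / 5)) * y) (X := ℓ * ((L : ℝ) * (J + 101 / 5))) (w := 0)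
    (by linarith) (by
      rw [hS]; push_cast
      have : (16 : ℝ) * L * N ≤ 16 * L * (6 / 5 * y) := by gcongr
      linarith) (by
      rw [abs_of_pos (by linarith)]
      apply le_of_eq
      have : (y : ℝ) ≠ 0 := by linarith
      field_simp
      exact hℓ.symm) (by
      rw [hKL]
      refine exp_mul_exp_sub_one_le hT12 (by positivity) ?_
      rw [Real.log_inv, ← hlc, ← hℓ, show (y : ℝ) * -lc - N * ℓ = -(y * lc + N * ℓ) by ring,
        abs_neg, div_le_iff₀ (by linarith)]
      have : (L : ℝ) * S ≤ T := by rw [hS]; push_cast; exact hLS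
      calc (L : ℝ) * S * |y * lc + N * ℓ| ≤ T * (3 * η * y) := by gcongr
        _ = 3 * T * η * y := by ring) (by
      simp only [map_sub, aeval_X, map_one, Real.log_one, mul_zero, zero_add]
      have : Real.log (α - 1) ≤ 0 := Real.log_nonpos (by linarith) (by linarith)
      exact mul_nonpos_of_nonneg_of_nonpos (by positivity) this)
  rw [hKL, Real.log_one, mul_zero, zero_add, add_zero] at key
  have hS' : (S : ℝ) = 16 * L := by rw [hS]; push_cast; ring
  push_cast at key
  rw [hS'] at key
  have f1 : Real.log T ≤ v := Real.log_le_log (by linarith) hTx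
  have f2 : 2 * k * Real.log T ≤ L := by
    have : 2 * k * Real.log T ≤ 2 * k * v := by gcongr
    linarith
  have f3 : (16 * (L : ℝ) * J - 1) * (k * Real.log ((L : ℝ) * (J + 101 / 5) * y) + 1) ≤
      16 * L * J * ((L - 1) / 2) := by
    have : k * Real.log ((L : ℝ) * (J + 101 / 5) * y) ≤ k * (2 * v) := by gcongr
    have l0 : 0 ≤ 16 * (L : ℝ) * J - 1 := by linarith
    refine mul_le_mul (by linarith) (by linarith) ?_ (by positivity)
    have : 0 ≤ Real.log ((L : ℝ) * (J + 101 / 5) * y) := Real.log_nonneg (by linarith)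
    positivity
  have hl3 := log_three_mul_add_one_le hk3
  have f4 : ((k : ℝ) - 1) * (16 * L * Real.log (3 * k + 1)) ≤ 4 * L * (J - 1) := by
    have hl0 := Real.log_nonneg (show (1 : ℝ) ≤ 3 * k + 1 by linarith)
    calc ((k : ℝ) - 1) * (16 * L * Real.log (3 * k + 1)) ≤ k * (16 * L * k) := by
          gcongr; linarith
      _ = 4 * L * (J - 1) := by rw [hJ']; ring
  have f5 : Real.exp 1 * (ℓ * (L * (J + 101 / 5))) ≤ 19 / 10 * (L * (J + 101 / 5)) := by
    have he := Real.exp_one_lt_d9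
    rw [← mul_assoc]
    have : Real.exp 1 * ℓ ≤ 19 / 10 := by
      calc Real.exp 1 * ℓ ≤ 2.7182818286 * (694 / 1000) := by gcongr
        _ ≤ 19 / 10 := by norm_num
    gcongr
  have f6 : ((L : ℝ) - 1) * (Real.exp 1 * (ℓ * (L * (J + 101 / 5))) +
      (k - 1) * (16 * L * Real.log (3 * k + 1))) ≤
      L * (19 / 10 * (L * (J + 101 / 5)) + 4 * L * (J - 1)) := by
    have hl0 := Real.log_nonneg (show (1 : ℝ) ≤ 3 * k + 1 by linarith)
    refine mul_le_mul (by linarith) (by linarith) ?_ (by positivity)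
    have : 0 ≤ (k : ℝ) - 1 := by linarith
    have : 0 ≤ ℓ := by linarith
    positivity
  have hl2 := Real.log_two_lt_d9
  have f7 : T - 1 ≤ L + 2 + 16 * L * J * ((L - 1) / 2) +
      L * (19 / 10 * (L * (J + 101 / 5)) + 4 * L * (J - 1)) := by linarith
  rw [hT] at f7
  have f8 : 37 * (L : ℝ) ^ 2 ≤ L ^ 2 * J := by
    have : (L : ℝ) ^ 2 * 37 ≤ L ^ 2 * J := by gcongr
    linarith
  have f9 : (39 : ℝ) * L ≤ L ^ 2 := by rw [sq]; gcongr
  have f10 : 0 ≤ (L : ℝ) * J := by positivity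
  linarith

end AnalyticSolution

theorem exists_interpolation_parameters {k u h a x y ε : ℝ} (hk : 3 ≤ k) (hu : 9 / 2 ≤ u)
    (hh : 1 ≤ h) (ha : 1 ≤ a) (hy : 0 ≤ y) (hay : a * y ≤ x) (hε : 0 ≤ ε)
    (hx : 1200 * k ^ 5 * a ^ 2 * h ^ 2 * u ^ 2 ≤ x) (hkε : 2800 * k ^ 3 * h * u ^ 2 * ε ≤ 1) :
    ∃ L S J : ℕ, 2 * k * u + 3 ≤ L ∧ 8 * L * (k * a * h + 1) ≤ S ∧
      3 * (k * a * h + k ^ 2 + 2 + 4 * y * ε) ≤ J ∧ 2 * (S * J * L : ℝ) ≤ x ∧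
      (S + 1 : ℝ) ^ 2 ≤ x := by
  have hah : 1 ≤ a * h := one_le_mul_of_one_le_of_one_le ha hh
  have hku : 27 / 2 ≤ k * u := by
    have : (3 : ℝ) * (9 / 2) ≤ k * u := by gcongr
    linarith
  have hkah : 3 ≤ k * a * h := by
    have : (3 : ℝ) * 1 ≤ k * (a * h) := by gcongr
    linarith
  have hy0 : 0 ≤ y * ε := by positivity
  refine ⟨⌈2 * k * u⌉₊ + 3, ⌈8 * (⌈2 * k * u⌉₊ + 3 : ℕ) * (k * a * h + 1)⌉₊,
    ⌈3 * (k * a * h + k ^ 2 + 2 + 4 * y * ε)⌉₊, ?_, Nat.le_ceil _, Nat.le_ceil _, ?_⟩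
  · push_cast; linarith [Nat.le_ceil (2 * k * u)]
  have hL2 : ((⌈2 * k * u⌉₊ + 3 : ℕ) : ℝ) ≤ 23 / 10 * (k * u) := by
    push_cast
    linarith [Nat.ceil_lt_add_one (show 0 ≤ 2 * k * u by linarith)]
  have hL1 : (3 : ℝ) ≤ (⌈2 * k * u⌉₊ + 3 : ℕ) := by push_cast; linarith [Nat.le_ceil (2 * k * u)]
  set L : ℕ := ⌈2 * k * u⌉₊ + 3
  have hP : 27 / 2 ≤ k * u * (k * a * h) := by
    have : 27 / 2 * 3 ≤ k * u * (k * a * h) := by gcongr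
    linarith
  have hS2 : (⌈8 * (L : ℝ) * (k * a * h + 1)⌉₊ : ℝ) ≤ 247 / 10 * (k * u * (k * a * h)) := by
    have h1 := Nat.ceil_lt_add_one (show 0 ≤ 8 * (L : ℝ) * (k * a * h + 1) by positivity)
    have h2 : 8 * (L : ℝ) * (k * a * h + 1) ≤
        8 * (23 / 10 * (k * u)) * (k * a * h + 1 / 3 * (k * a * h)) := by
      gcongr; linarith
    have h3 : 27 / 2 * 3 ≤ k * u * (k * a * h) := by gcongr
    linarith
  set S : ℕ := ⌈8 * (L : ℝ) * (k * a * h + 1)⌉₊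
  have hk2 : 9 ≤ k ^ 2 := by nlinarith
  have hQ : k ^ 2 ≤ k ^ 2 * (a * h) := le_mul_of_one_le_right (by positivity) hah
  have hQ2 : k * a * h ≤ 1 / 3 * (k ^ 2 * (a * h)) := by
    have : 3 * (k * (a * h)) ≤ k * (k * (a * h)) := by gcongr
    linarith
  have hJ2 : (⌈3 * (k * a * h + k ^ 2 + 2 + 4 * y * ε)⌉₊ : ℝ) ≤
      48 / 10 * (k ^ 2 * (a * h)) + 12 * (y * ε) := by
    have h1 := Nat.ceil_lt_add_one
      (show 0 ≤ 3 * (k * a * h + k ^ 2 + 2 + 4 * y * ε) by nlinarith)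
    linarith
  set J : ℕ := ⌈3 * (k * a * h + k ^ 2 + 2 + 4 * y * ε)⌉₊
  have e1 : k * u * (k * a * h) * (k ^ 2 * (a * h)) * (k * u) = k ^ 5 * a ^ 2 * h ^ 2 * u ^ 2 := by
    ring
  constructor
  · have h1 : (S * J * L : ℝ) ≤ 247 / 10 * (k * u * (k * a * h)) *
        (48 / 10 * (k ^ 2 * (a * h)) + 12 * (y * ε)) * (23 / 10 * (k * u)) := by gcongr
    have e2 : k * u * (k * a * h) * (y * ε) * (k * u) = k ^ 3 * h * u ^ 2 * ε * (a * y) := by ring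
    have h2 : k ^ 3 * h * u ^ 2 * ε * (a * y) ≤ 1 / 2800 * x := by
      have : 0 ≤ a * y := by positivity
      have h3 : k ^ 3 * h * u ^ 2 * ε ≤ 1 / 2800 := by linarith
      gcongr
    have h3 : 0 ≤ x := by linarith [mul_nonneg (zero_le_one.trans ha) hy]
    nlinarith
  · have h1 : (S + 1 : ℝ) ^ 2 ≤ (25 * (k * u * (k * a * h))) ^ 2 := by
      gcongr
      linarith [show 27 / 2 * 3 ≤ k * u * (k * a * h) by gcongr]
    have h2 : k ^ 4 * a ^ 2 * h ^ 2 * u ^ 2 ≤ k ^ 5 * a ^ 2 * h ^ 2 * u ^ 2 := by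
      gcongr <;> linarith
    have h3 : 0 ≤ k ^ 4 * a ^ 2 * h ^ 2 * u ^ 2 := by positivity
    nlinarith

theorem interpolation_parameters_false {k u ah yε e ε : ℝ} {L S J K R v logKL logB E : ℝ}
    (hk : 3 ≤ k) (hah : 1 ≤ ah) (hy : 0 ≤ yε) (hv : v ≤ 2 / 3 * u) (hv3 : 3 ≤ v)
    (hL : 2 * k * u + 3 ≤ L) (hS : 8 * L * (k * ah + 1) ≤ S)
    (hJ : 3 * (k * ah + k ^ 2 + 2 + 4 * yε) ≤ J) (hK : K = S * J) (hR : R = L * J)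
    (hKL : logKL ≤ v) (hB : logB ≤ u) (he : e ≤ 3) (hε : 4 * ε ≤ 1) (hε0 : 0 ≤ ε)
    (hE : E ≤ e * (ε * (R + L) + S * yε) + ((R + L) * (ah + ε) + S * (1 + ah + yε)) +
      (k - 1) * ((R + L) * ah + S * (k + ah)))
    (key : K * L - 1 ≤ 2 * k * logKL + 2 + (K - 1) * (k * logB + 1) + (L - 1) * E) : False := by
  have hku : 27 / 2 ≤ k * u := by
    have : (3 : ℝ) * (9 / 2) ≤ k * u := by gcongr; linarith
    linarith
  have hkah : 3 ≤ k * ah := by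
    have : (3 : ℝ) * 1 ≤ k * ah := by gcongr
    linarith
  have hk2 : 9 ≤ k ^ 2 := by nlinarith
  have hS1 : 32 * L ≤ S := by
    have : 8 * L * 4 ≤ 8 * L * (k * ah + 1) := by gcongr <;> linarith
    linarith
  have hJ3 : 30 ≤ J := by linarith
  have hL0 : 0 < L := by linarith
  have hS0 : 0 < S := by linarith
  have hKS : 30 * S ≤ K := by
    rw [hK]
    have : S * 30 ≤ S * J := by gcongr
    linarith
  have hRL : 0 ≤ R + L := by
    have : 0 ≤ L * J := by positivity
    linarith
  have E1 : E ≤ (R + L) * (k * ah + 1) + S * (k * ah + k ^ 2 + 2 + 4 * yε) := by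
    have t1 : (R + L) * (e * ε + ε) ≤ (R + L) * 1 := by
      gcongr
      have : e * ε ≤ 3 * ε := by gcongr
      linarith
    have t2 : S * (e * yε) ≤ S * (3 * yε) := by gcongr
    have t3 : 0 ≤ S * (k + 1) := by positivity
    linarith
  have E2 : (R + L) * (k * ah + 1) ≤ S * (J + 1) / 8 := by
    have : (J + 1) * (8 * L * (k * ah + 1)) ≤ (J + 1) * S := by gcongr
    rw [hR]
    linarith
  have E3 : S * (k * ah + k ^ 2 + 2 + 4 * yε) ≤ S * (J / 3) := by gcongr; linarith
  have E4 : (L - 1) * E ≤ L * (S * (J + 1) / 8 + S * (J / 3)) := by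
    have h1 : 0 ≤ S * (J + 1) / 8 + S * (J / 3) := by positivity
    have h2 : (L - 1) * E ≤ (L - 1) * (S * (J + 1) / 8 + S * (J / 3)) := by
      gcongr <;> linarith
    linarith
  have K1 : (K - 1) * (k * logB + 1) ≤ (K - 1) * ((L - 1) / 2) := by
    have : k * logB ≤ k * u := by gcongr
    gcongr <;> linarith
  have K2 : 2 * k * logKL ≤ L := by
    have : 2 * k * logKL ≤ 2 * k * v := by gcongr
    have : 2 * k * v ≤ 2 * k * (2 / 3 * u) := by gcongr
    linarith
  have J1 : L * S * 30 ≤ L * S * J := by gcongr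
  rw [hK] at *
  have : 0 ≤ L * S := by positivity
  linarith

theorem injOn_add_mul {y R S : ℕ} (hR : R ≤ y) :
    Set.InjOn (fun q : ℕ × ℕ => q.1 * ((1 : ℕ) : ℝ) + q.2 * (y : ℝ))
      {q | q.1 < R ∧ q.2 ≤ S} := by
  rintro ⟨p, q⟩ hq ⟨p', q'⟩ hq' he
  replace hq : p < R := hq.1
  replace hq' : p' < R := hq'.1
  have he' : p + q * y = p' + q' * y := by
    simp only [Nat.cast_one, mul_one] at he
    exact_mod_cast he
  have hqq : q = q' := by
    have h1 : (p + q * y) / y = q := by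
      rw [Nat.add_mul_div_right _ _ (by omega), Nat.div_eq_of_lt (by omega), zero_add]
    have h2 : (p' + q' * y) / y = q' := by
      rw [Nat.add_mul_div_right _ _ (by omega), Nat.div_eq_of_lt (by omega), zero_add]
    rw [← h1, ← h2, he']
  subst hqq
  have : p = p' := by omega
  rw [this]

namespace AnalyticSolution
variable {k m s x A : ℕ} {α : ℝ}

set_option maxHeartbeats 1000000 in
/-- If `log A / log α` is close to a rational number with denominator `a`, then `x` is bounded. -/
theorem le_of_abs_mul_log_sub_le (H : AnalyticSolution k α m s x A) {a t : ℕ} (ha : 1 ≤ a)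
    {ε : ℝ} (hat : |a * Real.log A - t * Real.log α| ≤ ε) (hε4 : 4 * ε ≤ 1)
    (hε : 2800 * k ^ 3 * Real.log A * (3 / 2 * Real.log x) ^ 2 * ε ≤ 1) :
    (x : ℝ) ≤ 1200 * k ^ 5 * a ^ 2 * Real.log A ^ 2 * (3 / 2 * Real.log x) ^ 2 := by
  by_contra! hx
  have hr := H.root
  have hk3 := hr.three_le
  have hk : (3 : ℝ) ≤ k := by exact_mod_cast hk3
  have hkv := H.k_le_log
  have hx20 := H.twenty_le
  have hx20' : (20 : ℝ) ≤ x := by exact_mod_cast hx20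
  have hh1 := H.log_A_pos
  have hA4 := H.four_le
  have hA4' : (4 : ℝ) ≤ A := by exact_mod_cast hA4
  have hα1 := hr.lower
  have hα2 := hr.upper
  have hℓ1 := hr.log_lower
  have hlc1 := hr.log_binetCoeff_lower
  have hlc2 := hr.log_binetCoeff_upper
  have hc1 := hr.binetCoeff_lower
  have hden := hr.den_lower
  have ha' : (1 : ℝ) ≤ a := by exact_mod_cast ha
  have hε0 : 0 ≤ ε := (abs_nonneg _).trans hat
  obtain ⟨y, hy⟩ : ∃ y, y = x / a := ⟨_, rfl⟩
  obtain ⟨z, hz⟩ : ∃ z, z = x % a := ⟨_, rfl⟩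
  have hxyz : a * y + z = x := by rw [hy, hz]; exact Nat.div_add_mod x a
  have hza : z < a := by rw [hz]; exact Nat.mod_lt _ ha
  have hxyz' : (a : ℝ) * y + z = x := by exact_mod_cast hxyz
  have hz0 : (0 : ℝ) ≤ z := Nat.cast_nonneg z
  have hza' : (z : ℝ) ≤ a := by exact_mod_cast hza.le
  have hv3 : 3 ≤ Real.log x := by linarith
  obtain ⟨L, S, J, hL, hS, hJ, hSJL, hSx⟩ := exists_interpolation_parameters (k := k)
    (u := 3 / 2 * Real.log x) (h := Real.log A) (a := a) (x := x) (y := y) (ε := ε) hk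
    (by linarith) hh1.le ha' (Nat.cast_nonneg y) (by linarith) hε0 hx.le hε
  have hku : (3 : ℝ) * 3 ≤ k * Real.log x := by gcongr
  have hL30 : (30 : ℝ) ≤ L := by linarith
  have hkah : (a : ℝ) * 3 ≤ k * a * Real.log A := by
    have : (3 : ℝ) * a * 1 ≤ k * a * Real.log A := by gcongr
    linarith
  have hS3 : (a : ℝ) * 3 ≤ S ∧ 960 ≤ (S : ℝ) := by
    have : 8 * 30 * ((a : ℝ) * 3 + 1) ≤ 8 * L * (k * a * Real.log A + 1) := by gcongr
    constructor <;> linarith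
  have hyε0 : 0 ≤ (y : ℝ) * ε := by positivity
  have hJ30 : (30 : ℝ) ≤ J := by
    have : (3 : ℝ) ^ 2 ≤ (k : ℝ) ^ 2 := by gcongr
    linarith
  have hLN : 30 ≤ L := by exact_mod_cast hL30
  have hJN : 30 ≤ J := by exact_mod_cast hJ30
  have hSN : 960 ≤ S := by exact_mod_cast hS3.2
  have hRy : L * J + L ≤ y := by
    rw [hy, Nat.le_div_iff_mul_le ha]
    have h1 : (L * J + L : ℝ) * a ≤ x := by
      have h2 : (a : ℝ) * 3 * J * L ≤ S * J * L := by gcongr; exact hS3.1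
      have h3 : (a : ℝ) * 30 * L ≤ a * J * L := by gcongr
      have h4 : 0 ≤ (a : ℝ) * L := by positivity
      have h5 : 0 ≤ (a : ℝ) * J * L := by positivity
      linarith
    exact_mod_cast h1
  have hy0 : (0 : ℝ) < y := by
    have : 0 < y := by
      have : 0 < L * J := Nat.mul_pos (by omega) (by omega)
      omega
    exact_mod_cast this
  have hyx : (y : ℝ) ≤ x := by
    have : (1 : ℝ) * y ≤ a * y := by gcongr
    linarith
  set Λ := x * Real.log A - s * Real.log α - Real.log (binetCoeff k α) with hΛ
  have hform : |Λ| ≤ 2 / 3 ^ x := H.form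
  have hform1 : 2 / (3 : ℝ) ^ x ≤ 1 / 10 := by
    have h1 : (3 : ℝ) ^ 3 ≤ 3 ^ x := pow_le_pow_right₀ (by norm_num) (by omega)
    rw [div_le_iff₀ (by positivity)]
    linarith
  set s₀ : ℤ := s - t * y with hs₀
  have hs₀' : (s₀ : ℝ) = s - t * y := by rw [hs₀]; push_cast; ring
  set a₁ : ℝ := A ^ a / α ^ t with ha₁
  have hA0 : (0 : ℝ) < A := by linarith
  have hα0 : 0 < α := by linarith
  have ha₁0 : 0 < a₁ := by positivity
  have hlog₁ : Real.log a₁ = a * Real.log A - t * Real.log α := by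
    rw [ha₁, Real.log_div (by positivity) (by positivity), Real.log_pow, Real.log_pow]
  rw [← hlog₁] at hat
  have hat' := abs_le.1 hat
  set a₂ : ℝ := binetCoeff k α * α ^ s₀ / A ^ z with ha₂
  have hc0 : 0 < binetCoeff k α := by linarith
  have ha₂0 : 0 < a₂ := by positivity
  have hlog₂ : Real.log a₂ = Real.log (binetCoeff k α) + s₀ * Real.log α - z * Real.log A := by
    rw [ha₂, Real.log_div (by positivity) (by positivity), Real.log_mul (by positivity)
      (by positivity), Real.log_zpow, Real.log_pow]
  have hlin : Real.log a₂ - y * Real.log a₁ = -Λ := by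
    rw [hlog₁, hlog₂, hΛ, hs₀', ← hxyz']; ring
  have hΛ' := abs_le.1 hform
  have hyy : |y * Real.log a₁| ≤ y * ε := by
    rw [abs_mul, Nat.abs_cast]; gcongr
  have hyy' := abs_le.1 hyy
  have hs_neg : ((-s₀).toNat : ℝ) * Real.log α ≤ y * ε := by
    rcases le_total 0 s₀ with h0 | h0
    · rw [Int.toNat_of_nonpos (by omega)]
      simpa using hyε0
    · have : (((-s₀).toNat : ℤ) : ℝ) = -(s₀ : ℝ) := by
        rw [Int.toNat_of_nonneg (by omega)]; push_cast; ring
      rw [Int.cast_natCast] at this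
      rw [this]
      have : 0 ≤ z * Real.log A := by positivity
      linarith
  have hzA : (z : ℝ) * Real.log A ≤ a * Real.log A := by gcongr
  have hR : ((L * J : ℕ) : ℝ) = L * J := by push_cast; ring
  have hK : ((S * J : ℕ) : ℝ) = S * J := by push_cast; ring
  have hKL12 : 12 ≤ (S * J * L : ℝ) := by
    have : (960 : ℝ) * 30 * 30 ≤ S * J * L := by gcongr; exact hS3.2
    linarith
  have hX0 : 0 ≤ ε * (L * J + L + S * y : ℝ) := by positivity
  have hSy : S * y + y ≤ Real.exp (3 / 2 * Real.log x) := by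
    rw [← Real.log_le_iff_le_exp (by positivity)]
    have h1 := Real.log_le_log (by positivity) hSx
    rw [Real.log_pow] at h1
    have h2 := Real.log_le_log hy0 hyx
    rw [show (S * y + y : ℝ) = (S + 1) * y by ring, Real.log_mul (by positivity) hy0.ne']
    push_cast at h1
    linarith
  have hRy' : (L * J : ℝ) + L ≤ y := by exact_mod_cast hRy
  have hAz : (1 : ℝ) ≤ (A : ℝ) ^ z := one_le_pow₀ (by linarith)
  have key := interpolation_inequality (by omega : 1 ≤ k) hr.liouvilleAt (K := S * J) (L := L)
    (R := L * J) (S := S) (Nat.mul_pos (by omega) (by omega)) (by omega)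
    (a₁ := a₁) (a₂ := a₂) ha₁0 (by
      rw [ha₁]
      intro h1
      rw [div_eq_one_iff_eq (by positivity)] at h1
      exact hr.pow_ne_natCast_pow (by omega) (by omega) h1) ha₂0 (b₁ := y) (b₂ := 1) one_pos
    (A₁ := (A : ℤ[X]) ^ a) (D₁ := X ^ t) (A₂ := (X - 1) * X ^ s₀.toNat)
    (D₂ := (((k : ℤ[X]) + 1) * X - 2 * (k : ℤ[X])) * ((A : ℤ[X]) ^ z * X ^ (-s₀).toNat))
    (M₁ := (A : ℝ) ^ a) (M₂ := (3 * k + 1) * (A : ℝ) ^ z) (by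
      rw [ha₁]
      simp only [map_pow, aeval_X, map_natCast]
      field_simp) (by
      rw [ha₂]
      simp only [map_pow, map_mul, map_sub, map_add, map_one, map_natCast, map_ofNat,
        aeval_X]
      rw [← hr.binetCoeff_mul]
      have : α ^ s₀.toNat = α ^ s₀ * α ^ (-s₀).toNat := by
        rw [← zpow_natCast, ← zpow_natCast, ← zpow_add₀ hα0.ne']
        congr 1
        omega
      rw [this]
      field_simp) (by simp only [map_pow, aeval_X]; positivity) (by
      simp only [map_pow, map_mul, map_sub, map_add, map_one, map_natCast, map_ofNat,
        aeval_X]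
      have : 0 < (k + 1) * α - 2 * k := by linarith
      positivity) (one_le_pow₀ (by linarith)) (one_le_mul_of_one_le_of_one_le (by linarith) hAz)
    (fun q _ => by simp) (fun q hq => by
      simp only [map_pow, aeval_X, norm_pow]
      exact (pow_le_one₀ (norm_nonneg _) hq).trans (one_le_pow₀ (by linarith)))
    (fun q hq => by
      simp only [map_pow, map_mul, aeval_X, norm_pow, norm_mul]
      calc _ ≤ 2 * (1 : ℝ) := by
            gcongr
            · exact norm_aeval_sub_one_le hq
            · exact pow_le_one₀ (norm_nonneg _) hq
        _ ≤ (3 * k + 1) * (A : ℝ) ^ z := by gcongr; linarith)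
    (fun q hq => by
      rw [map_mul, norm_mul]
      gcongr
      · exact norm_aeval_den_le hk3 hq
      · simp only [map_pow, map_mul, aeval_X, norm_pow, norm_mul, map_natCast,
          Complex.norm_natCast]
        exact mul_le_of_le_one_right (by positivity) (pow_le_one₀ (norm_nonneg _) hq))
    (injOn_add_mul (by omega)) (by
      have : S * J - 1 < S * J := Nat.sub_lt (Nat.mul_pos (by omega) (by omega)) one_pos
      calc L * (S * J - 1) < L * (S * J) := Nat.mul_lt_mul_of_pos_left this (by omega)
        _ ≤ L * J * (S + 1) := by
          rw [mul_comm S J, ← mul_assoc]; exact Nat.mul_le_mul_left _ (by omega))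
    (B := L * J + L + S * y) (X := ε * (L * J + L + S * y))
    (w := (L * J + L) * (a * Real.log A + ε) + S * (1 + a * Real.log A + y * ε))
    (by
      have : (0 : ℝ) ≤ S * y := by positivity
      have : (30 : ℝ) * 30 ≤ L * J := by gcongr
      linarith) (by push_cast; linarith) (by
      rw [Nat.cast_one, div_one]
      gcongr) (by
      rw [hK]
      refine exp_mul_exp_sub_one_le hKL12 (by positivity) ?_
      rw [Nat.cast_one, one_mul, div_one, hlin, abs_neg]
      have h1 : (L : ℝ) * S * 30 ≤ L * S * J := by gcongr
      have h2 : 0 ≤ (L : ℝ) * S := by positivity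
      have h3 : ((3 : ℝ) ^ x)⁻¹ ≤ Real.exp (-(2 * (S * J * L))) := by
        rw [Real.exp_neg]
        refine inv_anti₀ (Real.exp_pos _) ((Real.exp_le_exp.2 hSJL).trans ?_)
        rw [← Real.exp_one_pow]
        exact pow_le_pow_left₀ (Real.exp_pos _).le (by linarith [Real.exp_one_lt_d9]) x
      calc (L : ℝ) * S * |Λ| ≤ (S * J * L) * (2 * ((3 : ℝ) ^ x)⁻¹) := by
            refine mul_le_mul (by linarith) hform (abs_nonneg _) (by positivity)
        _ ≤ (S * J * L) * (3 * Real.exp (-(2 * (S * J * L)))) := by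
            refine mul_le_mul_of_nonneg_left ?_ (by positivity)
            linarith [Real.exp_pos (-(2 * (S * J * L : ℝ)))]
        _ = _ := by ring) (by
      simp only [map_pow, map_mul, map_sub, map_add, map_one, map_natCast, map_ofNat,
        aeval_X]
      have hden0 : 0 < (k + 1) * α - 2 * k := by linarith
      have hden2 : (k + 1) * α - 2 * k ≤ 2 := by
        have : (k + 1) * α ≤ (k + 1) * 2 := by gcongr
        linarith
      have hlog2 : Real.log ((k + 1) * α - 2 * k) ≤ 1 := by
        linarith [Real.log_le_sub_one_of_pos hden0]
      rw [Real.log_mul hden0.ne' (by positivity), Real.log_mul (by positivity) (by positivity),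
        Real.log_pow, Real.log_pow, Real.log_pow, Nat.cast_add, hR]
      have h1 : (t : ℝ) * Real.log α ≤ a * Real.log A + ε := by linarith
      exact add_le_add (mul_le_mul_of_nonneg_left h1 (by positivity))
        (mul_le_mul_of_nonneg_left (by linarith) (by positivity)))
  refine interpolation_parameters_false (k := k) (u := 3 / 2 * Real.log x)
    (ah := a * Real.log A) (yε := y * ε) (e := Real.exp 1) (ε := ε) (L := L) (S := S) (J := J)
    (K := S * J) (R := L * J) (v := Real.log x) (logKL := Real.log ((S * J : ℕ) * L))
    (logB := Real.log (L * J + L + S * y)) (E := Real.exp 1 * (ε * (L * J + L + S * y)) +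
      ((L * J + L) * (a * Real.log A + ε) + S * (1 + a * Real.log A + y * ε)) +
      (k - 1) * (((L * J + L : ℕ) : ℝ) * Real.log (A ^ a) +
        S * Real.log ((3 * k + 1) * A ^ z))) hk
    (one_le_mul_of_one_le_of_one_le ha' hh1.le) hyε0 (by linarith) hv3 hL
    (by rw [← mul_assoc]; exact hS) (by rw [← mul_assoc, ← mul_assoc]; exact hJ) rfl rfl ?_ ?_
    (by linarith [Real.exp_one_lt_d9]) hε4 hε0 ?_ ?_
  · rw [hK]
    exact Real.log_le_log (by linarith) (by linarith)
  · rw [Real.log_le_iff_le_exp (by positivity)]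
    linarith
  · have h1 : Real.log ((A : ℝ) ^ a) = a * Real.log A := Real.log_pow _ _
    have h2 : Real.log ((3 * k + 1) * (A : ℝ) ^ z) ≤ k + a * Real.log A := by
      rw [Real.log_mul (by positivity) (by positivity), Real.log_pow]
      linarith [log_three_mul_add_one_le hk3]
    rw [h1, Nat.cast_add, hR]
    have h3 : (0 : ℝ) ≤ k - 1 := by linarith
    have h4 : (k - 1) * ((L * J + L) * (a * Real.log A) +
        S * Real.log ((3 * k + 1) * (A : ℝ) ^ z)) ≤
        (k - 1) * ((L * J + L) * (a * Real.log A) + S * (k + a * Real.log A)) := by gcongr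
    linarith
  · have : 2 * Real.log 2 ≤ 2 := by linarith [Real.log_two_lt_d9]
    rw [hK] at key ⊢
    linarith

end AnalyticSolution

theorem log_le_div_two_pow_add (n : ℕ) {v : ℝ} (hv : 0 < v) :
    Real.log v ≤ v / 2 ^ n + n * Real.log 2 - 1 := by
  have h := Real.log_le_sub_one_of_pos (show 0 < v / 2 ^ n by positivity)
  rw [Real.log_div hv.ne' (by positivity), Real.log_pow] at h
  linarith

theorem log_le_of_le_two_pow_mul {N a b : ℕ} {x K w : ℝ} (hx : 0 < x) (hK : 0 < K) (hw : 0 < w)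
    (h : x ≤ 2 ^ N * K ^ a * w ^ b) :
    Real.log x ≤ N * Real.log 2 + a * Real.log K + b * Real.log w := by
  have := Real.log_le_log hx h
  rwa [Real.log_mul (by positivity) (by positivity), Real.log_mul (by positivity) (by positivity),
    Real.log_pow, Real.log_pow, Real.log_pow] at this

theorem mul_pow_six_le_two_pow {k : ℕ} (hk : 61 ≤ k) : 25500000 * k ^ 6 ≤ 2 ^ k := by
  induction k, hk using Nat.le_induction with
  | base => norm_num
  | succ k hk ih =>
    have h2 : (k + 1) ^ 6 ≤ 2 * k ^ 6 := by
      have h1 : 61 * (k + 1) ≤ 62 * k := by omega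
      have h3 := Nat.pow_le_pow_left h1 6
      rw [mul_pow, mul_pow] at h3
      have : 62 ^ 6 * k ^ 6 ≤ 61 ^ 6 * 2 * k ^ 6 := Nat.mul_le_mul_right _ (by norm_num)
      omega
    rw [pow_succ 2]
    omega

theorem mul_pow_twelve_le_two_pow {k : ℕ} (hk : 200 ≤ k) : 150000000 * k ^ 12 ≤ 2 ^ k := by
  induction k, hk using Nat.le_induction with
  | base => norm_num
  | succ k hk ih =>
    have h2 : (k + 1) ^ 12 ≤ 2 * k ^ 12 := by
      have h1 : 200 * (k + 1) ≤ 201 * k := by omega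
      have h3 := Nat.pow_le_pow_left h1 12
      rw [mul_pow, mul_pow] at h3
      have : 201 ^ 12 * k ^ 12 ≤ 200 ^ 12 * 2 * k ^ 12 := Nat.mul_le_mul_right _ (by norm_num)
      omega
    rw [pow_succ 2]
    omega

theorem DominantRoot.two_sub_le {k : ℕ} {α : ℝ} (h : DominantRoot k α) :
    2 - α ≤ 8 / 5 / 2 ^ k := by
  have h1 := h.mul_two_sub_le
  have hl := h.lower
  have hu := h.upper
  have h2 := one_add_mul_le_pow (show (-2 : ℝ) ≤ -((2 - α) / 2) by linarith) k
  have h3 : α ^ k = 2 ^ k * (1 + -((2 - α) / 2)) ^ k := by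
    rw [← mul_pow]; congr 1; ring
  have h4 : 65 / 100 * 2 ^ k ≤ α ^ k := by
    rw [h3, mul_comm]
    gcongr
    refine le_trans ?_ h2
    linarith
  have h5 := h.eqn
  have h6 : 65 / 100 * 2 ^ k * (2 - α) ≤ 1 := by
    rw [← h5]
    exact mul_le_mul_of_nonneg_right h4 (by linarith)
  rw [le_div_iff₀ (by positivity)]
  linarith

theorem DominantRoot.log_binetCoeff_mul_bounds {k : ℕ} {α : ℝ} (h : DominantRoot k α) :
    0 ≤ Real.log (binetCoeff k α) + Real.log α ∧
      Real.log (binetCoeff k α) + Real.log α ≤ k * (2 - α) := by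
  have hl := h.lower
  have hu := h.upper
  have hc := h.binetCoeff_lower
  have hD := h.den_lower
  have hm := h.binetCoeff_mul
  have hk : (3 : ℝ) ≤ k := by exact_mod_cast h.three_le
  rw [← Real.log_mul (by linarith) (by linarith)]
  set c := binetCoeff k α
  set D := (k + 1) * α - 2 * k with hDdef
  have hcα : c * α * D = α * (α - 1) := by rw [← hm]; ring
  have hdiff : α * (α - 1) - D = (2 - α) * (k - α) := by rw [hDdef]; ring
  constructor
  · apply Real.log_nonneg
    have : 0 ≤ (2 - α) * (k - α) := mul_nonneg (by linarith) (by linarith)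
    by_contra! hlt
    nlinarith
  · refine (Real.log_le_sub_one_of_pos (by positivity)).trans ?_
    have h1 : (c * α - 1) * D = (2 - α) * (k - α) := by rw [← hdiff, ← hcα]; ring
    have h2 : (2 - α) * (k - α) ≤ (2 - α) * (k : ℝ) := by
      apply mul_le_mul_of_nonneg_left <;> linarith
    have h3 : 0 ≤ (2 - α) * (k : ℝ) := mul_nonneg (by linarith) (by linarith)
    by_contra! hlt
    nlinarith

namespace AnalyticSolution
variable {k m s x A : ℕ} {α : ℝ}

theorem x_pos (H : AnalyticSolution k α m s x A) : (0 : ℝ) < x := by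
  have := H.twenty_le
  exact_mod_cast (by omega : 0 < x)

theorem three_le_log (H : AnalyticSolution k α m s x A) : 3 ≤ Real.log x := by
  have : (3 : ℝ) ≤ k := by exact_mod_cast H.root.three_le
  linarith [H.k_le_log]

/-- The bound for `x` obtained from Dirichlet's approximation theorem. -/
theorem le_of_dirichlet (H : AnalyticSolution k α m s x A) :
    (x : ℝ) ≤ 107200000000 * k ^ 11 * Real.log A ^ 4 * Real.log x ^ 6 := by
  have hk : (3 : ℝ) ≤ k := by exact_mod_cast H.root.three_le
  have hv := H.three_le_log
  have hh := H.log_A_pos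
  have hl0 := H.root.log_lower
  have hl1 := H.root.log_upper
  set h := Real.log A
  set ℓ := Real.log α
  set v := Real.log x
  set Y := 2800 * k ^ 3 * h * (3 / 2 * v) ^ 2 with hY
  have hY1 : 100 ≤ Y := by
    have : 2800 * (3:ℝ) ^ 3 * 1 * (3 / 2 * 3) ^ 2 ≤ Y := by rw [hY]; gcongr
    linarith
  have hn : 0 < ⌊Y⌋₊ := Nat.floor_pos.2 (by linarith)
  obtain ⟨a, ha0, han, hap⟩ := Real.exists_nat_abs_mul_sub_round_le (h / ℓ) hn
  have hr0 : 0 ≤ round (a * (h / ℓ)) := by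
    rw [round_eq]
    apply Int.floor_nonneg.2
    positivity
  obtain ⟨t, ht⟩ := Int.eq_ofNat_of_zero_le hr0
  rw [ht] at hap
  have hlt := Nat.lt_floor_add_one Y
  have hYa : (a : ℝ) ≤ Y := le_trans (by exact_mod_cast han) (Nat.floor_le (by linarith))
  set N : ℝ := (⌊Y⌋₊ : ℝ)
  have hε : |a * h - t * ℓ| ≤ ℓ / (N + 1) := by
    have : a * h - t * ℓ = (a * (h / ℓ) - ((t : ℕ) : ℤ)) * ℓ := by
      push_cast; field_simp
    rw [this, abs_mul, abs_of_pos (a := ℓ) (by linarith), div_eq_mul_one_div ℓ, mul_comm _ ℓ]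
    refine mul_le_mul_of_nonneg_left ?_ (by linarith)
    exact_mod_cast hap
  have hx := H.le_of_abs_mul_log_sub_le (Nat.succ_le_of_lt ha0) hε
    (by rw [← mul_div_assoc, div_le_one (by linarith)]; linarith)
    (by
      change Y * (ℓ / (N + 1)) ≤ 1
      rw [← mul_div_assoc, div_le_one (by linarith)]
      nlinarith)
  calc (x : ℝ) ≤ 1200 * k ^ 5 * a ^ 2 * h ^ 2 * (3 / 2 * v) ^ 2 := hx
    _ ≤ 1200 * k ^ 5 * Y ^ 2 * h ^ 2 * (3 / 2 * v) ^ 2 := by gcongr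
    _ = (1200 * 2800 ^ 2 * (3 / 2) ^ 6) * (k ^ 11 * h ^ 4 * v ^ 6) := by rw [hY]; ring
    _ ≤ 107200000000 * (k ^ 11 * h ^ 4 * v ^ 6) := by
      apply mul_le_mul_of_nonneg_right (by norm_num); positivity
    _ = _ := by ring

/-- The bound for `x` obtained from `A ≈ α ^ (m - 1)`, valid for large `k`. -/
theorem le_of_le_two_pow (H : AnalyticSolution k α m s x A)
    (hc : 4480 * k ^ 3 * Real.log A * (3 / 2 * Real.log x) ^ 2 * (k + 2) ≤ 2 ^ k) :
    (x : ℝ) ≤ 1200 * k ^ 5 * Real.log A ^ 2 * (3 / 2 * Real.log x) ^ 2 := by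
  have hk : (3 : ℝ) ≤ k := by exact_mod_cast H.root.three_le
  have hv := H.three_le_log
  have hh := H.log_A_pos
  have hu := H.root.upper
  have hl := H.root.lower
  have hm3 := H.three_le_m
  have hlam := H.abs_log_sub_le
  have hδ := H.root.two_sub_le
  obtain ⟨hb1, hb2⟩ := H.root.log_binetCoeff_mul_bounds
  have heqn := H.root.eqn
  set h := Real.log A
  set v := Real.log x
  have hαm : 2 / α ^ m ≤ 2 * (2 - α) := by
    have h1 : α ^ k ≤ α ^ m := pow_le_pow_right₀ (by linarith) H.k_le_m
    have h0 : 0 < α ^ k := by positivity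
    calc 2 / α ^ m ≤ 2 / α ^ k := by gcongr
      _ = 2 * (2 - α) := by rw [div_eq_iff h0.ne']; linarith
  have hcast : ((m - 1 : ℕ) : ℝ) = m - 1 := by
    rw [Nat.cast_sub (by omega)]; simp
  have hε : |((1 : ℕ) : ℝ) * h - ((m - 1 : ℕ) : ℝ) * Real.log α| ≤ (k + 2) * (8 / 5 / 2 ^ k) := by
    have h1 : ((1 : ℕ) : ℝ) * h - ((m - 1 : ℕ) : ℝ) * Real.log α =
        (h - m * Real.log α - Real.log (binetCoeff k α)) +
          (Real.log (binetCoeff k α) + Real.log α) := by rw [hcast]; push_cast; ring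
    rw [h1]
    refine (abs_add_le _ _).trans ?_
    rw [abs_of_nonneg hb1]
    have : (k + 2) * (2 - α) ≤ (k + 2) * (8 / 5 / 2 ^ k) := by gcongr
    linarith
  have h2k : (0 : ℝ) < 2 ^ k := by positivity
  have := H.le_of_abs_mul_log_sub_le le_rfl hε
    (by
      rw [← mul_div_assoc, ← mul_div_assoc, div_le_one h2k]
      refine le_trans ?_ hc
      have : 4480 * (3:ℝ) ^ 3 * 1 * (3 / 2 * 3) ^ 2 * (k + 2) ≤
        4480 * k ^ 3 * h * (3 / 2 * v) ^ 2 * (k + 2) := by gcongr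
      linarith)
    (by
      change 2800 * k ^ 3 * h * (3 / 2 * v) ^ 2 * ((k + 2) * (8 / 5 / 2 ^ k)) ≤ 1
      have : 2800 * k ^ 3 * h * (3 / 2 * v) ^ 2 * ((k + 2) * (8 / 5 / 2 ^ k)) =
        4480 * k ^ 3 * h * (3 / 2 * v) ^ 2 * (k + 2) / 2 ^ k := by ring
      rw [this]
      exact (div_le_one h2k).2 hc)
  simpa using this

/-- Either `x` is tiny, or `log A` is polynomially bounded in `k` and `log x`. -/
theorem log_le_or_log_A_le (H : AnalyticSolution k α m s x A) :
    Real.log x ≤ 30 ∨ Real.log A ≤ 3605 * k ^ 4 * Real.log x ^ 2 := by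
  have hk : (3 : ℝ) ≤ k := by exact_mod_cast H.root.three_le
  have hv := H.three_le_log
  have hkv := H.k_le_log
  have h2 := Real.log_two_lt_d9
  have hmin := H.min_le
  have hx := H.x_pos
  rcases le_total x m with hxm | hxm
  · left
    rw [min_eq_left hxm] at hmin
    set v := Real.log x with hvdef
    have h1 : (x : ℝ) ≤ 2 ^ 13 * v ^ 4 * v ^ 2 := by
      refine hmin.trans ?_
      gcongr
      norm_num
    have h3 := log_le_of_le_two_pow_mul hx (by linarith) (by linarith) h1
    have h4 := log_le_div_two_pow_add 5 (show 0 < v by linarith)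
    push_cast at h3 h4
    norm_num at h4
    linarith
  · right
    rw [min_eq_right hxm] at hmin
    have hm3 := H.three_le_m
    have hA : Real.log A ≤ (m - 1 : ℕ) * Real.log 2 := by
      rw [← Real.log_pow]
      apply Real.log_le_log
      · have := H.four_le; positivity
      · exact_mod_cast H.le_two_pow
    have hm1 : ((m - 1 : ℕ) : ℝ) ≤ m := by exact_mod_cast Nat.sub_le _ _
    have h0 : 0 < Real.log 2 := Real.log_pos (by norm_num)
    have h5 : Real.log A ≤ (5200 * k ^ 4 * Real.log x ^ 2) * Real.log 2 :=
      hA.trans (by gcongr; linarith)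
    have h6 : 0 ≤ k ^ 4 * Real.log x ^ 2 := by positivity
    nlinarith

theorem log_le_of_log_A_le (H : AnalyticSolution k α m s x A)
    (hA : Real.log A ≤ 3605 * k ^ 4 * Real.log x ^ 2) :
    Real.log x ≤ 2588 / 10 + 1117 / 10000 * k := by
  have hk : (3 : ℝ) ≤ k := by exact_mod_cast H.root.three_le
  have hv := H.three_le_log
  have h2 := Real.log_two_lt_d9
  have hh := H.log_A_pos
  have hx := H.x_pos
  have hD := H.le_of_dirichlet
  set v := Real.log x with hvdef
  have h1 : (x : ℝ) ≤ 2 ^ 84 * k ^ 27 * v ^ 14 := by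
    calc (x : ℝ) ≤ 107200000000 * k ^ 11 * Real.log A ^ 4 * v ^ 6 := hD
      _ ≤ 107200000000 * k ^ 11 * (3605 * k ^ 4 * v ^ 2) ^ 4 * v ^ 6 := by gcongr
      _ = (107200000000 * 3605 ^ 4) * (k ^ 27 * v ^ 14) := by ring
      _ ≤ 2 ^ 84 * (k ^ 27 * v ^ 14) := by
        apply mul_le_mul_of_nonneg_right (by norm_num); positivity
      _ = _ := by ring
  have h3 := log_le_of_le_two_pow_mul hx (by linarith) (by linarith) h1
  have h4 := log_le_div_two_pow_add 8 (show 0 < v by linarith)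
  have h5 := log_le_div_two_pow_add 8 (show (0:ℝ) < k by linarith)
  push_cast at h3 h4 h5
  norm_num at h4 h5
  linarith

/-- The parameter `k` is less than `200`. -/
theorem k_lt (H : AnalyticSolution k α m s x A) : k < 200 := by
  by_contra! hk200
  have hk : (200 : ℝ) ≤ k := by exact_mod_cast hk200
  have hkv := H.k_le_log
  rcases H.log_le_or_log_A_le with h | hA
  · linarith
  have hvk := H.log_le_of_log_A_le hA
  have hh := H.log_A_pos
  have hx := H.x_pos
  have h2 := Real.log_two_lt_d9
  have h12 : (150000000 : ℝ) * k ^ 12 ≤ 2 ^ k := by exact_mod_cast mul_pow_twelve_le_two_pow hk200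
  have hT := H.le_of_le_two_pow
  set v := Real.log x with hvdef
  have hvk' : v ≤ 141 / 100 * k := by linarith
  have hx' := hT (by
    refine le_trans ?_ h12
    calc 4480 * (k:ℝ) ^ 3 * Real.log A * (3 / 2 * v) ^ 2 * ((k:ℝ) + 2)
        ≤ 4480 * (k:ℝ) ^ 3 * (3605 * (k:ℝ) ^ 4 * (141 / 100 * k) ^ 2) * (3 / 2 * (141 / 100 * k)) ^ 2 *
            ((k:ℝ) + k / 100) := by
          have : Real.log A ≤ 3605 * k ^ 4 * (141 / 100 * k) ^ 2 := hA.trans (by gcongr)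
          gcongr
          linarith
      _ = (4480 * 3605 * (141 / 100) ^ 4 * (9 / 4) * (101 / 100)) * (k:ℝ) ^ 12 := by ring
      _ ≤ 150000000 * (k:ℝ) ^ 12 := by
          apply mul_le_mul_of_nonneg_right (by norm_num); positivity)
  have h1 : (x : ℝ) ≤ 2 ^ 36 * k ^ 13 * v ^ 6 := by
    calc (x : ℝ) ≤ 1200 * k ^ 5 * Real.log A ^ 2 * (3 / 2 * v) ^ 2 := hx'
      _ ≤ 1200 * k ^ 5 * (3605 * k ^ 4 * v ^ 2) ^ 2 * (3 / 2 * v) ^ 2 := by gcongr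
      _ = (1200 * 3605 ^ 2 * (9 / 4)) * (k ^ 13 * v ^ 6) := by ring
      _ ≤ 2 ^ 36 * (k ^ 13 * v ^ 6) := by
        apply mul_le_mul_of_nonneg_right (by norm_num); positivity
      _ = _ := by ring
  have h3 := log_le_of_le_two_pow_mul hx (by linarith) (by linarith) h1
  have h4 := log_le_div_two_pow_add 8 (show 0 < v by linarith)
  have h5 := log_le_div_two_pow_add 8 (show (0:ℝ) < k by linarith)
  push_cast at h3 h4 h5
  norm_num at h4 h5
  linarith

theorem le_two_pow_of_log_le (H : AnalyticSolution k α m s x A) {N : ℕ}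
    (h : Real.log x ≤ N * Real.log 2) : x ≤ 2 ^ N := by
  rw [← Real.log_pow, Real.log_le_log_iff H.x_pos (by positivity)] at h
  exact_mod_cast h

theorem le_two_pow_four_hundred_six (H : AnalyticSolution k α m s x A) : x ≤ 2 ^ 406 := by
  have hk : (k : ℝ) ≤ 199 := by exact_mod_cast Nat.le_of_lt_succ H.k_lt
  apply H.le_two_pow_of_log_le
  have h2 := Real.log_two_gt_d9
  push_cast
  rcases H.log_le_or_log_A_le with h | hA
  · linarith
  · linarith [H.log_le_of_log_A_le hA]

theorem log_A_le_of_pow_le (H : AnalyticSolution k α m s x A) {N : ℕ} (h : α ^ m ≤ 2 ^ N) :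
    Real.log A ≤ N * Real.log 2 + 1 / 2 := by
  have hl := H.root.lower
  have h1 := Real.log_le_log (by positivity) h
  rw [Real.log_pow, Real.log_pow] at h1
  have h2 := (abs_le.1 H.abs_log_sub_le).2
  have h3 := H.root.log_binetCoeff_upper
  have h4 : 2 / α ^ m ≤ 2 / (9 / 5) ^ 3 := by
    have : (9 / 5 : ℝ) ^ 3 ≤ α ^ m :=
      (pow_le_pow_left₀ (by norm_num) hl.le 3).trans
        (pow_le_pow_right₀ (by linarith) H.three_le_m)
    gcongr
  norm_num at h4
  linarith

theorem log_le_of_log_A_le_const (H : AnalyticSolution k α m s x A) (hA : Real.log A ≤ 572) :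
    Real.log x ≤ 1147 / 10 + 181 / 1000 * k := by
  have hk : (3 : ℝ) ≤ k := by exact_mod_cast H.root.three_le
  have hv := H.three_le_log
  have h2 := Real.log_two_lt_d9
  have hh := H.log_A_pos
  have hx := H.x_pos
  have hD := H.le_of_dirichlet
  set v := Real.log x with hvdef
  have h1 : (x : ℝ) ≤ 2 ^ 74 * k ^ 11 * v ^ 6 := by
    calc (x : ℝ) ≤ 107200000000 * k ^ 11 * Real.log A ^ 4 * v ^ 6 := hD
      _ ≤ 107200000000 * k ^ 11 * 572 ^ 4 * v ^ 6 := by gcongr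
      _ = (107200000000 * 572 ^ 4) * (k ^ 11 * v ^ 6) := by ring
      _ ≤ 2 ^ 74 * (k ^ 11 * v ^ 6) := by
        apply mul_le_mul_of_nonneg_right (by norm_num); positivity
      _ = _ := by ring
  have h3 := log_le_of_le_two_pow_mul hx (by linarith) (by linarith) h1
  have h4 := log_le_div_two_pow_add 7 (show 0 < v by linarith)
  have h5 := log_le_div_two_pow_add 6 (show (0:ℝ) < k by linarith)
  push_cast at h3 h4 h5
  norm_num at h4 h5
  linarith

theorem k_le_sixty (H : AnalyticSolution k α m s x A) (hA : Real.log A ≤ 572) : k ≤ 60 := by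
  by_contra! hk61
  have hk : (61 : ℝ) ≤ k := by exact_mod_cast hk61
  have hk2 : (k : ℝ) ≤ 199 := by exact_mod_cast Nat.le_of_lt_succ H.k_lt
  have hkv := H.k_le_log
  have hvk := H.log_le_of_log_A_le_const hA
  have hh := H.log_A_pos
  have hx := H.x_pos
  have h2 := Real.log_two_lt_d9
  have h6 : (25500000 : ℝ) * k ^ 6 ≤ 2 ^ k := by exact_mod_cast mul_pow_six_le_two_pow hk61
  have hT := H.le_of_le_two_pow
  set v := Real.log x with hvdef
  have hvk' : 3 / 2 * v ≤ 31 / 10 * k := by linarith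
  have hx' := hT (by
    refine le_trans ?_ h6
    calc 4480 * (k:ℝ) ^ 3 * Real.log A * (3 / 2 * v) ^ 2 * ((k:ℝ) + 2)
        ≤ 4480 * (k:ℝ) ^ 3 * 572 * (31 / 10 * k) ^ 2 * ((k:ℝ) + k / 30) := by
          gcongr
          linarith
      _ = (4480 * 572 * (31 / 10) ^ 2 * (31 / 30)) * (k:ℝ) ^ 6 := by ring
      _ ≤ 25500000 * (k:ℝ) ^ 6 := by
          apply mul_le_mul_of_nonneg_right (by norm_num); positivity)
  have h1 : (x : ℝ) ≤ 2 ^ 30 * k ^ 5 * v ^ 2 := by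
    calc (x : ℝ) ≤ 1200 * k ^ 5 * Real.log A ^ 2 * (3 / 2 * v) ^ 2 := hx'
      _ ≤ 1200 * k ^ 5 * 572 ^ 2 * (3 / 2 * v) ^ 2 := by gcongr
      _ = (1200 * 572 ^ 2 * (9 / 4)) * (k ^ 5 * v ^ 2) := by ring
      _ ≤ 2 ^ 30 * (k ^ 5 * v ^ 2) := by
        apply mul_le_mul_of_nonneg_right (by norm_num); positivity
      _ = _ := by ring
  have h3 := log_le_of_le_two_pow_mul hx (by linarith) (by linarith) h1
  have h4 := log_le_div_two_pow_add 7 (show 0 < v by linarith)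
  have h5 := log_le_div_two_pow_add 8 (show (0:ℝ) < k by linarith)
  push_cast at h3 h4 h5
  norm_num at h4 h5
  linarith

theorem le_of_log_A_le_const (H : AnalyticSolution k α m s x A) (hA : Real.log A ≤ 572) :
    x ≤ 2 ^ 116 * k ^ 11 := by
  have hk : (k : ℝ) ≤ 60 := by exact_mod_cast H.k_le_sixty hA
  have hvk := H.log_le_of_log_A_le_const hA
  have hh := H.log_A_pos
  have hv := H.three_le_log
  have hD := H.le_of_dirichlet
  set v := Real.log x with hvdef
  have : (x : ℝ) ≤ 2 ^ 116 * k ^ 11 := by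
    calc (x : ℝ) ≤ 107200000000 * k ^ 11 * Real.log A ^ 4 * v ^ 6 := hD
      _ ≤ 107200000000 * k ^ 11 * 572 ^ 4 * 127 ^ 6 := by gcongr; linarith
      _ = (107200000000 * 572 ^ 4 * 127 ^ 6) * k ^ 11 := by ring
      _ ≤ 2 ^ 116 * k ^ 11 := by
        apply mul_le_mul_of_nonneg_right (by norm_num); positivity
  exact_mod_cast this

end AnalyticSolution

namespace KernelCheck

/-- Evaluates `n` before passing it to `f` when reduced by the kernel. -/
def force {β : Type} (n : ℕ) (f : ℕ → β) : β := Nat.rec (f 0) (fun m _ => f (m + 1)) n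

/-- Partial sums of `-log (1 - u)` in fixed-point arithmetic with denominator `one`. -/
def logAux (one u fuel : ℕ) : ℕ → ℕ → ℕ → ℕ :=
  Nat.rec (fun _ _ acc => acc) (fun _ ih i t acc =>
    bif Nat.beq t 0 then acc else
      force (acc + t / i) fun acc' => force (t * u / one) fun t' => force (i + 1) fun i' =>
        ih i' t' acc') fuel

/-- Fixed-point approximation to `-log (1 - u / 2 ^ p)`. -/
def logOneSub (p one u : ℕ) : ℕ := logAux one u p 1 u 0

/-- Newton iteration for the dominant root, in fixed-point arithmetic. -/
def newton (one k fuel : ℕ) : ℕ → ℕ :=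
  Nat.rec (fun a => a) (fun _ ih a =>
    force (a ^ (k - 1) / one ^ (k - 2)) fun t =>
      force ((one * one - t * a / one * (2 * one - a)) * one / (t * ((k + 1) * a - 2 * k * one)))
        fun d => bif Nat.beq d 0 then a else force (a - d) fun a' => ih a') fuel

/-- The absolute value of the signed number stored in the low part of `v`. -/
def lowPart (M v : ℕ) : ℕ := force (v % M) fun r => bif Nat.ble r (M / 2) then r else M - r

/-- Euclidean algorithm down to `thr`, passing the last two remainders to `f`. -/
def euclid {β : Type} (thr fuel : ℕ) (f : ℕ → ℕ → β) : ℕ → ℕ → β :=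
  Nat.rec f (fun _ ih u v => bif Nat.ble v thr then f u v else ih v (u % v)) fuel

/-- Euclidean algorithm, four steps at a time. -/
def euclidFour {β : Type} (thr fuel : ℕ) (f : ℕ → ℕ → β) : ℕ → ℕ → β :=
  Nat.rec f (fun _ ih u v => bif Nat.ble v thr then f u v else ih ((u % v) % (v % (u % v))) ((v % (u % v)) % ((u % v) % (v % (u % v))))) fuel

/-- Does a denominator in the continued fraction algorithm pass the test? -/
def search (M : ℕ) (test : ℕ → Bool) (fuel : ℕ) : ℕ → ℕ → Bool :=
  Nat.rec (fun _ _ => false) (fun _ ih u v =>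
    bif force (lowPart M v) test then true else force (u % v) fun r => ih v r) fuel

/-- Distance from `n` to the nearest multiple of `l`. -/
def dist (l n : ℕ) : ℕ := force (n % l) fun r => bif Nat.ble (2 * r) l then r else l - r

def mulSubTest (one l psi e X q : ℕ) : Bool :=
  force (q * psi) fun n => force ((n + l / 2) / l) fun P =>
    force (n - P * l + (P * l - n)) fun w =>
      Nat.ble X q && Nat.ble P (2 * q) && Nat.ble (8 * (X * (w + 5 * q * e))) one &&
        Nat.beq (Nat.gcd P q) 1

def shiftTest (one l psi e X T lam : ℕ) (neg : Bool) (q : ℕ) : Bool :=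
  force (q * lam) fun n =>
    force (dist l (bif neg then q * psi + n else q * psi + q * l - n)) fun w =>
      force (dist l n) fun D =>
        Nat.ble 1 q &&
        Nat.ble (2 * q * one / T + X * (w + 6 * q * e) + 3 * q * e + 2) D

def adjust (M lam : ℕ) (neg : Bool) (v : ℕ) : ℕ :=
  force (v % M) fun r => bif Nat.ble r (M / 2) then
    (bif neg then v + r * lam * M else v - r * lam * M) else
    (bif neg then v - (M - r) * lam * M else v + (M - r) * lam * M)

def pairTest (p one l psi e X T M u v lam : ℕ) (neg : Bool) : Bool :=
  force (Nat.log2 X + 2) fun B => force ((B + (p - Nat.log2 lam)) / 2) fun b =>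
    force (2 ^ (p - (bif Nat.ble B b then b else B)) * M) fun thr =>
      euclidFour thr 1000 (search M (shiftTest one l psi e X T lam neg) 30)
        (adjust M lam neg u) (adjust M lam neg v)

def lamTest (p one l psi e X Q T M u v lam : ℕ) (neg : Bool) : Bool :=
  bif Nat.ble ((lam + e) * X * Q * 10 + 1) (4 * one) then true else
    Nat.ble lam l && pairTest p one l psi e X T M u v lam neg

def roundTest (one g A : ℕ) : Bool :=
  Nat.ble (2 * one) g && Nat.ble (g * 2 ^ 30) (one * one) &&
    Nat.ble (100 * (A * one)) (100 * g + 49 * one) && Nat.ble (100 * g) (100 * (A * one) + 49 * one)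

def loop (p one a l psi e X Q T M fuel : ℕ) : ℕ → ℕ → ℕ → ℕ → Bool :=
  Nat.rec (fun _ _ _ _ => false) (fun _ ih m g u v =>
    bif Nat.ble (5 * X * Q * one) g then true else
      force ((2 * g + one) / (2 * one)) fun A =>
        roundTest one g A &&
        euclid (2 ^ (p - 7 * m / 16) * M) 1000 (fun u v => force u fun u => force v fun v =>
          (bif Nat.ble (A * one) g then
            force (logOneSub p one ((g - A * one) * one / g)) fun lam =>
              lamTest p one l psi e X Q T M u v lam true
          else
            force (logOneSub p one ((A * one - g) / A)) fun lam =>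
              lamTest p one l psi e X Q T M u v lam false) &&
          force (g * a / one) fun g' => force (m + 1) fun m' => ih m' g' u v) u v) fuel

def rootTest (one k a : ℕ) : Bool :=
  Nat.ble (3 * one) (2 * (a - 4)) && Nat.ble (a + 4) (2 * one) &&
    Nat.ble (one ^ (k + 1)) ((a - 4) ^ k * (2 * one - (a - 4))) &&
    Nat.ble ((a + 4) ^ k * (2 * one - (a + 4))) (one ^ (k + 1))

/-- Compute the fixed-point data of the linear form and pass them to `f`. -/
def withData (p k : ℕ) (f : ℕ → ℕ → ℕ → ℕ → Bool) : Bool :=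
  force (2 ^ p) fun one =>
    force (newton one k 20 (2 * one - one / 2 ^ k)) fun a =>
      rootTest one k a &&
      force (logOneSub p one (one / 2)) fun l2 =>
        force (2 * one - a) fun d =>
          force (l2 - logOneSub p one (d / 2)) fun l =>
            force (l2 + logOneSub p one d - logOneSub p one ((k + 1) * d / 2)) fun psi =>
              f one a l psi

def firstTest (p k X B : ℕ) : Bool :=
  withData p k fun one _ l psi => 
    search (2 ^ 512) (fun Q => mulSubTest one l psi (2 ^ 14) X Q && Nat.ble (5 * X * Q) B) 1000
      (l * 2 ^ 512) (psi * 2 ^ 512 + 1)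

def powIter (one a fuel : ℕ) : ℕ → ℕ :=
  Nat.rec (fun g => g) (fun _ ih g => force (g * a / one) fun g' => ih g') fuel

def secondTest (p k X x₀ : ℕ) : Bool :=
  force X fun X => withData p k fun one a l psi =>
    force (2 ^ 320) fun M => force (l * M) fun u => force (psi * M + 1) fun v =>
      force (3 ^ x₀) fun T =>
      search M (fun Q => mulSubTest one l psi (2 ^ 14) X Q && Nat.ble (40 * Q) T &&
        force ((a - one) * one / ((k + 1) * a - 2 * k * one)) fun c =>
          force (powIter one a k c) fun g =>
            loop p one a l psi (2 ^ 14) X Q T M 500 k g u v) 1000 u v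

def rangeTest (test : ℕ → Bool) (n : ℕ) : ℕ → Bool :=
  Nat.rec (fun _ => true) (fun _ ih k => test k && force (k + 1) ih) n

end KernelCheck

namespace KernelCheck

theorem force_eq {β : Type} (n : ℕ) (f : ℕ → β) : force n f = f n := by cases n <;> rfl

theorem logAux_eq (one u fuel i t acc : ℕ) : logAux one u fuel i t acc =
    acc + ∑ j ∈ range fuel, (fun t => t * u / one)^[j] t / (i + j) := by
  induction fuel generalizing i t acc with
  | zero => simp [logAux]
  | succ n ih =>
    have : logAux one u (n + 1) i t acc = bif Nat.beq t 0 then acc else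
      force (acc + t / i) fun acc' => force (t * u / one) fun t' => force (i + 1) fun i' =>
        logAux one u n i' t' acc' := rfl
    rw [this, force_eq, force_eq, force_eq, ih, sum_range_succ']
    by_cases ht : t = 0
    · subst ht
      have h0 : ∀ j, (fun t => t * u / one)^[j] 0 = 0 := fun j =>
        Function.iterate_fixed (by simp) j
      simp [h0]
    · rw [show Nat.beq t 0 = false by cases t <;> [exact absurd rfl ht; rfl], cond_false]
      simp only [Function.iterate_succ_apply, Function.iterate_zero, id, add_zero]
      rw [sum_congr rfl fun j _ => by rw [show i + 1 + j = i + (j + 1) by ring]]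
      ring

theorem logOneSub_spec {p U : ℕ} (hU : 2 * U ≤ 2 ^ p) :
    |-Real.log (1 - U / 2 ^ p) * 2 ^ p - logOneSub p (2 ^ p) U| ≤ 3 * p + 1 := by
  set one : ℝ := 2 ^ p with hone
  have h1 : 0 < one := by positivity
  set θ : ℝ := U / one with hθ
  have hθ0 : 0 ≤ θ := by positivity
  have hθ2 : θ ≤ 1 / 2 := by
    rw [hθ, div_le_iff₀ h1]
    have : (2 * U : ℝ) ≤ one := by rw [hone]; exact_mod_cast hU
    linarith
  set T : ℕ → ℕ := fun j => (fun t => t * U / 2 ^ p)^[j] U with hT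
  have hT1 : ∀ j, (T j : ℝ) ≤ θ ^ (j + 1) * one ∧ θ ^ (j + 1) * one ≤ T j + 2 := by
    intro j
    induction j with
    | zero => constructor <;> simp [hT, hθ, h1.ne']
    | succ j ih =>
      have hs : T (j + 1) = T j * U / 2 ^ p := by
        simp only [hT, Function.iterate_succ_apply']
      have hr : (T j : ℝ) * θ = ((T j * U : ℕ) : ℝ) / ((2 ^ p : ℕ) : ℝ) := by
        rw [hθ, hone]; push_cast; ring
      have hle : (T (j + 1) : ℝ) ≤ T j * θ := by rw [hs, hr]; exact Nat.cast_div_le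
      have hge : (T j : ℝ) * θ ≤ T (j + 1) + 1 := by
        rw [hs, hr, ← Nat.floor_div_eq_div (K := ℝ)]
        exact (Nat.lt_floor_add_one _).le
      rw [pow_succ, mul_right_comm]
      constructor
      · exact hle.trans (mul_le_mul_of_nonneg_right ih.1 hθ0)
      · have := mul_le_mul_of_nonneg_right ih.2 hθ0
        linarith
  have hsum : |∑ j ∈ range p, θ ^ (j + 1) / (j + 1) * one - logOneSub p (2 ^ p) U| ≤ 3 * p := by
    rw [logOneSub, logAux_eq, zero_add]
    push_cast
    rw [← sum_sub_distrib]
    refine (abs_sum_le_sum_abs _ _).trans ((sum_le_card_nsmul _ _ 3 fun j _ => ?_).trans_eq ?_)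
    · obtain ⟨ha, hb⟩ := hT1 j
      change |_ - ((T j / (1 + j) : ℕ) : ℝ)| ≤ 3
      have hj : (1 : ℝ) ≤ j + 1 := by linarith [Nat.cast_nonneg (α := ℝ) j]
      have hle : ((T j / (1 + j) : ℕ) : ℝ) ≤ T j / (j + 1) := by
        refine Nat.cast_div_le.trans_eq ?_
        push_cast; ring
      have hge : (T j : ℝ) / (j + 1) ≤ (T j / (1 + j) : ℕ) + 1 := by
        have : (T j : ℝ) / (j + 1) = (T j : ℝ) / ((1 + j : ℕ) : ℝ) := by push_cast; ring
        rw [this, ← Nat.floor_div_eq_div (K := ℝ)]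
        exact (Nat.lt_floor_add_one _).le
      have e : θ ^ (j + 1) / (j + 1) * one = θ ^ (j + 1) * one / (j + 1) := by ring
      rw [e, abs_le]
      have h3 : (T j : ℝ) / (j + 1) ≤ θ ^ (j + 1) * one / (j + 1) := by gcongr
      have h4 : θ ^ (j + 1) * one / (j + 1) ≤ T j / (j + 1) + 2 := by
        have : θ ^ (j + 1) * one / (j + 1) ≤ (T j + 2) / (j + 1) := by gcongr
        have h5 : (2 : ℝ) / (j + 1) ≤ 2 := div_le_self (by norm_num) hj
        rw [add_div] at this
        linarith
      constructor <;> linarith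
    · simp; ring
  have htail := Real.abs_log_sub_add_sum_range_le (show |θ| < 1 by rw [abs_of_nonneg hθ0]; linarith) p
  rw [abs_of_nonneg hθ0] at htail
  have htail2 : θ ^ (p + 1) / (1 - θ) * one ≤ 1 := by
    have h2 : θ ^ (p + 1) ≤ (1 / 2) ^ (p + 1) := by gcongr
    have h3 : (1 / 2 : ℝ) ^ (p + 1) * one = 1 / 2 := by
      rw [hone, pow_succ, mul_right_comm, ← mul_pow]; norm_num
    rw [div_mul_eq_mul_div, div_le_one (by linarith)]
    have := mul_le_mul_of_nonneg_right h2 h1.le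
    linarith
  have h6 : |-Real.log (1 - θ) * one - ∑ j ∈ range p, θ ^ (j + 1) / (j + 1) * one| ≤ 1 := by
    rw [← sum_mul, ← sub_mul, abs_mul, abs_of_pos h1, ← abs_neg]
    refine le_trans (mul_le_mul_of_nonneg_right ?_ h1.le) htail2
    refine le_trans (le_of_eq ?_) htail
    congr 1; ring
  calc _ ≤ _ := abs_sub_le _ (∑ j ∈ range p, θ ^ (j + 1) / (j + 1) * one) _
    _ ≤ 1 + 3 * p := add_le_add h6 hsum
    _ = _ := by ring

theorem abs_log_one_sub_le {p U : ℕ} {u E : ℝ} (hU : 2 * U ≤ 2 ^ p)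
    (hu : |u * 2 ^ p - U| ≤ E) (hE : 4 * E ≤ 2 ^ p) :
    |-Real.log (1 - u) * 2 ^ p - logOneSub p (2 ^ p) U| ≤ 3 * p + 1 + 4 * E := by
  have h1 := logOneSub_spec hU
  set one : ℝ := 2 ^ p with hone
  have hp : 0 < one := by positivity
  have hU2 : (U : ℝ) / one ≤ 1 / 2 := by
    rw [div_le_iff₀ hp]
    have : (2 * U : ℝ) ≤ one := by rw [hone]; exact_mod_cast hU
    linarith
  have hE4 : E / one ≤ 1 / 4 := by rw [div_le_iff₀ hp]; linarith
  have hE0 : 0 ≤ E := (abs_nonneg _).trans hu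
  have h2 : |(1 - U / one) - (1 - u)| ≤ E / one := by
    rw [le_div_iff₀ hp, ← abs_of_pos hp, ← abs_mul, abs_of_pos hp]
    refine le_trans (le_of_eq ?_) hu
    congr 1; field_simp; ring
  have h3 := abs_log_sub_log_le (by linarith) h2 (by linarith)
  have h4 : E / one / (1 - U / one - E / one) ≤ 4 * (E / one) := by
    rw [div_le_iff₀ (by linarith)]
    have : 0 ≤ E / one := by positivity
    nlinarith
  have h5 : |(Real.log (1 - U / one) - Real.log (1 - u)) * one| ≤ 4 * E := by
    rw [abs_mul, abs_of_pos hp]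
    calc _ ≤ 4 * (E / one) * one := mul_le_mul_of_nonneg_right (h3.trans h4) hp.le
      _ = _ := by field_simp
  calc _ = |(-Real.log (1 - U / one) * one - logOneSub p (2 ^ p) U) +
        (Real.log (1 - U / one) - Real.log (1 - u)) * one| := by congr 1; ring
    _ ≤ _ := (abs_add_le _ _).trans (add_le_add h1 h5)

end KernelCheck

theorem pow_mul_sum_lt {s t : ℝ} (hs : 0 < s) (hst : s < t) {k : ℕ} (hk : 0 < k) :
    s ^ k * ∑ i ∈ range k, t ^ i < t ^ k * ∑ i ∈ range k, s ^ i := by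
  rw [mul_sum, mul_sum]
  refine sum_lt_sum_of_nonempty (by simpa using hk.ne') fun i hi => ?_
  have hi' := mem_range.1 hi
  obtain ⟨j, hj, rfl⟩ : ∃ j, j ≠ 0 ∧ k = i + j := ⟨k - i, by omega, by omega⟩
  rw [pow_add, pow_add]
  have h1 : s ^ j < t ^ j := pow_lt_pow_left₀ hst hs.le hj
  have h2 : 0 < s ^ i * t ^ i := mul_pos (pow_pos hs i) (pow_pos (hs.trans hst) i)
  nlinarith

theorem pow_mul_two_sub_sub_one (t : ℝ) (k : ℕ) :
    t ^ k * (2 - t) - 1 = (t - 1) * (∑ i ∈ range k, t ^ i - t ^ k) := by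
  have := mul_geom_sum t k
  linear_combination -this

namespace DominantRoot
variable {k : ℕ} {α : ℝ}

theorem le_of_one_le (h : DominantRoot k α) {t : ℝ} (ht : 1 ≤ t ^ k * (2 - t)) : t ≤ α := by
  by_contra! hlt
  have hα := h.lower
  have h1 := pow_mul_sum_lt (by linarith) hlt (by linarith [h.three_le] : 0 < k)
  rw [h.sum_pow_eq, mul_comm] at h1
  have h2 := lt_of_mul_lt_mul_right h1 (by positivity)
  have h3 := pow_mul_two_sub_sub_one t k
  nlinarith

theorem le_of_le_one (h : DominantRoot k α) {t : ℝ} (ht1 : 1 < t) (ht : t ^ k * (2 - t) ≤ 1) :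
    α ≤ t := by
  by_contra! hlt
  have hα := h.lower
  have h1 := pow_mul_sum_lt (by linarith) hlt (by linarith [h.three_le] : 0 < k)
  rw [h.sum_pow_eq, mul_comm] at h1
  have h2 := lt_of_mul_lt_mul_left h1 (by positivity)
  have h3 := pow_mul_two_sub_sub_one t k
  nlinarith

end DominantRoot

namespace KernelCheck
variable {k p a l psi : ℕ} {α : ℝ}

/-- `a`, `l`, `psi` are fixed-point approximations to `α`, `log α` and `-log c`. -/
structure FixedData (k : ℕ) (α : ℝ) (p a l psi : ℕ) : Prop where
  p_lower : 100 ≤ p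
  p_upper : p ≤ 860
  k_le : k ≤ 199
  root : |α * 2 ^ p - a| ≤ 4
  log : |Real.log α * 2 ^ p - l| ≤ 2 ^ 14
  logCoeff : |-Real.log (binetCoeff k α) * 2 ^ p - psi| ≤ 2 ^ 14

theorem two_pow_hundred_le (hp : 100 ≤ p) : (2 : ℝ) ^ 100 ≤ 2 ^ p :=
  pow_le_pow_right₀ (by norm_num) hp

theorem abs_sub_le_of_rootTest (h : DominantRoot k α) (ht : rootTest (2 ^ p) k a = true) :
    |α * 2 ^ p - a| ≤ 4 ∧ a + 4 ≤ 2 * 2 ^ p := by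
  simp only [rootTest, Bool.and_eq_true, Nat.ble_eq] at ht
  obtain ⟨⟨⟨h1, h2⟩, h3⟩, h4⟩ := ht
  have hone : (0 : ℝ) < 2 ^ p := by positivity
  have hpos : 0 < 2 ^ p := by positivity
  have key : ∀ b : ℕ, b ≤ 2 * 2 ^ p → ((b : ℝ) / 2 ^ p) ^ k * (2 - (b : ℝ) / 2 ^ p) =
      ((b ^ k * (2 * 2 ^ p - b) : ℕ) : ℝ) / (((2 ^ p) ^ (k + 1) : ℕ) : ℝ) := by
    intro b hb
    rw [Nat.cast_mul, Nat.cast_sub hb]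
    push_cast
    rw [div_pow, pow_succ]
    field_simp
  have hden : (0 : ℝ) < (((2 ^ p) ^ (k + 1) : ℕ) : ℝ) := by positivity
  have hlo : ((a - 4 : ℕ) : ℝ) / 2 ^ p ≤ α := by
    apply h.le_of_one_le
    rw [key _ (by omega), le_div_iff₀ hden, one_mul]
    exact_mod_cast h3
  have hhi : α ≤ ((a + 4 : ℕ) : ℝ) / 2 ^ p := by
    apply h.le_of_le_one
    · rw [lt_div_iff₀ hone, one_mul]
      have : 2 ^ p < a + 4 := by omega
      exact_mod_cast this
    · rw [key _ (by omega), div_le_one hden]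
      exact_mod_cast h4
  rw [div_le_iff₀ hone] at hlo
  rw [le_div_iff₀ hone] at hhi
  have ha4 : 4 ≤ a := by omega
  push_cast [Nat.cast_sub ha4] at hlo hhi
  exact ⟨abs_le.2 ⟨by linarith, by linarith⟩, h2⟩

theorem div_two_cast_bounds (n : ℕ) : (n : ℝ) / 2 - 1 ≤ (n / 2 : ℕ) ∧ ((n / 2 : ℕ) : ℝ) ≤ n / 2 := by
  have h1 : n ≤ 2 * (n / 2) + 1 := by omega
  have h2 : 2 * (n / 2) ≤ n := by omega
  have h1' : (n : ℝ) ≤ 2 * (n / 2 : ℕ) + 1 := by exact_mod_cast h1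
  have h2' : 2 * ((n / 2 : ℕ) : ℝ) ≤ n := by exact_mod_cast h2
  constructor <;> linarith

theorem exists_fixedData (h : DominantRoot k α) (hk : k ≤ 199) (hp : 100 ≤ p) (hp' : p ≤ 860)
    {f : ℕ → ℕ → ℕ → ℕ → Bool} (hf : withData p k f = true) :
    ∃ a l psi, f (2 ^ p) a l psi = true ∧ FixedData k α p a l psi := by
  simp only [withData, force_eq, Bool.and_eq_true] at hf
  obtain ⟨hroot, hf⟩ := hf
  generalize newton (2 ^ p) k 20 (2 * 2 ^ p - 2 ^ p / 2 ^ k) = a at hroot hf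
  obtain ⟨ha, ha2⟩ := abs_sub_le_of_rootTest h hroot
  refine (fun hs : _ ∧ _ => ⟨a, _, _, hf, hp, hp', hk, ha, hs.1, hs.2⟩) ?_
  have hbig := two_pow_hundred_le hp
  have hbig' : (2 : ℝ) ^ 100 = 1267650600228229401496703205376 := by norm_num
  rw [hbig'] at hbig
  set d := 2 * 2 ^ p - a with hd
  have hdc : (d : ℝ) = 2 * 2 ^ p - a := by rw [hd, Nat.cast_sub (by omega)]; push_cast; rfl
  have hpR : (p : ℝ) ≤ 860 := by exact_mod_cast hp'
  have hkR : (k : ℝ) ≤ 199 := by exact_mod_cast hk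
  have hk0 : (3 : ℝ) ≤ k := by exact_mod_cast h.three_le
  have hl := h.lower
  have hu := h.upper
  have hkδ := h.mul_two_sub_le
  obtain ⟨ha3, ha4⟩ := abs_le.1 ha
  have hlow := h.log_lower
  have hψ := h.log_binetCoeff_upper
  have hlog2 := Real.log_two_gt_d9
  have hlog2' := Real.log_two_lt_d9
  set one : ℝ := 2 ^ p with hone
  have hone0 : 0 < one := by linarith
  have h2 : |Real.log 2 * one - logOneSub p (2 ^ p) (2 ^ p / 2)| ≤ 3 * p + 5 := by
    obtain ⟨h21, h22⟩ := div_two_cast_bounds (2 ^ p)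
    push_cast at h21 h22
    have := abs_log_one_sub_le (p := p) (U := 2 ^ p / 2) (u := 1 / 2) (E := 1) (by omega)
      (by rw [abs_le]; constructor <;> linarith) (by linarith)
    rw [show -Real.log (1 - 1 / 2) = Real.log 2 by
      rw [← Real.log_inv]; norm_num] at this
    linarith
  have h1 : |-Real.log (1 - (2 - α) / 2) * one - logOneSub p (2 ^ p) (d / 2)| ≤ 3 * p + 13 := by
    obtain ⟨h21, h22⟩ := div_two_cast_bounds d
    have := abs_log_one_sub_le (p := p) (U := d / 2) (u := (2 - α) / 2) (E := 3)
      (by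
        have : (2 * (d / 2 : ℕ) : ℝ) ≤ one := by nlinarith
        rw [hone] at this
        exact_mod_cast this)
      (by rw [abs_le]; constructor <;> linarith) (by linarith)
    linarith
  have h3 : |-Real.log (1 - (2 - α)) * one - logOneSub p (2 ^ p) d| ≤ 3 * p + 17 := by
    have := abs_log_one_sub_le (p := p) (U := d) (u := 2 - α) (E := 4)
      (by
        have : (2 * d : ℝ) ≤ one := by nlinarith
        rw [hone] at this
        exact_mod_cast this)
      (by rw [abs_le]; constructor <;> linarith) (by linarith)
    linarith
  have h4 : |-Real.log (1 - (k + 1) * (2 - α) / 2) * one - logOneSub p (2 ^ p) ((k + 1) * d / 2)| ≤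
      3 * p + 1620 := by
    obtain ⟨h21, h22⟩ := div_two_cast_bounds ((k + 1) * d)
    push_cast at h21 h22
    have hdl : -4 ≤ (2 - α) * one - d := by linarith
    have hdu : (2 - α) * one - d ≤ 4 := by linarith
    have hm1 := mul_le_mul_of_nonneg_left hdl (by linarith : (0:ℝ) ≤ k + 1)
    have hm2 := mul_le_mul_of_nonneg_left hdu (by linarith : (0:ℝ) ≤ k + 1)
    have hm3 := mul_le_mul_of_nonneg_right hkδ hone0.le
    have := abs_log_one_sub_le (p := p) (U := (k + 1) * d / 2) (u := (k + 1) * (2 - α) / 2)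
      (E := 401)
      (by
        have : (2 * ((k + 1) * d / 2 : ℕ) : ℝ) ≤ one := by linarith
        rw [hone] at this
        exact_mod_cast this)
      (by rw [abs_le]; constructor <;> linarith) (by linarith)
    linarith
  have e1 : Real.log α = Real.log 2 + Real.log (1 - (2 - α) / 2) := by
    rw [← Real.log_mul (by norm_num) (by linarith)]; congr 1; ring
  have e2 : -Real.log (binetCoeff k α) =
      Real.log 2 + Real.log (1 - (k + 1) * (2 - α) / 2) - Real.log (1 - (2 - α)) := by
    rw [← Real.log_mul (by norm_num) (by linarith), ← Real.log_div (by linarith) (by linarith),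
      ← Real.log_inv, binetCoeff, inv_div]
    congr 2 <;> ring
  rw [abs_le] at h1 h2 h3 h4
  constructor
  · rw [Nat.cast_sub]
    · rw [e1, abs_le]; constructor <;> linarith
    · have hm := mul_le_mul_of_nonneg_right hlow.le hone0.le
      rw [e1] at hm
      rw [← Nat.cast_le (α := ℝ)]
      linarith
  · rw [Nat.cast_sub]
    · push_cast
      rw [e2, abs_le]; constructor <;> linarith
    · have hm := mul_le_mul_of_nonneg_right (show (1/10 : ℝ) ≤ -Real.log (binetCoeff k α) by linarith)
        hone0.le
      rw [e2] at hm
      rw [← Nat.cast_le (α := ℝ)]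
      push_cast
      linarith

end KernelCheck

namespace KernelCheck

theorem dist_eq (l n : ℕ) : dist l n = bif Nat.ble (2 * (n % l)) l then n % l else l - n % l := by
  rw [dist, force_eq]

theorem two_mul_dist_le {l : ℕ} (hl : 0 < l) (n : ℕ) : 2 * dist l n ≤ l := by
  rw [dist_eq]
  have := Nat.mod_lt n hl
  by_cases h : 2 * (n % l) ≤ l
  · rw [Nat.ble_eq_true_of_le h, cond_true]; exact h
  · rw [Bool.eq_false_iff.2 (fun h' => h (Nat.le_of_ble_eq_true h')), cond_false]; omega

theorem exists_abs_sub_eq_dist {l : ℕ} (hl : 0 < l) (n : ℕ) :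
    ∃ Z : ℤ, |(n : ℤ) - Z * l| = dist l n := by
  have hm := Nat.mod_lt n hl
  have hd : ((n : ℤ)) = (n / l : ℕ) * l + (n % l : ℕ) := by
    rw [mul_comm]; exact_mod_cast (Nat.div_add_mod n l).symm
  rw [dist_eq]
  by_cases h : 2 * (n % l) ≤ l
  · refine ⟨(n / l : ℕ), ?_⟩
    rw [Nat.ble_eq_true_of_le h, cond_true, hd, add_sub_cancel_left, abs_of_nonneg (by positivity)]
  · refine ⟨(n / l : ℕ) + 1, ?_⟩
    rw [Bool.eq_false_iff.2 (fun h' => h (Nat.le_of_ble_eq_true h')), cond_false, Nat.cast_sub hm.le]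
    have : (n : ℤ) - ((n / l : ℕ) + 1) * l = -(l - (n % l : ℕ)) := by
      nth_rewrite 1 [hd]; ring
    rw [this, abs_neg, abs_of_nonneg]
    have : ((n % l : ℕ) : ℤ) < l := by exact_mod_cast hm
    linarith

theorem dist_le_abs_sub {l : ℕ} (hl : 0 < l) (n : ℕ) (Z : ℤ) : (dist l n : ℤ) ≤ |(n : ℤ) - Z * l| := by
  obtain ⟨Y, hY⟩ := exists_abs_sub_eq_dist hl n
  by_cases hZ : Z = Y
  · rw [hZ, hY]
  · have h1 : (l : ℤ) ≤ |(n - Y * l) - (n - Z * l)| := by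
      have : ((n : ℤ) - Y * l) - (n - Z * l) = (Z - Y) * l := by ring
      rw [this, abs_mul, Nat.abs_cast]
      exact le_mul_of_one_le_left (by positivity) (Int.one_le_abs (sub_ne_zero.2 hZ))
    have h2 := abs_sub ((n : ℤ) - Y * l) (n - Z * l)
    have h3 : 2 * (dist l n : ℤ) ≤ l := by exact_mod_cast two_mul_dist_le hl n
    linarith

namespace FixedData
variable {k p a l psi : ℕ} {α : ℝ}

theorem two_pow_lower (D : FixedData k α p a l psi) : (1000000000000 : ℝ) ≤ 2 ^ p :=
  le_trans (by norm_num) (two_pow_hundred_le D.p_lower)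

theorem l_lower (D : FixedData k α p a l psi) (h : DominantRoot k α) :
    (58 / 100 : ℝ) * 2 ^ p ≤ l := by
  have h1 := mul_le_mul_of_nonneg_right h.log_lower.le (show (0 : ℝ) ≤ 2 ^ p by positivity)
  linarith [(abs_le.1 D.log).2, D.two_pow_lower]

theorem psi_le (D : FixedData k α p a l psi) (h : DominantRoot k α) :
    (psi : ℝ) ≤ 2 * l := by
  have h1 := mul_le_mul_of_nonneg_right (show -Real.log (binetCoeff k α) ≤ 694 / 1000 by
    linarith [h.log_binetCoeff_lower]) (show (0 : ℝ) ≤ 2 ^ p by positivity)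
  linarith [(abs_le.1 D.logCoeff).1, D.two_pow_lower, D.l_lower h]

end FixedData

end KernelCheck

namespace AnalyticSolution
variable {k m s x A : ℕ} {α : ℝ}

/-- The deviation of `log A` from its main terms. -/
noncomputable def logError (k m A : ℕ) (α : ℝ) : ℝ :=
  Real.log A - m * Real.log α - Real.log (binetCoeff k α)

theorem abs_mul_logCoeff_add_le (H : AnalyticSolution k α m s x A) :
    |((x : ℝ) - 1) * -Real.log (binetCoeff k α) - ((m * x - s : ℤ) : ℝ) * Real.log α| ≤
      x * |logError k m A α| + 2 / 3 ^ x := by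
  have h1 : ((x : ℝ) - 1) * -Real.log (binetCoeff k α) - ((m * x - s : ℤ) : ℝ) * Real.log α =
      x * logError k m A α - (x * Real.log A - s * Real.log α - Real.log (binetCoeff k α)) := by
    rw [logError]; push_cast; ring
  rw [h1]
  refine (abs_sub _ _).trans (add_le_add ?_ H.form)
  rw [abs_mul, Nat.abs_cast]

end AnalyticSolution

namespace KernelCheck
open AnalyticSolution
variable {k m s x A p a l psi X q : ℕ} {α : ℝ}

theorem le_logError_of_mulSubTest (H : AnalyticSolution k α m s x A)
    (D : FixedData k α p a l psi) (ht : mulSubTest (2 ^ p) l psi (2 ^ 14) X q = true)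
    (hxX : x ≤ X) (hq : 40 * q ≤ 3 ^ x) : 2 / 5 ≤ |logError k m A α| * X * q := by
  simp only [mulSubTest, force_eq, Bool.and_eq_true, Nat.ble_eq, Nat.beq_eq] at ht
  set P := (q * psi + l / 2) / l
  set w := q * psi - P * l + (P * l - q * psi) with hw
  obtain ⟨⟨⟨h1, h2⟩, h3⟩, h4⟩ := ht
  have hx := H.twenty_le
  set ψ := -Real.log (binetCoeff k α) with hψ
  set ℓ := Real.log α with hℓ
  have hl := H.root.log_lower
  obtain ⟨hl1, hl2⟩ := abs_le.1 D.log
  obtain ⟨hp1, hp2⟩ := abs_le.1 D.logCoeff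
  have hone : (0 : ℝ) < 2 ^ p := by positivity
  set one : ℝ := 2 ^ p with hone'
  have hw' : |(q * psi : ℝ) - P * l| ≤ w := by
    have : ((q * psi : ℕ) : ℤ) - (P * l : ℕ) ≤ w ∧ -(w : ℤ) ≤ ((q * psi : ℕ) : ℤ) - (P * l : ℕ) := by
      omega
    rw [abs_le]
    constructor
    · exact_mod_cast this.2
    · exact_mod_cast this.1
  have h2R : (P : ℝ) ≤ 2 * q := by exact_mod_cast h2
  have hqψ : |q * ψ - P * ℓ| * one ≤ w + 5 * q * 2 ^ 14 := by
    rw [show |q * ψ - P * ℓ| * one = |(q * ψ - P * ℓ) * one| by rw [abs_mul, abs_of_pos hone]]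
    have e : (q * ψ - P * ℓ) * one =
        (q * psi - P * l) + (q * (ψ * one - psi) - P * (ℓ * one - l)) := by ring
    rw [e]
    refine (abs_add_le _ _).trans (add_le_add hw' ((abs_sub _ _).trans ?_))
    rw [abs_mul, abs_mul, Nat.abs_cast, Nat.abs_cast]
    have i1 : q * |ψ * one - psi| ≤ (q : ℝ) * 2 ^ 14 :=
      mul_le_mul_of_nonneg_left D.logCoeff (by positivity)
    have i2 : P * |ℓ * one - l| ≤ (2 * q : ℝ) * 2 ^ 14 :=
      mul_le_mul h2R D.log (abs_nonneg _) (by positivity)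
    have : (0:ℝ) ≤ q := by positivity
    linarith
  have h3R : 8 * (X * ((w : ℝ) + 5 * q * 2 ^ 14)) ≤ one := by rw [hone']; exact_mod_cast h3
  set N : ℤ := m * x - s
  have hne : (q : ℤ) * N ≠ ((x - 1 : ℕ) : ℤ) * P := by
    intro he
    have hd : (q : ℤ) ∣ ((x - 1 : ℕ) : ℤ) * P := ⟨N, he.symm⟩
    have hd' : q ∣ (x - 1) * P := by exact_mod_cast hd
    have hd2 : q ∣ x - 1 := (Nat.Coprime.symm h4).dvd_of_dvd_mul_right hd'
    have := Nat.le_of_dvd (by omega) hd2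
    omega
  have hone_le : (1 : ℝ) ≤ |(q : ℝ) * N - (x - 1 : ℕ) * P| := by
    have := Int.one_le_abs (sub_ne_zero.2 hne)
    exact_mod_cast this
  have hx1 : ((x - 1 : ℕ) : ℝ) = x - 1 := by rw [Nat.cast_sub (by omega)]; simp
  have hΘ := H.abs_mul_logCoeff_add_le
  set Θ := ((x : ℝ) - 1) * ψ - (N : ℝ) * ℓ with hΘdef
  have e2 : ((q : ℝ) * N - (x - 1 : ℕ) * P) * ℓ = ((x : ℝ) - 1) * (q * ψ - P * ℓ) - q * Θ := by
    rw [hx1, hΘdef]; ring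
  have hxR : (20 : ℝ) ≤ x := by exact_mod_cast hx
  have hXR : (x : ℝ) ≤ X := by exact_mod_cast hxX
  have i3 : ℓ ≤ ((x : ℝ) - 1) * |q * ψ - P * ℓ| + q * |Θ| := by
    calc ℓ ≤ |(q : ℝ) * N - (x - 1 : ℕ) * P| * ℓ := le_mul_of_one_le_left (by linarith) hone_le
      _ = |((q : ℝ) * N - (x - 1 : ℕ) * P) * ℓ| := by rw [abs_mul, abs_of_pos (a := ℓ) (by linarith)]
      _ ≤ |((x : ℝ) - 1) * (q * ψ - P * ℓ)| + |q * Θ| := by rw [e2]; exact abs_sub _ _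
      _ = _ := by rw [abs_mul, abs_mul, Nat.abs_cast, abs_of_pos (show (0:ℝ) < x - 1 by linarith)]
  have i4 : ((x : ℝ) - 1) * |q * ψ - P * ℓ| ≤ 1 / 8 := by
    have i5 : ((x : ℝ) - 1) * |q * ψ - P * ℓ| ≤ X * |q * ψ - P * ℓ| :=
      mul_le_mul_of_nonneg_right (by linarith) (abs_nonneg _)
    have i6 : X * (|q * ψ - P * ℓ| * one) ≤ X * (w + 5 * q * 2 ^ 14) :=
      mul_le_mul_of_nonneg_left hqψ (by positivity)
    have i7 : X * |q * ψ - P * ℓ| ≤ 1 / 8 := by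
      by_contra! hlt
      have := mul_lt_mul_of_pos_right hlt hone
      linarith
    linarith
  have i8 : q * |Θ| ≤ |logError k m A α| * X * q + 1 / 20 := by
    have i9 : q * |Θ| ≤ q * (x * |logError k m A α| + 2 / 3 ^ x) :=
      mul_le_mul_of_nonneg_left hΘ (by positivity)
    have i10 : q * (x * |logError k m A α|) ≤ q * (X * |logError k m A α|) := by gcongr
    have i11 : (q : ℝ) * (2 / 3 ^ x) ≤ 1 / 20 := by
      rw [← mul_div_assoc, div_le_iff₀ (by positivity)]
      have : (40 * q : ℝ) ≤ 3 ^ x := by exact_mod_cast hq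
      linarith
    linarith
  linarith

theorem pow_le_of_mulSubTest (H : AnalyticSolution k α m s x A)
    (D : FixedData k α p a l psi) (ht : mulSubTest (2 ^ p) l psi (2 ^ 14) X q = true)
    (hxX : x ≤ X) (hq : 40 * q ≤ 3 ^ x) : α ^ m ≤ 5 * X * q := by
  have h1 := le_logError_of_mulSubTest H D ht hxX hq
  have hα : 0 < α ^ m := pow_pos (by linarith [H.root.lower]) m
  have h2 : |logError k m A α| * α ^ m ≤ 2 := by
    rw [← le_div_iff₀ hα]; exact H.abs_log_sub_le
  have h3 := mul_le_mul_of_nonneg_right h1 hα.le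
  have h4 : |logError k m A α| * α ^ m * (X * q) ≤ 2 * (X * q) :=
    mul_le_mul_of_nonneg_right h2 (by positivity)
  linarith

theorem false_of_shiftTest (H : AnalyticSolution k α m s x A) (D : FixedData k α p a l psi)
    {T lam : ℕ} {neg : Bool} (ht : shiftTest (2 ^ p) l psi (2 ^ 14) X T lam neg q = true)
    (hxX : x ≤ X) (hT0 : 0 < T) (hT : T ≤ 3 ^ x) (hlaml : lam ≤ l)
    (hlam : |logError k m A α * 2 ^ p - ((bif neg then -(lam : ℝ) else (lam : ℝ)) : ℝ)| ≤ 2 ^ 14) : False := by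
  simp only [shiftTest, force_eq, Bool.and_eq_true, Nat.ble_eq] at ht
  obtain ⟨hq1, ht⟩ := ht
  have hL := D.l_lower H.root
  have hone : (0 : ℝ) < 2 ^ p := by positivity
  have hbig := D.two_pow_lower
  have hl0 : 0 < l := by
    have : (0 : ℝ) < l := by linarith
    exact_mod_cast this
  have hψl := D.psi_le H.root
  have hψl' : psi ≤ 2 * l := by exact_mod_cast hψl
  set ψ := -Real.log (binetCoeff k α) with hψ
  set ℓ := Real.log α with hℓ
  have hl := H.root.log_lower
  set lamZ : ℤ := bif neg then -lam else lam with hlamZ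
  have hlamR : ((bif neg then -(lam:ℝ) else lam) : ℝ) = lamZ := by cases neg <;> simp [hlamZ]
  rw [hlamR] at hlam
  have hlamabs : |lamZ| = lam := by cases neg <;> simp [hlamZ]
  set lamr := logError k m A α with hlamr
  set one : ℝ := 2 ^ p with hone'
  -- an integer multiple of `l` close to `q * (psi - lamZ)`
  obtain ⟨Z, hZ⟩ : ∃ Z : ℤ, |(q : ℤ) * psi - q * lamZ - Z * l| =
      dist l (bif neg then q * psi + q * lam else q * psi + q * l - q * lam) := by
    obtain ⟨Z, hZ⟩ := exists_abs_sub_eq_dist hl0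
      (bif neg then q * psi + q * lam else q * psi + q * l - q * lam)
    cases neg
    · refine ⟨Z - q, ?_⟩
      rw [← hZ]
      simp only [cond_false] at hlamZ ⊢
      have : q * lam ≤ q * l := Nat.mul_le_mul_left _ hlaml
      rw [hlamZ, Nat.cast_sub (by omega)]
      push_cast
      congr 1; ring
    · refine ⟨Z, ?_⟩
      rw [← hZ]
      simp only [cond_true] at hlamZ ⊢
      rw [hlamZ]
      push_cast
      congr 1; ring
  set n := (bif neg then q * psi + q * lam else q * psi + q * l - q * lam)
  have hw2 := two_mul_dist_le hl0 n
  have hD2 := two_mul_dist_le hl0 (q * lam)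
  set w := dist l n
  set d := dist l (q * lam) with hd
  have hZb : |Z| ≤ 4 * q := by
    have h1 : |Z * l| ≤ 4 * q * l := by
      have e : Z * l = (q : ℤ) * psi - q * lamZ - ((q : ℤ) * psi - q * lamZ - Z * l) := by ring
      rw [e]
      refine (abs_sub _ _).trans ?_
      rw [hZ]
      have h2 : |(q : ℤ) * psi - q * lamZ| ≤ q * psi + q * lam := by
        refine (abs_sub _ _).trans ?_
        rw [abs_mul, abs_mul, hlamabs, Nat.abs_cast, Nat.abs_cast]
      have h3 : q * psi ≤ q * (2 * l) := Nat.mul_le_mul_left _ hψl'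
      have h4 : q * lam ≤ q * l := Nat.mul_le_mul_left _ hlaml
      have h5 : 1 * l ≤ q * l := Nat.mul_le_mul_right _ hq1
      have h6 : q * psi + q * lam + w ≤ 4 * q * l := by
        have : 4 * q * l = q * (2 * l) + q * l + q * l := by ring
        omega
      calc _ ≤ ((q * psi + q * lam : ℤ)) + w := by linarith
        _ ≤ _ := by exact_mod_cast h6
    rw [abs_mul, Nat.abs_cast] at h1
    exact le_of_mul_le_mul_right h1 (by exact_mod_cast hl0)
  have hZbR : |(Z : ℝ)| ≤ 4 * q := by exact_mod_cast hZb
  have hq0 : (1 : ℝ) ≤ q := by exact_mod_cast hq1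
  set η := q * (ψ - lamr) - Z * ℓ with hη
  have hηb : |η| * one ≤ w + 6 * q * 2 ^ 14 := by
    rw [show |η| * one = |η * one| by rw [abs_mul, abs_of_pos hone]]
    have e : η * one = (q * psi - q * lamZ - Z * l) +
        (q * (ψ * one - psi) + (-q * (lamr * one - lamZ) + -Z * (ℓ * one - l))) := by rw [hη]; ring
    have hZ' : |((q : ℝ) * psi - q * lamZ - Z * l)| = w := by exact_mod_cast hZ
    rw [e]
    refine (abs_add_le _ _).trans ?_
    rw [hZ']
    have i1 : |q * (ψ * one - psi)| ≤ (q : ℝ) * 2 ^ 14 := by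
      rw [abs_mul, Nat.abs_cast]
      exact mul_le_mul_of_nonneg_left D.logCoeff (by positivity)
    have i2 : |-q * (lamr * one - lamZ)| ≤ (q : ℝ) * 2 ^ 14 := by
      rw [abs_mul, abs_neg, Nat.abs_cast]
      exact mul_le_mul_of_nonneg_left hlam (by positivity)
    have i3 : |-Z * (ℓ * one - l)| ≤ (4 * q : ℝ) * 2 ^ 14 := by
      rw [abs_mul, abs_neg]
      exact mul_le_mul hZbR D.log (abs_nonneg _) (by positivity)
    have i4 := abs_add_le (q * (ψ * one - psi)) (-q * (lamr * one - lamZ) + -Z * (ℓ * one - l))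
    have i5 := abs_add_le (-q * (lamr * one - lamZ)) (-Z * (ℓ * one - l))
    linarith
  -- lower bound for `|q * lamr + Y * ℓ|`
  have hlow : ∀ Y : ℤ, (d : ℝ) - 3 * q * 2 ^ 14 ≤ |q * lamr + Y * ℓ| * one := by
    intro Y
    have hdl : (2 * d : ℝ) ≤ l := by exact_mod_cast hD2
    have e : (q * lamr + Y * ℓ) * one =
        (q * lamZ + Y * l) + (q * (lamr * one - lamZ) + Y * (ℓ * one - l)) := by ring
    have i2 : |q * (lamr * one - lamZ)| ≤ (q : ℝ) * 2 ^ 14 := by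
      rw [abs_mul, Nat.abs_cast]
      exact mul_le_mul_of_nonneg_left hlam (by positivity)
    have i3 : |Y * (ℓ * one - l)| ≤ |(Y : ℝ)| * 2 ^ 14 := by
      rw [abs_mul]
      exact mul_le_mul_of_nonneg_left D.log (by positivity)
    have i4 : |((q : ℝ) * lamZ + Y * l)| ≤ |q * lamr + Y * ℓ| * one + (q * 2 ^ 14 + |(Y : ℝ)| * 2 ^ 14) := by
      have i5 : ((q : ℝ) * lamZ + Y * l) = (q * lamr + Y * ℓ) * one -
        (q * (lamr * one - lamZ) + Y * (ℓ * one - l)) := by rw [e]; ring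
      rw [i5]
      refine (abs_sub _ _).trans (add_le_add ?_ ?_)
      · rw [abs_mul, abs_of_pos hone]
      · exact (abs_add_le _ _).trans (add_le_add i2 i3)
    by_cases hY : |Y| ≤ 2 * q
    · have hYR : |(Y : ℝ)| ≤ 2 * q := by exact_mod_cast hY
      have i6 : (d : ℝ) ≤ |((q : ℝ) * lamZ + Y * l)| := by
        have : (d : ℤ) ≤ |(q : ℤ) * lamZ + Y * l| := by
          cases neg
          · simp only [cond_false] at hlamZ
            have := dist_le_abs_sub hl0 (q * lam) (-Y)
            rw [hlamZ]
            refine this.trans_eq ?_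
            push_cast; congr 1; ring
          · simp only [cond_true] at hlamZ
            have := dist_le_abs_sub hl0 (q * lam) Y
            rw [hlamZ, ← abs_neg]
            refine this.trans_eq ?_
            push_cast; congr 1; ring
        exact_mod_cast this
      linarith
    · have hY1 : 2 * (q : ℤ) + 1 ≤ |Y| := by omega
      have hY1R : 2 * (q : ℝ) + 1 ≤ |(Y : ℝ)| := by exact_mod_cast hY1
      have i6 : |(Y : ℝ)| * l - q * l ≤ |((q : ℝ) * lamZ + Y * l)| := by
        have i7 := abs_sub_abs_le_abs_sub ((Y : ℝ) * l) (-(q * lamZ))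
        rw [abs_neg, abs_mul, abs_mul, Nat.abs_cast, Nat.abs_cast] at i7
        have i8 : |(lamZ : ℝ)| ≤ l := by
          have : |(lamZ : ℝ)| = lam := by exact_mod_cast hlamabs
          rw [this]; exact_mod_cast hlaml
        have i9 : (q : ℝ) * |(lamZ : ℝ)| ≤ q * l := mul_le_mul_of_nonneg_left i8 (by positivity)
        have i10 : (Y : ℝ) * l - -(q * lamZ) = q * lamZ + Y * l := by ring
        rw [i10] at i7
        linarith
      have hl14 : (2 ^ 14 : ℝ) ≤ l := le_trans (by norm_num) ((show (100000 : ℝ) ≤ l by linarith))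
      have i11 : (2 * (q : ℝ) + 1) * (l - 2 ^ 14) ≤ |(Y : ℝ)| * (l - 2 ^ 14) :=
        mul_le_mul_of_nonneg_right hY1R (by linarith)
      have i12 : (2 ^ 14 : ℝ) ≤ q * l := by nlinarith
      linarith
  have hx := H.twenty_le
  have hxR : (20 : ℝ) ≤ x := by exact_mod_cast hx
  have hXR : (x : ℝ) ≤ X := by exact_mod_cast hxX
  have hform := H.form
  set Λ := x * Real.log A - s * Real.log α - Real.log (binetCoeff k α) with hΛ
  have hfin := hlow ((q : ℤ) * (m * x - s) - (x - 1 : ℤ) * Z)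
  have e : q * lamr + (((q : ℤ) * (m * x - s) - (x - 1 : ℤ) * Z : ℤ) : ℝ) * ℓ =
      (x - 1) * η + q * Λ := by
    rw [hη, hΛ, hlamr, logError, hψ]; push_cast; ring
  rw [e] at hfin
  have j1 : |(x - 1) * η + q * Λ| * one ≤ X * (w + 6 * q * 2 ^ 14) + q * (2 / 3 ^ x) * one := by
    have j2 : |(x - 1) * η + q * Λ| ≤ X * |η| + q * (2 / 3 ^ x) := by
      refine (abs_add_le _ _).trans (add_le_add ?_ ?_)
      · rw [abs_mul, abs_of_pos (show (0:ℝ) < x - 1 by linarith)]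
        exact mul_le_mul_of_nonneg_right (by linarith) (abs_nonneg _)
      · rw [abs_mul, Nat.abs_cast]
        exact mul_le_mul_of_nonneg_left hform (by positivity)
    have j3 := mul_le_mul_of_nonneg_right j2 hone.le
    have j4 : X * (|η| * one) ≤ X * (w + 6 * q * 2 ^ 14) :=
      mul_le_mul_of_nonneg_left hηb (by positivity)
    linarith
  have j5 : q * (2 / 3 ^ x) * one ≤ (2 * q * 2 ^ p / T : ℕ) + 1 := by
    have j6 : ((2 * q * 2 ^ p : ℕ) : ℝ) / T ≤ (2 * q * 2 ^ p / T : ℕ) + 1 := by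
      rw [← Nat.floor_div_eq_div (K := ℝ)]
      exact (Nat.lt_floor_add_one _).le
    refine le_trans ?_ j6
    push_cast
    rw [← hone']
    have j7 : q * (2 / 3 ^ x) * one = 2 * q * one / (3 : ℝ) ^ x := by ring
    rw [j7]
    have : (T : ℝ) ≤ 3 ^ x := by exact_mod_cast hT
    gcongr
  have htR : ((2 * q * 2 ^ p / T : ℕ) : ℝ) + X * (w + 6 * q * 2 ^ 14) + 3 * q * 2 ^ 14 + 2 ≤ d := by
    exact_mod_cast ht
  linarith

end KernelCheck

namespace KernelCheck
open AnalyticSolution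
variable {k m s x A p a l psi X Q : ℕ} {α : ℝ}

theorem exists_of_euclid {thr : ℕ} {f : ℕ → ℕ → Bool} :
    ∀ {fuel u v : ℕ}, euclid thr fuel f u v = true → ∃ u v, f u v = true := by
  intro fuel
  induction fuel with
  | zero => exact fun h => ⟨_, _, h⟩
  | succ n ih =>
    intro u v h
    change (bif Nat.ble v thr then f u v else euclid thr n f v (u % v)) = true at h
    cases hb : Nat.ble v thr
    · rw [hb, cond_false] at h; exact ih h
    · rw [hb, cond_true] at h; exact ⟨_, _, h⟩

theorem exists_of_euclidFour {thr : ℕ} {f : ℕ → ℕ → Bool} :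
    ∀ {fuel u v : ℕ}, euclidFour thr fuel f u v = true → ∃ u v, f u v = true := by
  intro fuel
  induction fuel with
  | zero => exact fun h => ⟨_, _, h⟩
  | succ n ih =>
    intro u v h
    change (bif Nat.ble v thr then f u v else euclidFour thr n f _ _) = true at h
    cases hb : Nat.ble v thr
    · rw [hb, cond_false] at h; exact ih h
    · rw [hb, cond_true] at h; exact ⟨_, _, h⟩

theorem exists_of_search {M : ℕ} {test : ℕ → Bool} :
    ∀ {fuel u v : ℕ}, search M test fuel u v = true → ∃ q, test q = true := by
  intro fuel
  induction fuel with
  | zero => exact fun h => absurd h Bool.false_ne_true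
  | succ n ih =>
    intro u v h
    change (bif force (lowPart M v) test then true else
      force (u % v) fun r => search M test n v r) = true at h
    rw [force_eq, force_eq] at h
    cases hb : test (lowPart M v)
    · rw [hb, cond_false] at h; exact ih h
    · exact ⟨_, hb⟩

theorem exists_of_pairTest {one e T M u v lam : ℕ} {neg : Bool}
    (h : pairTest p one l psi e X T M u v lam neg = true) :
    ∃ q, shiftTest one l psi e X T lam neg q = true := by
  simp only [pairTest, force_eq] at h
  obtain ⟨u, v, h⟩ := exists_of_euclidFour h
  exact exists_of_search h

theorem false_of_lamTest (H : AnalyticSolution k α m s x A) (D : FixedData k α p a l psi)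
    {T M u v lam : ℕ} {neg : Bool}
    (ht : lamTest p (2 ^ p) l psi (2 ^ 14) X Q T M u v lam neg = true)
    (hxX : x ≤ X) (hT0 : 0 < T) (hT : T ≤ 3 ^ x)
    (hη : 2 / 5 ≤ |logError k m A α| * X * Q)
    (hlam : |logError k m A α * 2 ^ p - ((bif neg then -(lam : ℝ) else (lam : ℝ)) : ℝ)| ≤ 2 ^ 14) :
    False := by
  rw [lamTest] at ht
  cases hb : Nat.ble ((lam + 2 ^ 14) * X * Q * 10 + 1) (4 * 2 ^ p)
  · rw [hb, cond_false, Bool.and_eq_true] at ht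
    obtain ⟨q, hq⟩ := exists_of_pairTest ht.2
    exact false_of_shiftTest H D hq hxX hT0 hT (Nat.le_of_ble_eq_true ht.1) hlam
  · have hb' := Nat.le_of_ble_eq_true hb
    have hbR : ((lam : ℝ) + 2 ^ 14) * X * Q * 10 + 1 ≤ 4 * 2 ^ p := by exact_mod_cast hb'
    have hone : (0 : ℝ) < 2 ^ p := by positivity
    have h1 : |logError k m A α| * 2 ^ p ≤ lam + 2 ^ 14 := by
      have h2 := abs_sub_abs_le_abs_sub (logError k m A α * 2 ^ p)
        ((bif neg then -(lam : ℝ) else (lam : ℝ)) : ℝ)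
      rw [abs_mul, abs_of_pos hone] at h2
      have h3 : |((bif neg then -(lam : ℝ) else (lam : ℝ)) : ℝ)| = lam := by cases neg <;> simp
      linarith
    have h4 := mul_le_mul_of_nonneg_right h1 (show (0 : ℝ) ≤ X * Q by positivity)
    have h5 := mul_le_mul_of_nonneg_right hη hone.le
    linarith

/-- `g` is a fixed-point approximation to `c * α ^ m`. -/
structure PowerApprox (k : ℕ) (α : ℝ) (p m g : ℕ) : Prop where
  one_le : 2 ^ p ≤ 3 * g
  abs_log_le : |Real.log (g / 2 ^ p) - m * Real.log α - Real.log (binetCoeff k α)| * 2 ^ p ≤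
    2000 + 5 * m

namespace PowerApprox

theorem abs_floor_sub_le (u v : ℕ) : |((u / v : ℕ) : ℝ) - u / v| ≤ 1 := by
  rw [← Nat.floor_div_eq_div (K := ℝ), abs_le]
  have h1 := Nat.floor_le (show (0 : ℝ) ≤ (u : ℝ) / v by positivity)
  have h2 := Nat.lt_floor_add_one ((u : ℝ) / v)
  constructor <;> linarith

theorem succ (h : DominantRoot k α) (D : FixedData k α p a l psi) {g : ℕ}
    (G : PowerApprox k α p m g) : PowerApprox k α p (m + 1) (g * a / 2 ^ p) := by
  have hone := D.two_pow_lower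
  have h1 := G.one_le
  have h2 := G.abs_log_le
  have h1R : (2 : ℝ) ^ p ≤ 3 * g := by exact_mod_cast h1
  have ha := D.root
  have hf := abs_floor_sub_le (g * a) (2 ^ p)
  push_cast at hf
  set g' := g * a / 2 ^ p with hg'
  have hl := h.lower
  set one : ℝ := 2 ^ p with hone'
  have hone0 : 0 < one := by linarith
  have hg0 : (0 : ℝ) < g := by linarith
  have hr : (g : ℝ) / one * one = g := div_mul_cancel₀ _ hone0.ne'
  have hr0 : 0 < (g : ℝ) / one := by positivity
  have hd : |g * α - g'| ≤ 4 * (g / one) + 1 := by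
    have e : g * α - g' = g / one * (α * one - a) - (g' - g * a / one) := by
      field_simp; ring
    rw [e]
    refine (abs_sub _ _).trans (add_le_add ?_ hf)
    rw [abs_mul, abs_of_pos hr0, mul_comm]
    exact mul_le_mul_of_nonneg_right ha hr0.le
  have hrb : 4 * ((g : ℝ) / one) ≤ g / 1000 := by
    rw [mul_div_assoc', div_le_div_iff₀ hone0 (by norm_num)]
    nlinarith
  have hgα : 9 / 5 * (g : ℝ) ≤ g * α := by nlinarith
  obtain ⟨hd1, hd2⟩ := abs_le.1 hd
  have hgg : (g : ℝ) ≤ g' := by linarith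
  have hlog := abs_log_sub_log_le (by positivity) hd (by linarith)
  refine ⟨?_, ?_⟩
  · have : g ≤ g' := by exact_mod_cast hgg
    omega
  · have h3 : |Real.log (g' / one) - Real.log (g / one) - Real.log α| * one ≤ 5 := by
      have e : Real.log (g' / one) - Real.log (g / one) - Real.log α =
          -(Real.log (g * α) - Real.log g') := by
        rw [Real.log_div (by linarith) hone0.ne', Real.log_div hg0.ne' hone0.ne',
          Real.log_mul hg0.ne' (by linarith)]
        ring
      rw [e, abs_neg]
      refine (mul_le_mul_of_nonneg_right hlog hone0.le).trans ?_
      rw [div_mul_eq_mul_div, div_le_iff₀ (by linarith)]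
      linarith
    have e : Real.log (g' / one) - (m + 1 : ℕ) * Real.log α - Real.log (binetCoeff k α) =
        (Real.log (g' / one) - Real.log (g / one) - Real.log α) +
        (Real.log (g / one) - m * Real.log α - Real.log (binetCoeff k α)) := by
      push_cast; ring
    rw [e]
    have h4 := mul_le_mul_of_nonneg_right (abs_add_le
      (Real.log (g' / one) - Real.log (g / one) - Real.log α)
      (Real.log (g / one) - m * Real.log α - Real.log (binetCoeff k α))) hone0.le
    push_cast
    linarith

theorem zero (h : DominantRoot k α) (D : FixedData k α p a l psi) :
    PowerApprox k α p 0 ((a - 2 ^ p) * 2 ^ p / ((k + 1) * a - 2 * k * 2 ^ p)) := by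
  have hone := D.two_pow_lower
  have hl := h.lower
  have hu := h.upper
  have hden := h.den_lower
  have hcmul := h.binetCoeff_mul
  have hc := h.binetCoeff_lower
  obtain ⟨ha1, ha2⟩ := abs_le.1 D.root
  have hk : (k : ℝ) ≤ 199 := by exact_mod_cast D.k_le
  have hk0 : (0 : ℝ) ≤ k := by positivity
  have hone0 : (0 : ℝ) < 2 ^ p := by positivity
  set den := (k + 1) * α - 2 * k with hden'
  have hdd : |den * 2 ^ p - ((k + 1) * a - 2 * k * 2 ^ p)| ≤ 800 := by
    have e : den * 2 ^ p - ((k + 1) * a - 2 * k * 2 ^ p) = (k + 1) * (α * 2 ^ p - a) := by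
      rw [hden']; ring
    rw [e, abs_mul, abs_of_nonneg (by linarith)]
    calc (k + 1 : ℝ) * |α * 2 ^ p - a| ≤ 200 * 4 :=
          mul_le_mul (by linarith) D.root (abs_nonneg _) (by norm_num)
      _ = 800 := by norm_num
  obtain ⟨hd1, hd2⟩ := abs_le.1 hdd
  have hdm := mul_le_mul_of_nonneg_right hden hone0.le
  have hαm := mul_le_mul_of_nonneg_right hl.le hone0.le
  have i1 : 2 ^ p ≤ a := by
    rw [← Nat.cast_le (α := ℝ)]; push_cast; linarith
  have i2 : 2 * k * 2 ^ p ≤ (k + 1) * a := by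
    rw [← Nat.cast_le (α := ℝ)]; push_cast; linarith
  have hf := abs_floor_sub_le ((a - 2 ^ p) * 2 ^ p) ((k + 1) * a - 2 * k * 2 ^ p)
  set g := (a - 2 ^ p) * 2 ^ p / ((k + 1) * a - 2 * k * 2 ^ p) with hg
  push_cast [Nat.cast_sub i1, Nat.cast_sub i2] at hf
  have hnn : |(α - 1) * 2 ^ p - (a - 2 ^ p)| ≤ 4 := by
    have e : (α - 1) * 2 ^ p - (a - 2 ^ p) = α * 2 ^ p - a := by ring
    rw [e]; exact D.root
  set one : ℝ := 2 ^ p with hone'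
  set N : ℝ := a - one with hN
  set E : ℝ := (k + 1) * a - 2 * k * one with hE
  have hN0 : 79 / 100 * one ≤ N := by linarith
  have hE0 : one ≤ E := by linarith
  have hNone : 0 < N * one := mul_pos (by linarith) hone0
  have hl1 := abs_log_sub_log_le (show 0 < (α - 1) * one by linarith) hnn (by linarith)
  have hl2 := abs_log_sub_log_le (show 0 < den * one by linarith) hdd (by linarith)
  have hq0 : 2 / 5 * one ≤ N * one / E := by
    rw [le_div_iff₀ (by linarith)]
    have h3 : den * (1 / 2) ≤ α - 1 := by
      rw [← hcmul, mul_comm]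
      exact mul_le_mul_of_nonneg_right hc.le (by linarith)
    have h4 := mul_le_mul_of_nonneg_right h3 hone0.le
    have h5 : 2 / 5 * E ≤ N := by linarith
    have h6 := mul_le_mul_of_nonneg_right h5 hone0.le
    linarith
  rw [abs_sub_comm] at hf
  have hl3 := abs_log_sub_log_le (show 0 < N * one / E by linarith) hf (by linarith)
  obtain ⟨hf1, hf2⟩ := abs_le.1 hf
  have hg0 : one ≤ 3 * g := by linarith
  refine ⟨by rw [hone'] at hg0; exact_mod_cast hg0, ?_⟩
  have hb1 : |Real.log ((α - 1) * one) - Real.log N| * one ≤ 6 := by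
    refine (mul_le_mul_of_nonneg_right hl1 hone0.le).trans ?_
    rw [div_mul_eq_mul_div, div_le_iff₀ (by linarith)]
    linarith
  have hb2 : |Real.log (den * one) - Real.log E| * one ≤ 800 := by
    refine (mul_le_mul_of_nonneg_right hl2 hone0.le).trans ?_
    rw [div_mul_eq_mul_div, div_le_iff₀ (by linarith)]
    linarith
  have hb3 : |Real.log (N * one / E) - Real.log g| * one ≤ 3 := by
    refine (mul_le_mul_of_nonneg_right hl3 hone0.le).trans ?_
    rw [div_mul_eq_mul_div, div_le_iff₀ (by linarith)]
    linarith
  have e : Real.log (g / one) - (0 : ℕ) * Real.log α - Real.log (binetCoeff k α) =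
      -(Real.log (N * one / E) - Real.log g) - (Real.log ((α - 1) * one) - Real.log N) +
        (Real.log (den * one) - Real.log E) := by
    rw [Real.log_div (by linarith) hone0.ne', Real.log_div hNone.ne' (by linarith),
      Real.log_mul (by linarith) hone0.ne', Real.log_mul (by linarith) hone0.ne',
      Real.log_mul (by linarith) hone0.ne', binetCoeff,
      Real.log_div (by linarith) (by linarith)]
    push_cast; ring
  rw [e]
  have t1 := abs_add_le (-(Real.log (N * one / E) - Real.log g) -
    (Real.log ((α - 1) * one) - Real.log N)) (Real.log (den * one) - Real.log E)
  have t2 := abs_sub (-(Real.log (N * one / E) - Real.log g))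
    (Real.log ((α - 1) * one) - Real.log N)
  rw [abs_neg] at t2
  have t3 := mul_le_mul_of_nonneg_right (t1.trans (add_le_add_left t2 _)) hone0.le
  push_cast
  linarith

theorem powIter (h : DominantRoot k α) (D : FixedData k α p a l psi) :
    ∀ {n m g : ℕ}, PowerApprox k α p m g →
      PowerApprox k α p (m + n) (KernelCheck.powIter (2 ^ p) a n g) := by
  intro n
  induction n with
  | zero => exact fun G => G
  | succ n ih =>
    intro m g G
    have h1 : KernelCheck.powIter (2 ^ p) a (n + 1) g =
        KernelCheck.powIter (2 ^ p) a n (g * a / 2 ^ p) := by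
      change force (g * a / 2 ^ p) (fun g' => KernelCheck.powIter (2 ^ p) a n g') = _
      rw [force_eq]
    rw [h1, show m + (n + 1) = m + 1 + n by ring]
    exact ih (G.succ h D)

end PowerApprox

end KernelCheck

namespace KernelCheck
open AnalyticSolution
variable {k m s x A p a l psi X Q g B : ℕ} {α : ℝ}

theorem abs_sub_le_of_abs_log_sub_le {a b d : ℝ} (ha : 0 < a) (hb : 0 < b) (hd : d ≤ 1)
    (h : |Real.log a - Real.log b| ≤ d) : |a - b| ≤ 2 * d * b := by
  have h1 : a = b * Real.exp (Real.log a - Real.log b) := by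
    rw [Real.exp_sub, Real.exp_log ha, Real.exp_log hb]; field_simp
  have h2 := Real.abs_exp_sub_one_le (h.trans hd)
  have e : a - b = (Real.exp (Real.log a - Real.log b) - 1) * b := by
    nth_rewrite 1 [h1]; ring
  rw [e, abs_mul, abs_of_pos hb]
  exact mul_le_mul_of_nonneg_right (by linarith) hb.le

namespace PowerApprox

theorem eq_of_roundTest (H : AnalyticSolution k α m s x A) (D : FixedData k α p a l psi)
    (G : PowerApprox k α p m g) (hm : m ≤ 700) {A' : ℕ} (ht : roundTest (2 ^ p) g A' = true) :
    A = A' := by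
  simp only [roundTest, Bool.and_eq_true, Nat.ble_eq] at ht
  obtain ⟨⟨⟨h1, h2⟩, h3⟩, h4⟩ := ht
  have hα := H.root.lower
  have hc := H.root.binetCoeff_lower
  have hone := D.two_pow_lower
  have hlog := G.abs_log_le
  have happ := H.approx
  have hmR : (m : ℝ) ≤ 700 := by exact_mod_cast hm
  have h1R : (2 * 2 ^ p : ℝ) ≤ g := by exact_mod_cast h1
  have h2R : (g * 2 ^ 30 : ℝ) ≤ 2 ^ p * 2 ^ p := by exact_mod_cast h2
  have h3R : (100 * (A' * 2 ^ p) : ℝ) ≤ 100 * g + 49 * 2 ^ p := by exact_mod_cast h3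
  have h4R : (100 * g : ℝ) ≤ 100 * (A' * 2 ^ p) + 49 * 2 ^ p := by exact_mod_cast h4
  set one : ℝ := 2 ^ p
  have hone0 : 0 < one := by linarith
  have hg0 : (0 : ℝ) < g := by linarith
  set P := binetCoeff k α * α ^ m with hP
  have hP0 : 0 < P := by positivity
  have hlogP : Real.log P = Real.log (binetCoeff k α) + m * Real.log α := by
    rw [hP, Real.log_mul (by linarith) (by positivity), Real.log_pow]
  have h5 : |Real.log P - Real.log (g / one)| ≤ 5500 / one := by
    rw [le_div_iff₀ hone0, abs_sub_comm, hlogP]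
    refine le_trans (le_of_eq ?_) (hlog.trans (by linarith))
    congr 2; ring
  have h6 := abs_sub_le_of_abs_log_sub_le hP0 (by positivity)
    (by rw [div_le_one hone0]; linarith) h5
  have h7 : 2 * (5500 / one) * (g / one) ≤ 1 / 1000 := by
    rw [show 2 * (5500 / one) * ((g : ℝ) / one) = 11000 * g / (one * one) by field_simp; ring,
      div_le_div_iff₀ (by positivity) (by norm_num)]
    linarith
  have h8 : |(g : ℝ) / one - A'| ≤ 49 / 100 := by
    rw [abs_le]
    constructor
    · rw [le_sub_iff_add_le, le_div_iff₀ hone0]; linarith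
    · rw [sub_le_iff_le_add, div_le_iff₀ hone0]; linarith
  have h9 : |(A : ℝ) - A'| < 1 := by
    rw [abs_le] at happ h6 h8
    rw [abs_lt]
    constructor <;> linarith
  have h10 : |(A : ℤ) - A'| < 1 := by exact_mod_cast h9
  have := Int.abs_lt_one_iff.1 h10
  omega

theorem abs_logError_sub_le (D : FixedData k α p a l psi)
    (G : PowerApprox k α p m g) (hm : m ≤ 700) {lam : ℝ}
    (h : |(Real.log A - Real.log (g / 2 ^ p)) * 2 ^ p - lam| ≤ 3 * p + 5) :
    |logError k m A α * 2 ^ p - lam| ≤ 2 ^ 14 := by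
  have hmR : (m : ℝ) ≤ 700 := by exact_mod_cast hm
  have hpR : (p : ℝ) ≤ 860 := by exact_mod_cast D.p_upper
  have hlog := G.abs_log_le
  have hone0 : (0 : ℝ) < 2 ^ p := by positivity
  set t := Real.log (g / 2 ^ p) - m * Real.log α - Real.log (binetCoeff k α) with ht
  have e : logError k m A α * 2 ^ p - lam =
      ((Real.log A - Real.log (g / 2 ^ p)) * 2 ^ p - lam) + t * 2 ^ p := by
    rw [logError, ht]; ring
  rw [e]
  have h1 : |t * 2 ^ p| ≤ 5500 := by
    rw [abs_mul, abs_of_pos hone0]; linarith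
  have h2 := abs_add_le ((Real.log A - Real.log (g / 2 ^ p)) * 2 ^ p - lam) (t * 2 ^ p)
  linarith

theorem abs_logError_add_le (H : AnalyticSolution k α m s x A) (D : FixedData k α p a l psi)
    (G : PowerApprox k α p m g) (hm : m ≤ 700) (ht : roundTest (2 ^ p) g A = true)
    (hle : A * 2 ^ p ≤ g) :
    |logError k m A α * 2 ^ p - -(logOneSub p (2 ^ p) ((g - A * 2 ^ p) * 2 ^ p / g) : ℝ)| ≤
      2 ^ 14 := by
  simp only [roundTest, Bool.and_eq_true, Nat.ble_eq] at ht
  obtain ⟨⟨⟨h1, -⟩, -⟩, h4⟩ := ht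
  apply G.abs_logError_sub_le D hm
  have hone := D.two_pow_lower
  have hA : (0 : ℝ) < A := by have := H.four_le; exact_mod_cast (by omega : 0 < A)
  have hp0 : 0 < 2 ^ p := by positivity
  have hg0 : 0 < g := by omega
  have hg0R : (0 : ℝ) < g := by exact_mod_cast hg0
  have hf := abs_floor_sub_le ((g - A * 2 ^ p) * 2 ^ p) g
  have hU : 2 * ((g - A * 2 ^ p) * 2 ^ p / g) ≤ 2 ^ p := by
    have h5 : 2 * (g - A * 2 ^ p) ≤ g := by omega
    have h6 := Nat.div_mul_le_self ((g - A * 2 ^ p) * 2 ^ p) g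
    have h7 := Nat.mul_le_mul_right (2 ^ p) h5
    refine Nat.le_of_mul_le_mul_right ?_ hg0
    linarith
  push_cast [Nat.cast_sub hle] at hf
  have := abs_log_one_sub_le (u := 1 - A * 2 ^ p / g) (E := 1) hU (by
    rw [abs_sub_comm]
    refine le_trans (le_of_eq ?_) hf
    congr 2
    field_simp) (by linarith)
  rw [sub_sub_cancel] at this
  have e : Real.log (A * 2 ^ p / g) = Real.log A - Real.log (g / 2 ^ p) := by
    rw [← Real.log_div hA.ne' (by positivity)]
    congr 1
    field_simp
  rw [e] at this
  rw [← abs_neg]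
  refine le_trans (le_of_eq ?_) (this.trans (by linarith))
  congr 1; ring

theorem abs_logError_sub_logOneSub_le (H : AnalyticSolution k α m s x A)
    (D : FixedData k α p a l psi)
    (G : PowerApprox k α p m g) (hm : m ≤ 700) (ht : roundTest (2 ^ p) g A = true)
    (hle : g ≤ A * 2 ^ p) :
    |logError k m A α * 2 ^ p - (logOneSub p (2 ^ p) ((A * 2 ^ p - g) / A) : ℝ)| ≤ 2 ^ 14 := by
  simp only [roundTest, Bool.and_eq_true, Nat.ble_eq] at ht
  obtain ⟨⟨⟨h1, -⟩, h3⟩, -⟩ := ht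
  apply G.abs_logError_sub_le D hm
  have hone := D.two_pow_lower
  have hA0 : 0 < A := by have := H.four_le; omega
  have hA : (0 : ℝ) < A := by exact_mod_cast hA0
  have hp0 : 0 < 2 ^ p := by positivity
  have hg0 : 0 < g := by omega
  have hg0R : (0 : ℝ) < g := by exact_mod_cast hg0
  have hf := abs_floor_sub_le (A * 2 ^ p - g) A
  have hU : 2 * ((A * 2 ^ p - g) / A) ≤ 2 ^ p := by
    have h6 := Nat.div_mul_le_self (A * 2 ^ p - g) A
    refine Nat.le_of_mul_le_mul_right ?_ hA0
    have h7 : 2 * (A * 2 ^ p - g) ≤ A * 2 ^ p := by omega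
    linarith
  push_cast [Nat.cast_sub hle] at hf
  have hp0R : (0 : ℝ) < 2 ^ p := by positivity
  have := abs_log_one_sub_le (u := 1 - g / (A * 2 ^ p)) (E := 1) hU (by
    rw [abs_sub_comm]
    refine le_trans (le_of_eq ?_) hf
    congr 2
    field_simp) (by linarith)
  rw [sub_sub_cancel] at this
  have e : -Real.log (g / (A * 2 ^ p)) = Real.log A - Real.log (g / 2 ^ p) := by
    rw [← Real.log_div hA.ne' (by positivity), ← Real.log_inv]
    congr 1
    field_simp
  rw [e] at this
  linarith

end PowerApprox

theorem false_of_loop (H : AnalyticSolution k α m s x A) (D : FixedData k α p a l psi)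
    (hQ : mulSubTest (2 ^ p) l psi (2 ^ 14) X Q = true) (hxX : x ≤ X) (hQx : 40 * Q ≤ 3 ^ x)
    {T M : ℕ} (hT0 : 0 < T) (hT : T ≤ 3 ^ x) :
    ∀ {fuel m₀ g u v : ℕ}, fuel + m₀ ≤ 700 → m₀ ≤ m → PowerApprox k α p m₀ g →
      loop p (2 ^ p) a l psi (2 ^ 14) X Q T M fuel m₀ g u v = true → False := by
  intro fuel
  have hη := le_logError_of_mulSubTest H D hQ hxX hQx
  have hpow := pow_le_of_mulSubTest H D hQ hxX hQx
  induction fuel with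
  | zero => exact fun _ _ _ h => Bool.false_ne_true h
  | succ n ih =>
    intro m₀ g u v hfuel hm₀ G h
    rw [loop] at h
    simp only [force_eq] at h
    have hg := G.one_le
    have hp0 : 0 < 2 ^ p := by positivity
    cases hb : Nat.ble (5 * X * Q * 2 ^ p) g
    · rw [hb, cond_false, Bool.and_eq_true] at h
      obtain ⟨hr, h⟩ := h
      obtain ⟨u, v, h⟩ := exists_of_euclid h
      generalize (2 * g + 2 ^ p) / (2 * 2 ^ p) = A' at hr h
      rw [Bool.and_eq_true] at h
      obtain ⟨h1, h2⟩ := h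
      rcases hm₀.eq_or_lt with rfl | hlt
      · obtain rfl := G.eq_of_roundTest H D (by omega) hr
        cases hb : Nat.ble (A * 2 ^ p) g
        · rw [hb, cond_false] at h1
          have : ¬ A * 2 ^ p ≤ g := fun h => by
            rw [Nat.ble_eq_true_of_le h] at hb
            exact Bool.noConfusion hb
          exact false_of_lamTest H D h1 hxX hT0 hT hη
            (G.abs_logError_sub_logOneSub_le H D (by omega) hr (by omega))
        · rw [hb, cond_true] at h1
          exact false_of_lamTest H D h1 hxX hT0 hT hη
            (G.abs_logError_add_le H D (by omega) hr (Nat.le_of_ble_eq_true hb))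
      · exact ih (by omega) hlt (G.succ H.root D) (by simpa only [loop, force_eq] using h2)
    · have hle := Nat.le_of_ble_eq_true hb
      have hleR : (5 * X * Q * 2 ^ p : ℝ) ≤ g := by exact_mod_cast hle
      have hlog := G.abs_log_le
      have hone := D.two_pow_lower
      have hc := H.root.log_binetCoeff_upper
      have hα := H.root.lower
      have hm₀R : (m₀ : ℝ) ≤ 700 := by exact_mod_cast (by omega : m₀ ≤ 700)
      set one : ℝ := 2 ^ p
      have hone0 : 0 < one := by linarith
      have h1 : α ^ m ≤ g / one := by
        rw [le_div_iff₀ hone0]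
        exact (mul_le_mul_of_nonneg_right hpow hone0.le).trans hleR
      have h2 := Real.log_le_log (by positivity) h1
      rw [Real.log_pow] at h2
      have h3 : (m₀ : ℝ) * Real.log α ≤ m * Real.log α :=
        mul_le_mul_of_nonneg_right (by exact_mod_cast hm₀) (by linarith [H.root.log_lower])
      have h4 : 1 / 10 * one ≤
          |Real.log (g / one) - m₀ * Real.log α - Real.log (binetCoeff k α)| * one :=
        mul_le_mul_of_nonneg_right (le_trans (by linarith) (le_abs_self _)) hone0.le
      linarith

theorem false_of_secondTest (H : AnalyticSolution k α m s x A) {x₀ : ℕ}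
    (ht : secondTest p k X x₀ = true) (hx₀ : x₀ ≤ x) (hxX : x ≤ X) (hk : k ≤ 199)
    (hp : 100 ≤ p) (hp' : p ≤ 860) : False := by
  rw [secondTest, force_eq] at ht
  obtain ⟨a, l, psi, ht, D⟩ := exists_fixedData H.root hk hp hp' ht
  simp only [force_eq] at ht
  obtain ⟨Q, hQ⟩ := exists_of_search ht
  rw [Bool.and_eq_true, Bool.and_eq_true] at hQ
  obtain ⟨⟨h1, h2⟩, h3⟩ := hQ
  have hT : 3 ^ x₀ ≤ 3 ^ x := Nat.pow_le_pow_right (by norm_num) hx₀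
  refine false_of_loop H D h1 hxX ((Nat.le_of_ble_eq_true h2).trans hT) (by positivity) hT
    (by omega) H.k_le_m ?_ h3
  have := PowerApprox.powIter H.root D (n := k) (PowerApprox.zero H.root D)
  rwa [zero_add] at this

theorem pow_le_of_firstTest (H : AnalyticSolution k α m s x A)
    (ht : firstTest p k X B = true) (hxX : x ≤ X) (hB : 8 * B ≤ X * 3 ^ x) (hk : k ≤ 199)
    (hp : 100 ≤ p) (hp' : p ≤ 860) : α ^ m ≤ B := by
  rw [firstTest] at ht
  obtain ⟨a, l, psi, ht, D⟩ := exists_fixedData H.root hk hp hp' ht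
  obtain ⟨Q, hQ⟩ := exists_of_search ht
  rw [Bool.and_eq_true] at hQ
  obtain ⟨h1, h2⟩ := hQ
  have h3 := Nat.le_of_ble_eq_true h2
  have h4 : 40 * Q ≤ 3 ^ x := by
    have hX : 0 < X := by have := H.twenty_le; omega
    refine Nat.le_of_mul_le_mul_left ?_ hX
    calc X * (40 * Q) = 8 * (5 * X * Q) := by ring
      _ ≤ X * 3 ^ x := (Nat.mul_le_mul_left 8 h3).trans hB
  refine (pow_le_of_mulSubTest H D h1 hxX h4).trans ?_
  exact_mod_cast h3

theorem of_rangeTest {test : ℕ → Bool} :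
    ∀ {n k₀ k : ℕ}, rangeTest test n k₀ = true → k₀ ≤ k → k < k₀ + n → test k = true := by
  intro n
  induction n with
  | zero => intro k₀ k _ h1 h2; omega
  | succ n ih =>
    intro k₀ k h h1 h2
    change (test k₀ && force (k₀ + 1) (rangeTest test n)) = true at h
    rw [force_eq, Bool.and_eq_true] at h
    rcases h1.eq_or_lt with rfl | h3
    · exact h.1
    · exact ih h.2 h3 (by omega)

end KernelCheck

namespace KernelCheck

set_option maxRecDepth 100000 in
theorem rangeTest_small :
    rangeTest (fun k => secondTest 110 k 512 20) 4 3 = true := by decide +kernel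

set_option maxRecDepth 100000 in
theorem rangeTest_first :
    rangeTest (fun k => firstTest 860 k (2 ^ 406) (2 ^ 824)) 197 3 = true := by decide +kernel

set_option maxRecDepth 100000 in
theorem rangeTest_from_three :
    rangeTest (fun k => secondTest 640 k (2 ^ 116 * k ^ 11) 500) 20 3 = true := by decide +kernel

set_option maxRecDepth 100000 in
theorem rangeTest_from_twenty_three :
    rangeTest (fun k => secondTest 640 k (2 ^ 116 * k ^ 11) 500) 20 23 = true := by decide +kernel

set_option maxRecDepth 100000 in
theorem rangeTest_from_forty_three :
    rangeTest (fun k => secondTest 640 k (2 ^ 116 * k ^ 11) 500) 18 43 = true := by decide +kernel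

end KernelCheck

namespace AnalyticSolution
open KernelCheck
variable {k m s x A : ℕ} {α : ℝ}

theorem false_of_lt (H : AnalyticSolution k α m s x A) (hx : x < 500) : False := by
  have hk : k < 7 := by
    have h1 := H.k_le_log
    have h2 : Real.log x ≤ Real.log (2 ^ 9 : ℝ) :=
      Real.log_le_log (by exact_mod_cast H.x_pos) (by exact_mod_cast (by omega : x ≤ 2 ^ 9))
    rw [Real.log_pow] at h2
    have h3 := Real.log_two_lt_d9
    have h4 : (k : ℝ) < 7 := by push_cast at h2; linarith
    exact_mod_cast h4
  have ht := of_rangeTest rangeTest_small H.root.three_le hk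
  beta_reduce at ht
  exact false_of_secondTest H ht H.twenty_le (by omega) (by omega) (by norm_num) (by norm_num)

set_option exponentiation.threshold 1000 in
theorem log_A_le_const (H : AnalyticSolution k α m s x A) (hx : 500 ≤ x) :
    Real.log A ≤ 572 := by
  have hk : k ≤ 199 := Nat.le_of_lt_succ H.k_lt
  have h1 : α ^ m ≤ 2 ^ 824 := by
    have h2 : 2 ^ 500 ≤ 3 ^ x := (Nat.pow_le_pow_left (by norm_num) 500).trans
      (Nat.pow_le_pow_right (by norm_num) hx)
    have hB : 8 * 2 ^ 824 ≤ 2 ^ 406 * 3 ^ x :=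
      le_trans (by norm_num) (Nat.mul_le_mul_left (2 ^ 406) h2)
    have ht := of_rangeTest rangeTest_first H.root.three_le (by omega)
    beta_reduce at ht
    have := pow_le_of_firstTest H ht H.le_two_pow_four_hundred_six hB hk (by norm_num)
      (by norm_num)
    exact_mod_cast this
  have h2 := H.log_A_le_of_pow_le h1
  have h3 := Real.log_two_lt_d9
  push_cast at h2
  linarith

set_option exponentiation.threshold 1000 in
theorem elim (H : AnalyticSolution k α m s x A) : False := by
  rcases lt_or_ge x 500 with hx | hx
  · exact H.false_of_lt hx
  have hA := H.log_A_le_const hx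
  have hk := H.k_le_sixty hA
  have hk3 := H.root.three_le
  have ht : secondTest 640 k (2 ^ 116 * k ^ 11) 500 = true := by
    rcases lt_or_ge k 23 with h | h
    · have := of_rangeTest rangeTest_from_three hk3 h
      beta_reduce at this; exact this
    rcases lt_or_ge k 43 with h' | h'
    · have := of_rangeTest rangeTest_from_twenty_three h h'
      beta_reduce at this; exact this
    · have := of_rangeTest rangeTest_from_forty_three h' (by omega)
      beta_reduce at this; exact this
  exact false_of_secondTest H ht hx (H.le_of_log_A_le_const hA) (by omega) (by norm_num)
    (by norm_num)

end AnalyticSolution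

/-- The Diophantine equation `(F_{m+1}^{(k)})^x − (F_{m-1}^{(k)})^x = F_n^{(k)}` has no
positive integer solutions `m, n, k, x` with `x ≥ 2` and `3 ≤ k ≤ min {m, log x}`. -/
theorem no_solutions_kFib_power_diff
    (k : ℕ) (m n : ℤ) (x : ℕ)
    (hm : 0 < m) (hn : 0 < n) (hx : 2 ≤ x)
    (hk3 : 3 ≤ k) (hkm : (k : ℤ) ≤ m) (hklog : (k : ℝ) ≤ Real.log x)
    (F : ℤ → ℤ)
    (hF0 : ∀ i : ℤ, 2 - (k : ℤ) ≤ i → i ≤ 0 → F i = 0)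
    (hF1 : F 1 = 1)
    (hFrec : ∀ i : ℤ, 2 ≤ i → F i = ∑ j ∈ Finset.Icc (1 : ℤ) (k : ℤ), F (i - j)) :
    (F (m + 1)) ^ x - (F (m - 1)) ^ x ≠ F n := by
  intro heq
  lift m to ℕ using hm.le
  obtain ⟨s, rfl⟩ : ∃ s : ℕ, n = s + 1 := ⟨(n - 1).toNat, by omega⟩
  obtain ⟨α, A, H⟩ := AnalyticSolution.of_isKFib hk3 ⟨hF0, hF1, hFrec⟩
    (by exact_mod_cast hkm) hklog heq
  exact H.elim
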